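/- Let $0<\beta<d$ and $q=\frac{d}{d-\beta}$. Then for every $f\in W^{1,1}_{\mathrm{pol}}(\mathbb{S}^d)$, the maximal function $\widetilde{\mathcal{M}}_\beta f$ is weakly differentiable and there is a constant $C=C(d,\beta)$ such that $\|\nabla \widetilde{\mathcal{M}}_\beta f\|_{L^q(\mathbb{S}^d)} \le C\, \|\nabla f\|_{L^1(\mathbb{S}^d)}$. -/

import Mathlib

open MeasureTheory Metric Filter Topology Asymptotics
open scoped ENNReal RealInnerProductSpace NNReal

noncomputable section

/-- Euclidean space `ℝⁿ`. -/
abbrev Euc (n : ℕ) : Type := EuclideanSpace ℝ (Fin n)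

/-- The unit sphere `𝕊^d ⊆ ℝ^(d+1)`. -/
abbrev Sph (d : ℕ) : Type := Metric.sphere (0 : Euc (d + 1)) 1

/-- The north pole `𝐞 = (1,0,…,0)`. -/
def npole (d : ℕ) : Sph d :=
  ⟨EuclideanSpace.single 0 1, by
    rw [mem_sphere_zero_iff_norm, EuclideanSpace.norm_single]; norm_num⟩

/-- The south pole `-𝐞`. -/
def spole (d : ℕ) : Sph d :=
  ⟨-(npole d : Euc (d + 1)), by
    rw [mem_sphere_zero_iff_norm, norm_neg, ← mem_sphere_zero_iff_norm]
    exact (npole d).2⟩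

/-- Geodesic distance on the sphere. -/
def geodist {d : ℕ} (ξ η : Sph d) : ℝ :=
  Real.arccos ⟪(ξ : Euc (d + 1)), (η : Euc (d + 1))⟫

/-- Open geodesic ball. -/
def gball {d : ℕ} (ζ : Sph d) (r : ℝ) : Set (Sph d) := {η | geodist ζ η < r}

/-- Closed geodesic ball. -/
def gcball {d : ℕ} (ζ : Sph d) (r : ℝ) : Set (Sph d) := {η | geodist ζ η ≤ r}

/-- Geodesic sphere (boundary of a geodesic ball). -/
def gsphere {d : ℕ} (ζ : Sph d) (r : ℝ) : Set (Sph d) := {η | geodist ζ η = r}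

/-- The surface measure `σ` on `𝕊^d`, as the `d`-dimensional Hausdorff measure. -/
def sphMeasure (d : ℕ) : Measure (Sph d) :=
  Measure.comap Subtype.val (MeasureTheory.Measure.hausdorffMeasure (d : ℝ))

/-- The `(d-1)`-dimensional Hausdorff measure on `𝕊^d` (surface measure of boundaries of
geodesic balls). -/
def sphBdry (d : ℕ) : Measure (Sph d) :=
  Measure.comap Subtype.val (MeasureTheory.Measure.hausdorffMeasure ((d : ℝ) - 1))

/-- Polar angle `θ(ξ) = d(𝐞, ξ)`. -/
def polarAngle {d : ℕ} (ξ : Sph d) : ℝ := geodist (npole d) ξ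

/-- `w(ξ) = min{θ(ξ), π - θ(ξ)}`. -/
def sphWidth {d : ℕ} (ξ : Sph d) : ℝ := min (polarAngle ξ) (Real.pi - polarAngle ξ)

/-- A function on the sphere is polar if it only depends on `ξ ⬝ 𝐞`. -/
def IsPolar {d : ℕ} (f : Sph d → ℝ) : Prop :=
  ∀ ξ η : Sph d,
    ⟪(ξ : Euc (d + 1)), (npole d : Euc (d + 1))⟫ =
      ⟪(η : Euc (d + 1)), (npole d : Euc (d + 1))⟫ → f ξ = f η

/-- The uncentered fractional Hardy–Littlewood maximal function `𝓜̃_β f` on `𝕊^d`. -/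
def sphMax {d : ℕ} (β : ℝ) (f : Sph d → ℝ) (ξ : Sph d) : ℝ :=
  sSup {a | ∃ ζ : Sph d, ∃ r : ℝ, 0 < r ∧ r ≤ Real.pi ∧ geodist ζ ξ ≤ r ∧
    a = r ^ β * ⨍ η in gball ζ r, |f η| ∂(sphMeasure d)}

/-- The closed ball `B̄(ζ,r)` is a best ball for `𝓜̃_β f` at `ξ`, i.e. it contains `ξ` and
realizes the supremum defining `𝓜̃_β f (ξ)`. -/
def IsBestBall {d : ℕ} (β : ℝ) (f : Sph d → ℝ) (ξ ζ : Sph d) (r : ℝ) : Prop :=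
  0 ≤ r ∧ r ≤ Real.pi ∧ geodist ζ ξ ≤ r ∧
    sphMax β f ξ = r ^ β * ⨍ η in gball ζ r, |f η| ∂(sphMeasure d)

/-- Projection onto the tangent space of the sphere at `η`. -/
def tangProj {d : ℕ} (η : Sph d) (v : Euc (d + 1)) : Euc (d + 1) :=
  v - ⟪v, (η : Euc (d + 1))⟫ • (η : Euc (d + 1))

/-- `g` is the weak (tangential) gradient of `f` on `𝕊^d`: `g` is a.e. tangent and the
integration-by-parts formula against restrictions of smooth test functions holds. -/
def HasWeakGrad {d : ℕ} (f : Sph d → ℝ) (g : Sph d → Euc (d + 1)) : Prop :=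
  (∀ᵐ η ∂(sphMeasure d), ⟪g η, (η : Euc (d + 1))⟫ = 0) ∧
  ∀ φ : Euc (d + 1) → ℝ, ContDiff ℝ (⊤ : ℕ∞) φ →
    ∫ η, φ (η : Euc (d + 1)) • g η ∂(sphMeasure d)
      = - ∫ η, f η • tangProj η (gradient φ (η : Euc (d + 1))) ∂(sphMeasure d)
        + (d : ℝ) • ∫ η, (f η * φ (η : Euc (d + 1))) • (η : Euc (d + 1)) ∂(sphMeasure d)

/-- `f ∈ W^{1,1}(𝕊^d)`, with weak gradient `g`. -/
def MemW11 {d : ℕ} (f : Sph d → ℝ) (g : Sph d → Euc (d + 1)) : Prop :=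
  Integrable f (sphMeasure d) ∧ Integrable g (sphMeasure d) ∧ HasWeakGrad f g

/-- Convergence `f_j → f` in `W^{1,1}(𝕊^d)` (with weak gradients `g_j, g`). -/
def W11Tendsto {d : ℕ} (fj : ℕ → Sph d → ℝ) (gj : ℕ → Sph d → Euc (d + 1))
    (f : Sph d → ℝ) (g : Sph d → Euc (d + 1)) : Prop :=
  Tendsto (fun j => (∫ ξ, |fj j ξ - f ξ| ∂(sphMeasure d)) +
    ∫ ξ, ‖gj j ξ - g ξ‖ ∂(sphMeasure d)) atTop (nhds 0)

/-- `u : 𝕊^d → ℝ` is differentiable at `ξ` with (tangential) gradient `G`. -/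
def HasSphereGradAt {d : ℕ} (u : Sph d → ℝ) (G : Euc (d + 1)) (ξ : Sph d) : Prop :=
  ⟪G, (ξ : Euc (d + 1))⟫ = 0 ∧
    (fun η : Sph d => u η - u ξ - ⟪G, (η : Euc (d + 1)) - (ξ : Euc (d + 1))⟫)
      =o[nhds ξ] (fun η : Sph d => dist η ξ)

/-- The unit tangent vector at `η` pointing in the direction of the geodesic from `η` to `ζ`:
`v(η,ζ) = (ζ - (η·ζ)η)/|ζ - (η·ζ)η|`. -/
def gdir {d : ℕ} (η ζ : Sph d) : Euc (d + 1) :=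
  ‖(ζ : Euc (d + 1)) - ⟪(η : Euc (d + 1)), (ζ : Euc (d + 1))⟫ • (η : Euc (d + 1))‖⁻¹ •
    ((ζ : Euc (d + 1)) - ⟪(η : Euc (d + 1)), (ζ : Euc (d + 1))⟫ • (η : Euc (d + 1)))

/-- `S(η) = (η·v(ξ,𝐞))ξ - (η·ξ)v(ξ,𝐞)`. -/
def Svec {d : ℕ} (ξ η : Sph d) : Euc (d + 1) :=
  ⟪(η : Euc (d + 1)), gdir ξ (npole d)⟫ • (ξ : Euc (d + 1)) -
    ⟪(η : Euc (d + 1)), (ξ : Euc (d + 1))⟫ • gdir ξ (npole d)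

/-- `ζ` lies on the (closed) half great circle determined by `𝐞`, `ξ` and `-𝐞`
(the one passing through `ξ`). -/
def OnHalfGreatCircle {d : ℕ} (ξ ζ : Sph d) : Prop :=
  ∃ a b : ℝ, 0 ≤ b ∧ (ζ : Euc (d + 1)) = a • (npole d : Euc (d + 1)) +
    b • ((ξ : Euc (d + 1)) -
      ⟪(ξ : Euc (d + 1)), (npole d : Euc (d + 1))⟫ • (npole d : Euc (d + 1)))

/-- `σ(r)` up to the constant `κ_{d-1}`: `∫₀^r (sin t)^{d-1} dt`. -/
def sinInt (d : ℕ) (r : ℝ) : ℝ := ∫ t in (0:ℝ)..r, (Real.sin t) ^ (d - 1)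

/-- `σ'(r)` up to the constant `κ_{d-1}`: `(sin r)^{d-1}`. -/
def sinPow (d : ℕ) (r : ℝ) : ℝ := (Real.sin r) ^ (d - 1)

/-! ### Geodesic distance -/

lemma norm_sph {d : ℕ} (ξ : Sph d) : ‖(ξ : Euc (d + 1))‖ = 1 := by
  simpa using mem_sphere_zero_iff_norm.1 ξ.2

lemma geodist_eq_angle {d : ℕ} (ξ η : Sph d) :
    geodist ξ η = InnerProductGeometry.angle (ξ : Euc (d + 1)) (η : Euc (d + 1)) := by
  simp [geodist, InnerProductGeometry.angle, norm_sph]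

lemma geodist_nonneg {d : ℕ} (ξ η : Sph d) : 0 ≤ geodist ξ η := Real.arccos_nonneg _

lemma geodist_le_pi {d : ℕ} (ξ η : Sph d) : geodist ξ η ≤ Real.pi := Real.arccos_le_pi _

lemma geodist_comm {d : ℕ} (ξ η : Sph d) : geodist ξ η = geodist η ξ := by
  simp [geodist, real_inner_comm]

lemma geodist_self {d : ℕ} (ξ : Sph d) : geodist ξ ξ = 0 := by
  simp [geodist, real_inner_self_eq_norm_sq, norm_sph]

lemma geodist_triangle {d : ℕ} (ξ η ζ : Sph d) : geodist ξ ζ ≤ geodist ξ η + geodist η ζ := by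
  simp only [geodist_eq_angle]
  exact InnerProductGeometry.angle_le_angle_add_angle _ _ _

lemma cos_geodist {d : ℕ} (ξ η : Sph d) :
    Real.cos (geodist ξ η) = ⟪(ξ : Euc (d + 1)), (η : Euc (d + 1))⟫ := by
  have h := abs_real_inner_le_norm (ξ : Euc (d + 1)) (η : Euc (d + 1))
  rw [norm_sph, norm_sph, abs_le] at h
  exact Real.cos_arccos (by linarith) (by linarith)

lemma continuous_geodist {d : ℕ} : Continuous (fun x : Sph d × Sph d => geodist x.1 x.2) := by
  unfold geodist
  fun_prop

lemma continuous_geodist_right {d : ℕ} (p : Sph d) : Continuous (fun x : Sph d => geodist p x) := by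
  unfold geodist
  fun_prop

lemma geodist_neg {d : ℕ} (p ξ : Sph d) : geodist (-p) ξ = Real.pi - geodist p ξ := by
  simp [geodist, Real.arccos_neg]

lemma geodist_eq_zero {d : ℕ} {ξ η : Sph d} (h : geodist ξ η = 0) : ξ = η := by
  have h1 := cos_geodist ξ η
  rw [h, Real.cos_zero] at h1
  exact Subtype.ext ((inner_eq_one_iff_of_norm_eq_one (norm_sph ξ) (norm_sph η)).1 h1.symm)

lemma geodist_eq_pi {d : ℕ} {ξ η : Sph d} (h : geodist ξ η = Real.pi) : η = - ξ := by
  have h2 := geodist_neg ξ η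
  rw [h, sub_self] at h2
  exact (geodist_eq_zero h2).symm

/-- The isometry of the sphere induced by a linear isometry. -/
def sphIso {d : ℕ} (T : Euc (d + 1) ≃ₗᵢ[ℝ] Euc (d + 1)) : Sph d ≃ᵢ Sph d where
  toFun ξ := ⟨T ξ, by simp [T.norm_map, norm_sph]⟩
  invFun ξ := ⟨T.symm ξ, by simp [T.symm.norm_map, norm_sph]⟩
  left_inv ξ := by simp
  right_inv ξ := by simp
  isometry_toFun := by
    intro a b
    simp only [Subtype.edist_eq]
    exact T.isometry _ _

lemma sphIso_coe {d : ℕ} (T : Euc (d + 1) ≃ₗᵢ[ℝ] Euc (d + 1)) (ξ : Sph d) :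
    ((sphIso T ξ : Sph d) : Euc (d + 1)) = T ξ := rfl

lemma geodist_sphIso {d : ℕ} (T : Euc (d + 1) ≃ₗᵢ[ℝ] Euc (d + 1)) (ξ η : Sph d) :
    geodist (sphIso T ξ) (sphIso T η) = geodist ξ η := by
  simp [geodist, sphIso_coe, T.inner_map_map]

lemma sphMeasure_eq (d : ℕ) : sphMeasure d = Measure.hausdorffMeasure (d : ℝ) := by
  have hv : MeasurableEmbedding (Subtype.val : Sph d → Euc (d + 1)) :=
    MeasurableEmbedding.subtype_coe isClosed_sphere.measurableSet
  ext s hs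
  rw [sphMeasure, hv.comap_apply]
  exact isometry_subtype_coe.hausdorffMeasure_image (Or.inl (by positivity)) s

lemma measurePreserving_sphIso {d : ℕ} (T : Euc (d + 1) ≃ₗᵢ[ℝ] Euc (d + 1)) :
    MeasurePreserving (sphIso T) (sphMeasure d) (sphMeasure d) := by
  rw [sphMeasure_eq]
  exact (sphIso T).measurePreserving_hausdorffMeasure _

lemma sph_singleton {d : ℕ} (hd : 1 ≤ d) (ξ : Sph d) : sphMeasure d {ξ} = 0 := by
  rw [sphMeasure_eq]
  have := Measure.noAtoms_hausdorff (Sph d) (d := (d : ℝ)) (by exact_mod_cast hd)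
  exact measure_singleton ξ

/-- There is a linear isometry swapping two points of the sphere. -/
lemma exists_iso_swap {d : ℕ} (ξ η : Sph d) :
    ∃ T : Euc (d + 1) ≃ₗᵢ[ℝ] Euc (d + 1), sphIso T ξ = η ∧
      ∀ p : Sph d, geodist p ξ = geodist p η → sphIso T p = p := by
  refine ⟨((ℝ ∙ ((ξ : Euc (d + 1)) - η))ᗮ).reflection, ?_, ?_⟩
  · apply Subtype.ext
    rw [sphIso_coe]
    exact Submodule.reflection_sub (by rw [norm_sph, norm_sph])
  · intro p hp
    apply Subtype.ext
    rw [sphIso_coe]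
    rw [Submodule.reflection_eq_self_iff, Submodule.mem_orthogonal_singleton_iff_inner_left,
      inner_sub_right, ← cos_geodist, ← cos_geodist, hp, sub_self]

lemma measurableSet_gball {d : ℕ} (ζ : Sph d) (r : ℝ) : MeasurableSet (gball ζ r) :=
  (isOpen_lt (continuous_geodist_right ζ) continuous_const).measurableSet

instance sph_finite (d : ℕ) : IsFiniteMeasure (sphMeasure d) := by
  constructor
  have hc : IsCompact (Set.univ : Set (Sph d)) := isCompact_univ
  refine hc.measure_lt_top_of_nhdsWithin ?_
  intro ξ _
  rw [sphMeasure_eq, nhdsWithin_univ]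
  have : Fact (Module.finrank ℝ (Euc (d + 1)) = d + 1) := ⟨by simp⟩
  have hv : ‖((-ξ : Sph d) : Euc (d + 1))‖ = 1 := norm_sph _
  let W := (ℝ ∙ ((-ξ : Sph d) : Euc (d + 1)))ᗮ
  have hW : Module.finrank ℝ W = d :=
    Submodule.finrank_orthogonal_span_singleton (by
      intro h; rw [h, norm_zero] at hv; exact zero_ne_one hv)
  have hlip : ∃ K, ∃ s ∈ 𝓝 (0 : W), LipschitzOnWith K (stereoInvFun hv) s := by
    have h1 : ContDiff ℝ 1 (fun w : W => stereoInvFunAux ((-ξ : Sph d) : Euc (d + 1)) w) :=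
      contDiff_stereoInvFunAux.comp W.subtypeL.contDiff
    obtain ⟨K, s, hs, h⟩ := h1.contDiffAt.exists_lipschitzOnWith (x := (0 : W))
    refine ⟨K, s, hs, ?_⟩
    intro x hx y hy
    have := h hx hy
    exact this
  obtain ⟨K, s, hs, hK⟩ := hlip
  have hH : (Measure.hausdorffMeasure (Module.finrank ℝ W : ℝ) : Measure W).IsAddHaarMeasure :=
    isAddHaarMeasure_hausdorffMeasure
  rw [hW] at hH
  obtain ⟨s', hs', hfin⟩ := (Measure.hausdorffMeasure (d : ℝ) : Measure W).finiteAt_nhds (0 : W)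
  refine ⟨stereoInvFun hv '' (s ∩ s'), ?_, ?_⟩
  · have ho := (isOpenEmbedding_stereographic_symm hv).isOpenMap
    have h2 := ho.image_mem_nhds (inter_mem hs hs')
    have e1 : ((stereographic hv).symm : W → Sph d) = stereoInvFun hv := rfl
    have e2 : stereoInvFun hv (0 : W) = ξ := by
      apply Subtype.ext
      rw [stereoInvFun_apply]
      simp only [Submodule.coe_zero, norm_zero]
      norm_num
      rw [smul_smul]; norm_num
    rw [e1] at h2
    rw [e2] at h2
    exact h2
  · have h3 := (hK.mono (Set.inter_subset_left (t := s'))).hausdorffMeasure_image_le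
      (d := (d : ℝ)) (by positivity)
    refine h3.trans_lt (ENNReal.mul_lt_top (by
      apply ENNReal.rpow_lt_top_of_nonneg (by positivity) (by simp)) ?_)
    exact (measure_mono Set.inter_subset_right).trans_lt hfin

/-! ### Rotations and the divergence theorem on the sphere -/

/-- The rotation by the angle `s` in the `(i,j)` coordinate plane. -/
def rotLin {n : ℕ} (i j : Fin n) (s : ℝ) : Euc n →ₗ[ℝ] Euc n where
  toFun x := x + ((Real.cos s - 1) * x i - Real.sin s * x j) • EuclideanSpace.single i (1 : ℝ)
    + (Real.sin s * x i + (Real.cos s - 1) * x j) • EuclideanSpace.single j (1 : ℝ)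
  map_add' x y := by
    ext k; simp; split_ifs <;> ring
  map_smul' c x := by
    ext k; simp; split_ifs <;> ring

lemma rotLin_apply {n : ℕ} (i j : Fin n) (s : ℝ) (x : Euc n) : rotLin i j s x =
    x + ((Real.cos s - 1) * x i - Real.sin s * x j) • EuclideanSpace.single i (1 : ℝ)
    + (Real.sin s * x i + (Real.cos s - 1) * x j) • EuclideanSpace.single j (1 : ℝ) := rfl

lemma norm_rotLin {n : ℕ} {i j : Fin n} (hij : i ≠ j) (s : ℝ) (x : Euc n) :
    ‖rotLin i j s x‖ = ‖x‖ := by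
  have key : ‖rotLin i j s x‖ ^ 2 = ‖x‖ ^ 2 := by
    rw [rotLin_apply, norm_add_sq_real, norm_add_sq_real]
    simp only [inner_add_left, inner_smul_left, inner_smul_right, norm_smul, mul_pow,
      EuclideanSpace.inner_single_right, EuclideanSpace.inner_single_left]
    simp [hij, hij.symm]
    have := Real.sin_sq_add_cos_sq s
    linear_combination (x i ^ 2 + x j ^ 2) * this
  have h1 := norm_nonneg (rotLin i j s x)
  have h2 := norm_nonneg x
  nlinarith

/-- The rotation as a linear isometry equivalence. -/
def rotIso {n : ℕ} {i j : Fin n} (hij : i ≠ j) (s : ℝ) : Euc n ≃ₗᵢ[ℝ] Euc n :=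
  LinearIsometry.toLinearIsometryEquiv ⟨rotLin i j s, norm_rotLin hij s⟩ rfl

lemma rotIso_apply {n : ℕ} {i j : Fin n} (hij : i ≠ j) (s : ℝ) (x : Euc n) :
    rotIso hij s x = rotLin i j s x := rfl

lemma hasDerivAt_rotLin {n : ℕ} (i j : Fin n) (x : Euc n) (s : ℝ) :
    HasDerivAt (fun s => rotLin i j s x)
      ((-Real.sin s * x i - Real.cos s * x j) • EuclideanSpace.single i (1 : ℝ)
        + (Real.cos s * x i - Real.sin s * x j) • EuclideanSpace.single j (1 : ℝ)) s := by
  simp only [rotLin_apply]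
  have h1 : HasDerivAt (fun s => (Real.cos s - 1) * x i - Real.sin s * x j)
      (-Real.sin s * x i - Real.cos s * x j) s :=
    (((Real.hasDerivAt_cos s).sub_const 1).mul_const _).sub ((Real.hasDerivAt_sin s).mul_const _)
  have h2 : HasDerivAt (fun s => Real.sin s * x i + (Real.cos s - 1) * x j)
      (Real.cos s * x i - Real.sin s * x j) s := by
    have := ((Real.hasDerivAt_sin s).mul_const (x i)).add
      (((Real.hasDerivAt_cos s).sub_const 1).mul_const (x j))
    exact this.congr_deriv (by ring)
  have := ((h1.smul_const (EuclideanSpace.single i (1 : ℝ))).const_add x).add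
    (h2.smul_const (EuclideanSpace.single j (1 : ℝ)))
  exact this

lemma lipschitz_rotLin {n : ℕ} (i j : Fin n) (x : Euc n) (hx : ‖x‖ = 1) :
    LipschitzWith 4 (fun s => rotLin i j s x) := by
  refine lipschitzWith_of_nnnorm_deriv_le (fun s => (hasDerivAt_rotLin i j x s).differentiableAt) ?_
  intro s
  rw [(hasDerivAt_rotLin i j x s).deriv, ← NNReal.coe_le_coe, coe_nnnorm]
  have hi : |x i| ≤ 1 := by rw [← hx]; exact PiLp.norm_apply_le x i
  have hj : |x j| ≤ 1 := by rw [← hx]; exact PiLp.norm_apply_le x j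
  have hs := Real.abs_sin_le_one s
  have hc := Real.abs_cos_le_one s
  refine (norm_add_le _ _).trans ?_
  rw [norm_smul, norm_smul]
  simp only [EuclideanSpace.norm_single, norm_one, mul_one, Real.norm_eq_abs]
  have a1 : |(-Real.sin s * x i - Real.cos s * x j)| ≤ 2 := by
    refine (abs_sub _ _).trans ?_
    rw [abs_mul, abs_mul, abs_neg]
    nlinarith [abs_nonneg (x i), abs_nonneg (x j), abs_nonneg (Real.sin s),
      abs_nonneg (Real.cos s)]
  have a2 : |(Real.cos s * x i - Real.sin s * x j)| ≤ 2 := by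
    refine (abs_sub _ _).trans ?_
    rw [abs_mul, abs_mul]
    nlinarith [abs_nonneg (x i), abs_nonneg (x j), abs_nonneg (Real.sin s),
      abs_nonneg (Real.cos s)]
  push_cast
  linarith

lemma lipOn_mul {X : Type*} [PseudoMetricSpace X] {S : Set X} (hS : IsCompact S) {f g : X → ℝ}
    (hf : ∃ K, LipschitzOnWith K f S) (hg : ∃ K, LipschitzOnWith K g S) :
    ∃ K, LipschitzOnWith K (fun x => f x * g x) S := by
  obtain ⟨K, hf⟩ := hf
  obtain ⟨L, hg⟩ := hg
  obtain ⟨A, hA⟩ := hS.exists_bound_of_continuousOn hf.continuousOn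
  obtain ⟨B, hB⟩ := hS.exists_bound_of_continuousOn hg.continuousOn
  refine ⟨(|A| * L + |B| * K).toNNReal, ?_⟩
  refine LipschitzOnWith.of_dist_le_mul ?_
  intro x hx y hy
  rw [Real.coe_toNNReal _ (by positivity)]
  have h1 := hf.dist_le_mul x hx y hy
  have h2 := hg.dist_le_mul x hx y hy
  rw [Real.dist_eq] at *
  have h3 := (hA x hx).trans (le_abs_self A)
  have h4 := (hB y hy).trans (le_abs_self B)
  rw [Real.norm_eq_abs] at h3 h4
  have e : f x * g x - f y * g y = f x * (g x - g y) + (f x - f y) * g y := by ring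
  rw [e]
  refine (abs_add_le _ _).trans ?_
  rw [abs_mul, abs_mul]
  have := mul_le_mul h3 h2 (abs_nonneg _) (abs_nonneg _)
  have := mul_le_mul h1 h4 (abs_nonneg _) (by positivity)
  linarith

/-- Integration by parts for a rotation. -/
lemma rot_ibp {d : ℕ} {i j : Fin (d + 1)} (hij : i ≠ j) (Ψ : Euc (d + 1) → ℝ)
    (Ψ' : Sph d → ℝ) (hΨ : ∃ K, LipschitzOnWith K Ψ (Metric.sphere 0 1))
    (hm : AEStronglyMeasurable Ψ' (sphMeasure d))
    (hder : ∀ᵐ η : Sph d ∂(sphMeasure d),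
      HasDerivAt (fun s => Ψ (rotLin i j s (η : Euc (d + 1)))) (Ψ' η) 0) :
    Integrable Ψ' (sphMeasure d) ∧ ∫ η, Ψ' η ∂(sphMeasure d) = 0 := by
  obtain ⟨K, hK⟩ := hΨ
  have hc : Continuous (fun η : Sph d => Ψ η) := by
    have := continuousOn_iff_continuous_domRestrict.1 hK.continuousOn
    exact this
  have hmem : ∀ s (η : Sph d), rotLin i j s (η : Euc (d + 1)) ∈ Metric.sphere (0 : Euc (d + 1)) 1 :=
    fun s η => by rw [mem_sphere_zero_iff_norm, norm_rotLin hij, norm_sph]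
  have hF : ∀ s, Continuous (fun η : Sph d => Ψ (rotLin i j s (η : Euc (d + 1)))) := by
    intro s
    exact hc.comp (sphIso (rotIso hij s)).continuous
  have main := hasDerivAt_integral_of_dominated_loc_of_lip (μ := sphMeasure d)
    (F := fun s η => Ψ (rotLin i j s (η : Euc (d + 1)))) (F' := Ψ') (x₀ := (0 : ℝ))
    (bound := fun _ => K * 4) (s := Set.univ) univ_mem
    (Eventually.of_forall fun s => (hF s).aestronglyMeasurable) ?_ hm ?_ (integrable_const _) hder
  · refine ⟨main.1, ?_⟩
    have hconst : (fun s => ∫ η : Sph d, Ψ (rotLin i j s (η : Euc (d + 1))) ∂(sphMeasure d))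
        = fun s => ∫ η : Sph d, Ψ η ∂(sphMeasure d) := by
      funext s
      exact (measurePreserving_sphIso (rotIso hij s)).integral_comp
        (sphIso (rotIso hij s)).toHomeomorph.measurableEmbedding (fun η : Sph d => Ψ η)
    have h2 := main.2
    rw [hconst] at h2
    exact h2.unique (hasDerivAt_const _ _)
  · exact (hF 0).integrable_of_hasCompactSupport (HasCompactSupport.of_compactSpace _)
  · refine Eventually.of_forall fun η => ?_
    have h1 : LipschitzWith (K * 4) (fun s => Ψ (rotLin i j s (η : Euc (d + 1)))) := by
      rw [← lipschitzOnWith_univ]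
      exact hK.comp ((lipschitz_rotLin i j _ (norm_sph η)).lipschitzOnWith)
        (fun s _ => hmem s η)
    have e : Real.nnabs ((K : ℝ) * 4) = K * 4 := by
      ext; simp
    rw [e]
    exact h1.lipschitzOnWith

/-- The divergence theorem on the sphere, component `j`. -/
lemma sph_div {d : ℕ} (Φ : Euc (d + 1) → ℝ) (Φ' : Sph d → Euc (d + 1))
    (hΦ : ∃ K, LipschitzOnWith K Φ (Metric.sphere 0 1))
    (hm : AEStronglyMeasurable Φ' (sphMeasure d))
    (hder : ∀ᵐ η : Sph d ∂(sphMeasure d), HasGradientAt Φ (Φ' η) (η : Euc (d + 1)))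
    (j : Fin (d + 1)) :
    Integrable (fun η : Sph d => (tangProj η (Φ' η)) j) (sphMeasure d) ∧
    ∫ η : Sph d, (tangProj η (Φ' η)) j ∂(sphMeasure d)
      = d * ∫ η : Sph d, Φ η * (η : Euc (d + 1)) j ∂(sphMeasure d) := by
  have hcoord : ∀ i : Fin (d + 1), LipschitzOnWith 1 (fun x : Euc (d + 1) => x i)
      (Metric.sphere 0 1) := by
    intro i
    refine LipschitzOnWith.of_dist_le_mul ?_
    intro x _ y _
    rw [dist_eq_norm, dist_eq_norm]
    have := PiLp.norm_apply_le (x - y) i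
    simpa using this
  have hcm : ∀ i : Fin (d + 1), Continuous (fun η : Sph d => (η : Euc (d + 1)) i) := by
    intro i
    fun_prop
  have hΦc : Continuous (fun η : Sph d => Φ η) := by
    obtain ⟨K, hK⟩ := hΦ
    exact continuousOn_iff_continuous_domRestrict.1 hK.continuousOn
  have hm' : ∀ i, AEStronglyMeasurable (fun η => Φ' η i) (sphMeasure d) := by
    intro i
    exact (by fun_prop : Continuous (fun x : Euc (d + 1) => x i)).comp_aestronglyMeasurable hm
  have key : ∀ i, i ≠ j → Integrable (fun η : Sph d => -(η : Euc (d + 1)) j * Φ η +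
      (η : Euc (d + 1)) i * ((η : Euc (d + 1)) i * Φ' η j - (η : Euc (d + 1)) j * Φ' η i))
      (sphMeasure d) ∧ ∫ η : Sph d, (-(η : Euc (d + 1)) j * Φ η +
      (η : Euc (d + 1)) i * ((η : Euc (d + 1)) i * Φ' η j - (η : Euc (d + 1)) j * Φ' η i))
      ∂(sphMeasure d) = 0 := by
    intro i hij
    refine rot_ibp hij (fun x => x i * Φ x) _ (lipOn_mul (isCompact_sphere _ _) ⟨1, hcoord i⟩ hΦ)
      ?_ ?_
    · refine AEStronglyMeasurable.add ?_ ?_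
      · exact ((hcm j).neg.mul hΦc).aestronglyMeasurable
      · exact (hcm i).aestronglyMeasurable.mul
          (((hcm i).aestronglyMeasurable.mul (hm' j)).sub
            ((hcm j).aestronglyMeasurable.mul (hm' i)))
    · filter_upwards [hder] with η hη
      have h0 : rotLin i j 0 (η : Euc (d + 1)) = η := by simp [rotLin_apply]
      have hr := hasDerivAt_rotLin i j (η : Euc (d + 1)) 0
      have h1 : HasDerivAt (fun s => (rotLin i j s (η : Euc (d + 1))) i)
          (-(η : Euc (d + 1)) j) 0 := by
        have := (PiLp.proj (𝕜 := ℝ) 2 (fun _ : Fin (d + 1) => ℝ) i).hasFDerivAt.comp_hasDerivAt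
          (0 : ℝ) hr
        refine this.congr_deriv ?_
        simp [hij]
      have h2 : HasDerivAt (fun s => Φ (rotLin i j s (η : Euc (d + 1))))
          ((η : Euc (d + 1)) i * Φ' η j - (η : Euc (d + 1)) j * Φ' η i) 0 := by
        have hη' := hη.hasFDerivAt
        rw [← h0] at hη'
        have := hη'.comp_hasDerivAt (0 : ℝ) hr
        refine this.congr_deriv ?_
        simp [inner_add_right, inner_smul_right]
        simp [EuclideanSpace.inner_single_right]
        ring
      have := h1.mul h2
      rw [h0] at this
      exact this
  have hsum : ∀ η : Sph d, (tangProj η (Φ' η)) j = (∑ i ∈ Finset.univ.erase j,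
      (-(η : Euc (d + 1)) j * Φ η +
      (η : Euc (d + 1)) i * ((η : Euc (d + 1)) i * Φ' η j - (η : Euc (d + 1)) j * Φ' η i)))
      + d * (Φ η * (η : Euc (d + 1)) j) := by
    intro η
    have hn : ∑ i, (η : Euc (d + 1)) i * (η : Euc (d + 1)) i = 1 := by
      have := norm_sph η
      have h2 : ‖(η : Euc (d + 1))‖ ^ 2 = 1 := by rw [this]; norm_num
      rw [EuclideanSpace.norm_sq_eq] at h2
      simpa [sq] using h2
    have hi : ⟪Φ' η, (η : Euc (d + 1))⟫ = ∑ i, (η : Euc (d + 1)) i * Φ' η i := by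
      simp [PiLp.inner_apply]
    rw [Finset.sum_add_distrib, Finset.sum_const, Finset.card_erase_of_mem (Finset.mem_univ _),
      Finset.card_univ, Fintype.card_fin]
    have e : ∑ i ∈ Finset.univ.erase j, (η : Euc (d + 1)) i * ((η : Euc (d + 1)) i * Φ' η j -
        (η : Euc (d + 1)) j * Φ' η i) = ∑ i, (η : Euc (d + 1)) i * ((η : Euc (d + 1)) i * Φ' η j -
        (η : Euc (d + 1)) j * Φ' η i) := by
      refine Finset.sum_erase _ ?_
      ring
    have e2 : ∑ i, (η : Euc (d + 1)) i * ((η : Euc (d + 1)) i * Φ' η j -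
        (η : Euc (d + 1)) j * Φ' η i) = Φ' η j - (η : Euc (d + 1)) j * ⟪Φ' η, (η : Euc (d + 1))⟫ := by
      rw [hi, Finset.mul_sum]
      calc _ = ∑ i, ((η : Euc (d + 1)) i * (η : Euc (d + 1)) i * Φ' η j -
            (η : Euc (d + 1)) j * ((η : Euc (d + 1)) i * Φ' η i)) := by
            refine Finset.sum_congr rfl fun i _ => by ring
        _ = _ := by rw [Finset.sum_sub_distrib, ← Finset.sum_mul, hn, one_mul]
    rw [e, e2]
    simp [tangProj]
    ring
  have hI : Integrable (fun η : Sph d => Φ η * (η : Euc (d + 1)) j) (sphMeasure d) :=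
    (hΦc.mul (hcm j)).integrable_of_hasCompactSupport (HasCompactSupport.of_compactSpace _)
  have hI1 := integrable_finsetSum (μ := sphMeasure d) (Finset.univ.erase j)
    (fun i hi => (key i (Finset.ne_of_mem_erase hi)).1)
  simp_rw [hsum]
  refine ⟨hI1.add (hI.const_mul _), ?_⟩
  rw [integral_add hI1 (hI.const_mul _), integral_finsetSum _
    (fun i hi => (key i (Finset.ne_of_mem_erase hi)).1),
    Finset.sum_eq_zero (fun i hi => (key i (Finset.ne_of_mem_erase hi)).2), integral_const_mul,
    zero_add]

/-! ### The distribution of the polar angle -/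

lemma geodist_npole {d : ℕ} (ξ : Sph d) :
    geodist (npole d) ξ = Real.arccos ((ξ : Euc (d + 1)) 0) := by
  simp [geodist, npole, EuclideanSpace.inner_single_left]

lemma abs_coord_le {d : ℕ} (ξ : Sph d) (i : Fin (d + 1)) : |(ξ : Euc (d + 1)) i| ≤ 1 := by
  have := PiLp.norm_apply_le (ξ : Euc (d + 1)) i
  rwa [norm_sph ξ] at this

lemma cos_npole {d : ℕ} (ξ : Sph d) : Real.cos (geodist (npole d) ξ) = (ξ : Euc (d + 1)) 0 := by
  have := abs_le.1 (abs_coord_le ξ 0)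
  rw [geodist_npole, Real.cos_arccos this.1 this.2]

lemma hasGradientAt_comp0 {n : ℕ} (ψ : ℝ → ℝ) (ψ' : ℝ) (x : Euc (n + 1))
    (h : HasDerivAt ψ ψ' (x 0)) :
    HasGradientAt (fun x : Euc (n + 1) => ψ (x 0)) (ψ' • EuclideanSpace.single 0 (1 : ℝ)) x := by
  rw [hasGradientAt_iff_hasFDerivAt]
  have := h.comp_hasFDerivAt x
    (PiLp.proj (𝕜 := ℝ) 2 (fun _ : Fin (n + 1) => ℝ) 0).hasFDerivAt
  refine this.congr_fderiv ?_
  ext y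
  simp [inner_smul_left, EuclideanSpace.inner_single_left]

lemma tangProj_single0 {d : ℕ} (η : Sph d) (c : ℝ) :
    (tangProj η (c • EuclideanSpace.single 0 (1 : ℝ))) 0
      = c * (1 - ((η : Euc (d + 1)) 0) ^ 2) := by
  simp [tangProj, inner_smul_left, EuclideanSpace.inner_single_left]
  ring

/-- Smooth functions supported in a compact subinterval of `(0, π)`. -/
def TestF (A : ℝ → ℝ) : Prop :=
  ContDiff ℝ (⊤ : ℕ∞) A ∧ ∃ δ : ℝ, 0 < δ ∧ ∀ x, A x ≠ 0 → δ ≤ x ∧ x ≤ Real.pi - δ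

lemma TestF.comp_arccos {A : ℝ → ℝ} (hA : TestF A) :
    ContDiff ℝ (⊤ : ℕ∞) (fun t => A (Real.arccos t)) := by
  obtain ⟨hs, δ, hδ, hsupp⟩ := hA
  rw [contDiff_iff_contDiffAt]
  intro t
  by_cases h1 : t = 1
  · have : (fun t => A (Real.arccos t)) =ᶠ[𝓝 t] fun _ => 0 := by
      have hc : ∀ᶠ s in 𝓝 t, Real.arccos s < δ := by
        refine Real.continuous_arccos.continuousAt.eventually_lt continuousAt_const ?_
        rw [h1, Real.arccos_one]; exact hδ
      filter_upwards [hc] with s hs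
      by_contra h
      linarith [(hsupp _ h).1]
    exact contDiffAt_const.congr_of_eventuallyEq this
  by_cases h2 : t = -1
  · have : (fun t => A (Real.arccos t)) =ᶠ[𝓝 t] fun _ => 0 := by
      have hc : ∀ᶠ s in 𝓝 t, Real.pi - δ < Real.arccos s := by
        refine continuousAt_const.eventually_lt Real.continuous_arccos.continuousAt ?_
        rw [h2, Real.arccos_neg_one]; linarith
      filter_upwards [hc] with s hs
      by_contra h
      linarith [(hsupp _ h).2]
    exact contDiffAt_const.congr_of_eventuallyEq this
  exact hs.contDiffAt.comp t (Real.contDiffAt_arccos h2 h1)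

lemma TestF.deriv_eq_zero {A : ℝ → ℝ} (hA : TestF A) :
    ∃ δ : ℝ, 0 < δ ∧ (∀ x, A x ≠ 0 → δ ≤ x ∧ x ≤ Real.pi - δ) ∧
      ∀ x, deriv A x ≠ 0 → δ ≤ x ∧ x ≤ Real.pi - δ := by
  obtain ⟨hs, δ, hδ, hsupp⟩ := hA
  refine ⟨δ, hδ, hsupp, fun x hx => ?_⟩
  by_contra h
  apply hx
  have : A =ᶠ[𝓝 x] fun _ => 0 := by
    have hc : ∀ᶠ s in 𝓝 x, ¬ (δ ≤ s ∧ s ≤ Real.pi - δ) := by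
      have : IsClosed (Set.Icc δ (Real.pi - δ)) := isClosed_Icc
      exact this.isOpen_compl.mem_nhds h
    filter_upwards [hc] with s hs
    by_contra h'
    exact hs (hsupp _ h')
  rw [this.deriv_eq]
  simp

lemma TestF.hasDerivAt_comp_arccos {A : ℝ → ℝ} (hA : TestF A) (θ : ℝ) (h0 : 0 ≤ θ)
    (hpi : θ ≤ Real.pi) :
    ∃ c, HasDerivAt (fun t => A (Real.arccos t)) c (Real.cos θ) ∧
      c * Real.sin θ ^ 2 = - deriv A θ * Real.sin θ := by
  have hd : DifferentiableAt ℝ (fun t => A (Real.arccos t)) (Real.cos θ) :=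
    (hA.comp_arccos.differentiable (by simp)).differentiableAt
  refine ⟨_, hd.hasDerivAt, ?_⟩
  have h1 := hd.hasDerivAt.comp θ (Real.hasDerivAt_cos θ)
  by_cases hs : Real.sin θ = 0
  · simp [hs]
  have h2 : deriv A θ = deriv (fun t => A (Real.arccos t)) (Real.cos θ) * -Real.sin θ := by
    rw [← h1.deriv]
    apply Filter.EventuallyEq.deriv_eq
    have h3 : 0 < θ := by
      rcases h0.eq_or_lt with h | h
      · rw [← h] at hs; simp at hs
      · exact h
    have h4 : θ < Real.pi := by
      rcases hpi.eq_or_lt with h | h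
      · rw [h] at hs; simp at hs
      · exact h
    filter_upwards [Ioo_mem_nhds h3 h4] with s hs'
    simp [Real.arccos_cos hs'.1.le hs'.2.le]
  rw [h2]; ring

/-- The weak gradient identity tested against a polar function. -/
lemma weak_identity {d : ℕ} (f : Sph d → ℝ) (g0 : Sph d → ℝ)
    (hf : Integrable f (sphMeasure d))
    (H : ∀ φ : Euc (d + 1) → ℝ, ContDiff ℝ (⊤ : ℕ∞) φ →
      ∫ η : Sph d, φ η * g0 η ∂(sphMeasure d) =
        - ∫ η : Sph d, f η * (tangProj η (gradient φ η)) 0 ∂(sphMeasure d)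
        + d * ∫ η : Sph d, f η * φ η * (η : Euc (d + 1)) 0 ∂(sphMeasure d))
    (A : ℝ → ℝ) (hA : TestF A) :
    ∫ η : Sph d, A (geodist (npole d) η) * g0 η ∂(sphMeasure d) =
      ∫ η : Sph d, f η * (deriv A (geodist (npole d) η) * Real.sin (geodist (npole d) η)
        + d * A (geodist (npole d) η) * Real.cos (geodist (npole d) η)) ∂(sphMeasure d) := by
  have hφ : ContDiff ℝ (⊤ : ℕ∞) (fun x : Euc (d + 1) => A (Real.arccos (x 0))) := by
    have h1 := hA.comp_arccos
    have h2 : ContDiff ℝ (⊤ : ℕ∞) (fun x : Euc (d + 1) => x 0) :=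
      (PiLp.proj (𝕜 := ℝ) 2 (fun _ : Fin (d + 1) => ℝ) 0).contDiff
    exact h1.comp h2
  have hH := H _ hφ
  have hgr : ∀ η : Sph d, (tangProj η (gradient (fun x : Euc (d + 1) => A (Real.arccos (x 0))) η)) 0
      = - deriv A (geodist (npole d) η) * Real.sin (geodist (npole d) η) := by
    intro η
    obtain ⟨c, hc1, hc2⟩ := hA.hasDerivAt_comp_arccos (geodist (npole d) η) (geodist_nonneg _ _)
      (geodist_le_pi _ _)
    rw [cos_npole] at hc1
    rw [(hasGradientAt_comp0 _ _ _ hc1).gradient, tangProj_single0, ← cos_npole, ← hc2,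
      Real.sin_sq]
  simp_rw [hgr, ← geodist_npole] at hH
  rw [hH, ← integral_const_mul, ← integral_neg, ← integral_add]
  · congr 1; ext η
    rw [cos_npole]; ring
  · have hb : ∃ C, ∀ x, ‖deriv A x * Real.sin x‖ ≤ C := by
      have hcs : HasCompactSupport (fun x => deriv A x * Real.sin x) := by
        obtain ⟨δ, hδ, -, h⟩ := hA.deriv_eq_zero
        refine HasCompactSupport.intro (isCompact_Icc (a := δ) (b := Real.pi - δ)) ?_
        intro x hx
        by_contra h'
        exact hx (h x (left_ne_zero_of_mul h'))
      exact hcs.exists_bound_of_continuous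
        ((hA.1.continuous_deriv (by simp)).mul Real.continuous_sin)
    obtain ⟨C, hC⟩ := hb
    refine (hf.mul_bdd (c := C) ?_ (Eventually.of_forall fun η => ?_)).neg
    · exact (((hA.1.continuous_deriv (by simp)).neg.mul Real.continuous_sin).comp
        (continuous_geodist_right _)).aestronglyMeasurable
    · simpa using hC (geodist (npole d) η)
  · refine Integrable.const_mul ?_ _
    have hb : ∃ C, ∀ x, ‖A x‖ ≤ C := by
      have hcs : HasCompactSupport A := by
        obtain ⟨δ, hδ, h, -⟩ := hA.deriv_eq_zero
        refine HasCompactSupport.intro (isCompact_Icc (a := δ) (b := Real.pi - δ)) ?_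
        intro x hx
        by_contra h'
        exact hx (h x h')
      exact hcs.exists_bound_of_continuous hA.1.continuous
    obtain ⟨C, hC⟩ := hb
    simp_rw [mul_assoc]
    refine hf.mul_bdd (c := C) ?_ (Eventually.of_forall fun η => ?_)
    · exact ((hA.1.continuous.comp
        (continuous_geodist_right _)).mul (by fun_prop)).aestronglyMeasurable
    · rw [norm_mul, Real.norm_eq_abs, Real.norm_eq_abs]
      have := abs_coord_le η 0
      have h2 := hC (geodist (npole d) η)
      rw [Real.norm_eq_abs] at h2
      nlinarith [abs_nonneg (A (geodist (npole d) η))]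

lemma TestF.div_sin {χ : ℝ → ℝ} (h : TestF χ) (n : ℕ) :
    TestF (fun x => χ x * (Real.sin x ^ n)⁻¹) := by
  obtain ⟨hs, δ, hδ, hsupp⟩ := h
  refine ⟨?_, δ, hδ, fun x hx => hsupp x (left_ne_zero_of_mul hx)⟩
  rw [contDiff_iff_contDiffAt]
  intro x
  by_cases hx : δ ≤ x ∧ x ≤ Real.pi - δ
  · have : Real.sin x ≠ 0 := (Real.sin_pos_of_pos_of_lt_pi (by linarith) (by linarith)).ne'
    exact hs.contDiffAt.mul ((Real.contDiff_sin.contDiffAt.pow n).inv (pow_ne_zero _ this))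
  · have : (fun x => χ x * (Real.sin x ^ n)⁻¹) =ᶠ[𝓝 x] fun _ => 0 := by
      have hc : ∀ᶠ s in 𝓝 x, ¬ (δ ≤ s ∧ s ≤ Real.pi - δ) := by
        have : IsClosed (Set.Icc δ (Real.pi - δ)) := isClosed_Icc
        exact this.isOpen_compl.mem_nhds hx
      filter_upwards [hc] with s hs
      by_contra h'
      exact hs (hsupp _ (left_ne_zero_of_mul h'))
    exact contDiffAt_const.congr_of_eventuallyEq this

lemma weak_identity' {d : ℕ} (f : Sph d → ℝ) (g0 : Sph d → ℝ)
    (hf : Integrable f (sphMeasure d))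
    (H : ∀ φ : Euc (d + 1) → ℝ, ContDiff ℝ (⊤ : ℕ∞) φ →
      ∫ η : Sph d, φ η * g0 η ∂(sphMeasure d) =
        - ∫ η : Sph d, f η * (tangProj η (gradient φ η)) 0 ∂(sphMeasure d)
        + d * ∫ η : Sph d, f η * φ η * (η : Euc (d + 1)) 0 ∂(sphMeasure d))
    (χ : ℝ → ℝ) (hχ : TestF χ) :
    ∫ η : Sph d, χ (geodist (npole d) η) * (Real.sin (geodist (npole d) η) ^ d)⁻¹ * g0 η
      ∂(sphMeasure d) =
      ∫ η : Sph d, f η * (deriv χ (geodist (npole d) η) * Real.sin (geodist (npole d) η)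
        * (Real.sin (geodist (npole d) η) ^ d)⁻¹) ∂(sphMeasure d) := by
  rw [weak_identity f g0 hf H _ (hχ.div_sin d)]
  congr 1; ext η
  congr 1
  set x := geodist (npole d) η
  obtain ⟨δ, hδ, h1, h2⟩ := hχ.deriv_eq_zero
  obtain ⟨δ', hδ', h1', h2'⟩ := (hχ.div_sin d).deriv_eq_zero
  by_cases hs : Real.sin x = 0
  · have e1 : deriv χ x = 0 := by
      by_contra h
      exact (Real.sin_pos_of_pos_of_lt_pi (by linarith [(h2 x h).1]) (by linarith [(h2 x h).2])).ne' hs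
    have e2 : χ x = 0 := by
      by_contra h
      exact (Real.sin_pos_of_pos_of_lt_pi (by linarith [(h1 x h).1]) (by linarith [(h1 x h).2])).ne' hs
    simp [e2, hs]
  · have hd1 : HasDerivAt χ (deriv χ x) x :=
      (hχ.1.differentiable (by simp)).differentiableAt.hasDerivAt
    have hd2 := hd1.mul (((Real.hasDerivAt_sin x).pow d).inv (pow_ne_zero _ hs))
    have e : deriv (fun x => χ x * (Real.sin x ^ d)⁻¹) x = _ := hd2.deriv
    rw [e]
    rcases d with _ | n
    · simp
    · simp only [Nat.add_sub_cancel, Pi.pow_apply, Pi.inv_apply]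
      field_simp
      push_cast
      ring

/-! ### The distribution of the polar angle, II -/

lemma continuous_gradient {n : ℕ} {φ : Euc n → ℝ} (hφ : ContDiff ℝ (⊤ : ℕ∞) φ) :
    Continuous (gradient φ) := by
  unfold gradient
  exact (LinearIsometryEquiv.continuous _).comp (hφ.continuous_fderiv (by simp))

lemma lip_sphere_of_contDiff {n : ℕ} {φ : Euc n → ℝ} (hφ : ContDiff ℝ (⊤ : ℕ∞) φ) :
    ∃ K, LipschitzOnWith K φ (Metric.sphere 0 1) := by
  obtain ⟨K, hK⟩ := (hφ.contDiffOn (s := Metric.closedBall 0 1)).exists_lipschitzOnWith (by simp)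
    (convex_closedBall 0 1) (isCompact_closedBall 0 1)
  exact ⟨K, hK.mono Metric.sphere_subset_closedBall⟩

lemma weak_one {d : ℕ} (φ : Euc (d + 1) → ℝ) (hφ : ContDiff ℝ (⊤ : ℕ∞) φ) :
    ∫ η : Sph d, φ η * (0 : ℝ) ∂(sphMeasure d) =
        - ∫ η : Sph d, (1 : ℝ) * (tangProj η (gradient φ η)) 0 ∂(sphMeasure d)
        + d * ∫ η : Sph d, 1 * φ η * (η : Euc (d + 1)) 0 ∂(sphMeasure d) := by
  have := (sph_div φ (fun η => gradient φ η) (lip_sphere_of_contDiff hφ)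
    ((continuous_gradient hφ).comp continuous_subtype_val).aestronglyMeasurable
    (Eventually.of_forall fun η =>
      ((hφ.differentiable (by simp)).differentiableAt).hasGradientAt) 0).2
  simp only [mul_zero, integral_zero, one_mul, this]
  ring

lemma TestF.primitive {h : ℝ → ℝ} (hh : TestF h) (h0 : ∫ x in (0:ℝ)..Real.pi, h x = 0) :
    TestF (fun x => ∫ t in (0:ℝ)..x, h t) ∧ deriv (fun x => ∫ t in (0:ℝ)..x, h t) = h := by
  obtain ⟨hs, δ, hδ, hsupp⟩ := hh
  have hd : ∀ x, HasDerivAt (fun x => ∫ t in (0:ℝ)..x, h t) (h x) x := fun x =>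
    intervalIntegral.integral_hasDerivAt_right (hs.continuous.intervalIntegrable _ _)
      (hs.continuous.stronglyMeasurableAtFilter _ _) hs.continuous.continuousAt
  have hd' : deriv (fun x => ∫ t in (0:ℝ)..x, h t) = h := funext fun x => (hd x).deriv
  refine ⟨⟨?_, δ, hδ, ?_⟩, hd'⟩
  · refine contDiff_infty_iff_deriv.2 ⟨fun x => (hd x).differentiableAt, ?_⟩
    rw [hd']; exact hs
  · intro x hx
    constructor
    · by_contra hlt
      push Not at hlt
      apply hx
      have : ∀ t ∈ Set.uIcc 0 x, h t = 0 := by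
        intro t ht
        by_contra h'
        have h2 := (Set.mem_uIcc.1 ht)
        rcases h2 with h2 | h2 <;> linarith [(hsupp t h').1]
      dsimp only
      rw [intervalIntegral.integral_congr this]; simp
    · by_contra hlt
      push Not at hlt
      apply hx
      have : ∀ t ∈ Set.uIcc Real.pi x, h t = 0 := by
        intro t ht
        by_contra h'
        have h2 := (Set.mem_uIcc.1 ht)
        rcases h2 with h2 | h2 <;> linarith [(hsupp t h').2]
      have e := intervalIntegral.integral_add_adjacent_intervals
        (hs.continuous.intervalIntegrable (μ := volume) 0 Real.pi)
        (hs.continuous.intervalIntegrable Real.pi x)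
      dsimp only
      rw [← e, h0, intervalIntegral.integral_congr this]; simp

lemma TestF.const_mul {h : ℝ → ℝ} (hh : TestF h) (c : ℝ) : TestF (fun x => c * h x) := by
  obtain ⟨hs, δ, hδ, hsupp⟩ := hh
  exact ⟨contDiff_const.mul hs, δ, hδ, fun x hx => hsupp x (right_ne_zero_of_mul hx)⟩

lemma TestF.mul_smooth {h k : ℝ → ℝ} (hh : TestF h) (hk : ContDiff ℝ (⊤ : ℕ∞) k) :
    TestF (fun x => h x * k x) := by
  obtain ⟨hs, δ, hδ, hsupp⟩ := hh
  exact ⟨hs.mul hk, δ, hδ, fun x hx => hsupp x (left_ne_zero_of_mul hx)⟩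

lemma TestF.sub {h k : ℝ → ℝ} (hh : TestF h) (hk : TestF k) : TestF (fun x => h x - k x) := by
  obtain ⟨hs, δ, hδ, hsupp⟩ := hh
  obtain ⟨hs', δ', hδ', hsupp'⟩ := hk
  refine ⟨hs.sub hs', min δ δ', lt_min hδ hδ', fun x hx => ?_⟩
  by_cases h1 : h x = 0
  · have h2 : k x ≠ 0 := fun h2 => hx (by simp [h1, h2])
    have := hsupp' x h2
    exact ⟨(min_le_right _ _).trans this.1, by linarith [min_le_right δ δ']⟩
  · have := hsupp x h1
    exact ⟨(min_le_left _ _).trans this.1, by linarith [min_le_left δ δ']⟩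

lemma TestF.bound {h : ℝ → ℝ} (hh : TestF h) : ∃ C, ∀ x, |h x| ≤ C := by
  have hcs : HasCompactSupport h := by
    obtain ⟨hs, δ, hδ, hsupp⟩ := hh
    refine HasCompactSupport.intro (isCompact_Icc (a := δ) (b := Real.pi - δ)) ?_
    intro x hx
    by_contra h'
    exact hx (hsupp x h')
  exact hcs.exists_bound_of_continuous hh.1.continuous

lemma testF_bump {a b : ℝ} (ha : 0 ≤ a) (hab : a < b) (hb : b ≤ Real.pi) (n : ℕ) :
    ∃ k : ℝ → ℝ, TestF k ∧ (∀ x, 0 ≤ k x) ∧ (∀ x, k x ≤ 1) ∧ (∀ x, k x ≠ 0 → a < x ∧ x < b) ∧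
      ∀ x, |x - (a + b) / 2| ≤ (b - a) / 2 * (1 - 1 / (n + 2)) → k x = 1 := by
  set R := (b - a) / 2 with hR
  have hR0 : 0 < R := by rw [hR]; linarith
  have hn : (0 : ℝ) ≤ n := Nat.cast_nonneg n
  have h2 : (1 : ℝ) / (n + 2) < 1 := by rw [div_lt_one (by linarith)]; linarith
  have h3 : (1 : ℝ) / (n + 3) < 1 / (n + 2) := by
    apply one_div_lt_one_div_of_lt <;> linarith
  have h4 : (0 : ℝ) < 1 / (n + 3) := by positivity
  let B : ContDiffBump ((a + b) / 2) := ⟨R * (1 - 1 / (n + 2)), R * (1 - 1 / (n + 3)),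
    mul_pos hR0 (by linarith), mul_lt_mul_of_pos_left (by linarith) hR0⟩
  have hsup : ∀ x, B x ≠ 0 → |x - (a + b) / 2| < R * (1 - 1 / (n + 3)) := by
    intro x hx
    have : x ∈ Function.support B := hx
    rw [B.support_eq, Metric.mem_ball, Real.dist_eq] at this
    exact this
  have hlt : R * (1 - 1 / (n + 3)) = R - R * (1 / (n + 3)) := by ring
  have hpos : 0 < R * (1 / ((n : ℝ) + 3)) := mul_pos hR0 h4
  refine ⟨B, ⟨B.contDiff, R * (1 / (n + 3)), hpos, ?_⟩, fun x => B.nonneg, fun x => B.le_one, ?_, ?_⟩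
  · intro x hx
    have := abs_lt.1 (hsup x hx)
    constructor <;> linarith
  · intro x hx
    have := abs_lt.1 (hsup x hx)
    constructor <;> linarith
  · intro x hx
    apply B.one_of_mem_closedBall
    rw [Metric.mem_closedBall, Real.dist_eq]
    exact hx

lemma testF_bump_tendsto {a b : ℝ} (k : ℕ → ℝ → ℝ)
    (h1 : ∀ n x, k n x ≠ 0 → a < x ∧ x < b)
    (h2 : ∀ (n : ℕ) x, |x - (a + b) / 2| ≤ (b - a) / 2 * (1 - 1 / (n + 2)) → k n x = 1) (x : ℝ) :
    Tendsto (fun n => k n x) atTop (𝓝 ((Set.Ioo a b).indicator 1 x)) := by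
  by_cases hx : x ∈ Set.Ioo a b
  · rw [Set.indicator_of_mem hx]
    refine tendsto_const_nhds.congr' ?_
    have hl : Tendsto (fun n : ℕ => (b - a) / 2 * (1 - 1 / ((n : ℝ) + 2))) atTop
        (𝓝 ((b - a) / 2 * (1 - 0))) := by
      refine Tendsto.const_mul _ (tendsto_const_nhds.sub ?_)
      refine tendsto_const_nhds.div_atTop ?_
      exact tendsto_atTop_add_const_right _ _ tendsto_natCast_atTop_atTop
    have hlt : |x - (a + b) / 2| < (b - a) / 2 * (1 - 0) := by
      rw [abs_lt]; constructor <;> linarith [hx.1, hx.2]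
    filter_upwards [hl.eventually (lt_mem_nhds hlt)] with n hn
    simp [h2 n x hn.le]
  · rw [Set.indicator_of_notMem hx]
    refine tendsto_const_nhds.congr fun n => ?_
    by_contra h
    exact hx (h1 n x (Ne.symm h))

lemma exists_kappa_test {d : ℕ} (hd : 1 ≤ d) : ∃ κ : ℝ, 0 ≤ κ ∧ ∀ k : ℝ → ℝ, TestF k →
    ∫ η : Sph d, k (geodist (npole d) η) ∂(sphMeasure d)
      = κ * ∫ x in (0:ℝ)..Real.pi, k x * Real.sin x ^ (d - 1) := by
  obtain ⟨b, hb, hb0, hb1, hb2, hb3⟩ := testF_bump (le_refl (0:ℝ)) Real.pi_pos le_rfl 0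
  have hbi : 0 < ∫ x in (0:ℝ)..Real.pi, b x := by
    refine intervalIntegral.integral_pos Real.pi_pos hb.1.continuous.continuousOn
      (fun x _ => hb0 x) ⟨Real.pi / 2, ⟨by positivity, by linarith [Real.pi_pos]⟩, ?_⟩
    rw [hb3]
    · norm_num
    · simp; positivity
  let Λ : (ℝ → ℝ) → ℝ := fun h => ∫ η : Sph d, h (geodist (npole d) η) *
    (Real.sin (geodist (npole d) η) * (Real.sin (geodist (npole d) η) ^ d)⁻¹) ∂(sphMeasure d)
  have hΛ0 : ∀ h, TestF h → ∫ x in (0:ℝ)..Real.pi, h x = 0 → Λ h = 0 := by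
    intro h hh h0
    have := weak_identity' (d := d) (fun _ => 1) (fun _ => 0) (integrable_const _) weak_one _
      (hh.primitive h0).1
    rw [(hh.primitive h0).2] at this
    simp only [mul_zero, integral_zero, one_mul] at this
    simp only [Λ]
    rw [this]
    simp only [mul_assoc]
  have hI : ∀ h, TestF h → Integrable (fun η : Sph d => h (geodist (npole d) η) *
    (Real.sin (geodist (npole d) η) * (Real.sin (geodist (npole d) η) ^ d)⁻¹)) (sphMeasure d) := by
    intro h hh
    have h1 := (hh.mul_smooth Real.contDiff_sin).div_sin d
    have : Continuous (fun η : Sph d => h (geodist (npole d) η) * Real.sin (geodist (npole d) η) *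
      (Real.sin (geodist (npole d) η) ^ d)⁻¹) := h1.1.continuous.comp (continuous_geodist_right _)
    simp only [mul_assoc] at this
    exact this.integrable_of_hasCompactSupport (HasCompactSupport.of_compactSpace _)
  have hΛ : ∀ h, TestF h → Λ h = (Λ b / ∫ x in (0:ℝ)..Real.pi, b x) *
      ∫ x in (0:ℝ)..Real.pi, h x := by
    intro h hh
    set t := (∫ x in (0:ℝ)..Real.pi, h x) / ∫ x in (0:ℝ)..Real.pi, b x with ht
    have h1 := hΛ0 _ (hh.sub (hb.const_mul t)) (by
      rw [intervalIntegral.integral_sub (hh.1.continuous.intervalIntegrable _ _)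
        ((hb.1.continuous.const_mul t |>.intervalIntegrable _ _)),
        intervalIntegral.integral_const_mul, ht, div_mul_cancel₀ _ hbi.ne', sub_self])
    have h2 : Λ (fun x => h x - t * b x) = Λ h - t * Λ b := by
      simp only [Λ]
      rw [← integral_const_mul, ← integral_sub (hI h hh) ((hI b hb).const_mul t)]
      congr 1; ext η; ring
    rw [h2] at h1
    rw [sub_eq_zero.1 h1, ht]
    field_simp
  refine ⟨Λ b / ∫ x in (0:ℝ)..Real.pi, b x, div_nonneg ?_ hbi.le, ?_⟩
  · refine integral_nonneg fun η => ?_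
    have : 0 ≤ Real.sin (geodist (npole d) η) :=
      Real.sin_nonneg_of_nonneg_of_le_pi (geodist_nonneg _ _) (geodist_le_pi _ _)
    have := hb0 (geodist (npole d) η)
    dsimp only
    positivity
  · intro k hk
    rw [← hΛ _ (hk.mul_smooth (Real.contDiff_sin.pow (d - 1)))]
    simp only [Λ]
    congr 1; ext η
    set x := geodist (npole d) η
    by_cases h : k x = 0
    · simp [h]
    obtain ⟨δ, hδ, h1⟩ := hk.2
    have hs : Real.sin x ≠ 0 := (Real.sin_pos_of_pos_of_lt_pi (by linarith [(h1 x h).1])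
      (by linarith [(h1 x h).2])).ne'
    rw [mul_assoc, ← mul_assoc (Real.sin x ^ (d - 1)), ← pow_succ, Nat.sub_add_cancel hd,
      mul_inv_cancel₀ (pow_ne_zero _ hs), mul_one]

/-- The measure `sin^{d-1}` on `(0, π)`. -/
def sinMeas (d : ℕ) : Measure ℝ :=
  (volume.restrict (Set.Ioo 0 Real.pi)).withDensity (fun u => ENNReal.ofReal (Real.sin u ^ (d - 1)))

lemma sinMeas_Ioo {d : ℕ} {a b : ℝ} (ha : 0 ≤ a) (hab : a ≤ b) (hb : b ≤ Real.pi) :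
    sinMeas d (Set.Ioo a b) = ENNReal.ofReal (∫ x in a..b, Real.sin x ^ (d - 1)) := by
  rw [sinMeas, withDensity_apply _ measurableSet_Ioo, Measure.restrict_restrict measurableSet_Ioo,
    Set.inter_eq_self_of_subset_left (Set.Ioo_subset_Ioo ha hb),
    intervalIntegral.integral_of_le hab, integral_Ioc_eq_integral_Ioo,
    ofReal_integral_eq_lintegral_ofReal]
  · exact ((by fun_prop : Continuous fun x => Real.sin x ^ (d - 1)).integrableOn_Icc).mono_set
      Set.Ioo_subset_Icc_self
  · refine (ae_restrict_iff' measurableSet_Ioo).2 (Eventually.of_forall fun x hx => ?_)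
    exact pow_nonneg (Real.sin_nonneg_of_nonneg_of_le_pi (by linarith [hx.1])
      (by linarith [hx.2])) _

lemma polar_map_npole {d : ℕ} (hd : 1 ≤ d) : ∃ κ : ℝ, 0 ≤ κ ∧
    Measure.map (geodist (npole d)) (sphMeasure d) = ENNReal.ofReal κ • sinMeas d := by
  obtain ⟨κ, hκ, hk⟩ := exists_kappa_test hd
  refine ⟨κ, hκ, ?_⟩
  have hmeas : Measurable (geodist (npole d)) := (continuous_geodist_right _).measurable
  have := Measure.isFiniteMeasure_map (sphMeasure d) (geodist (npole d))
  refine Real.measure_ext_Ioo_rat fun a b => ?_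
  have hIoo : ∀ a b : ℝ, 0 ≤ a → a < b → b ≤ Real.pi →
      Measure.map (geodist (npole d)) (sphMeasure d) (Set.Ioo a b)
        = ENNReal.ofReal κ * sinMeas d (Set.Ioo a b) := by
    intro a b ha hab hb
    choose k hkT hk0 hk1 hk2 hk3 using testF_bump ha hab hb
    have t1 : Tendsto (fun n => ∫ η : Sph d, k n (geodist (npole d) η) ∂(sphMeasure d)) atTop
        (𝓝 (∫ η : Sph d, (Set.Ioo a b).indicator 1 (geodist (npole d) η) ∂(sphMeasure d))) := by
      refine tendsto_integral_of_dominated_convergence (fun _ => (1 : ℝ)) ?_ (integrable_const _)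
        ?_ ?_
      · intro n
        exact ((hkT n).1.continuous.comp (continuous_geodist_right _)).aestronglyMeasurable
      · intro n
        refine Eventually.of_forall fun η => ?_
        rw [Real.norm_eq_abs, abs_of_nonneg (hk0 _ _)]
        exact hk1 _ _
      · refine Eventually.of_forall fun η => ?_
        exact testF_bump_tendsto k hk2 hk3 _
    have t2 : Tendsto (fun n => ∫ x in (0:ℝ)..Real.pi, k n x * Real.sin x ^ (d - 1)) atTop
        (𝓝 (∫ x in (0:ℝ)..Real.pi, (Set.Ioo a b).indicator 1 x * Real.sin x ^ (d - 1))) := by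
      refine intervalIntegral.tendsto_integral_filter_of_dominated_convergence (fun _ => (1 : ℝ)) ?_
        ?_ (by simp) ?_
      · refine Eventually.of_forall fun n => ?_
        exact ((hkT n).1.continuous.mul (by fun_prop)).aestronglyMeasurable
      · refine Eventually.of_forall fun n => ?_
        refine Eventually.of_forall fun x _ => ?_
        rw [Real.norm_eq_abs, abs_mul, abs_of_nonneg (hk0 _ _), abs_pow]
        have := pow_le_one₀ (n := d - 1) (abs_nonneg _) (Real.abs_sin_le_one x)
        exact mul_le_one₀ (hk1 _ _) (by positivity) this
      · refine Eventually.of_forall fun x _ => ?_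
        exact (testF_bump_tendsto k hk2 hk3 _).mul_const _
    have e := tendsto_nhds_unique t1 ((t2.const_mul κ).congr fun n => (hk _ (hkT n)).symm)
    have e1 : (∫ η : Sph d, (Set.Ioo a b).indicator 1 (geodist (npole d) η) ∂(sphMeasure d))
        = ((sphMeasure d).map (geodist (npole d))).real (Set.Ioo a b) := by
      rw [map_measureReal_apply hmeas measurableSet_Ioo,
        ← integral_indicator_one (hmeas measurableSet_Ioo)]
      rfl
    have e2 : (∫ x in (0:ℝ)..Real.pi, (Set.Ioo a b).indicator 1 x * Real.sin x ^ (d - 1))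
        = ∫ x in a..b, Real.sin x ^ (d - 1) := by
      rw [intervalIntegral.integral_of_le Real.pi_pos.le, integral_Ioc_eq_integral_Ioo,
        intervalIntegral.integral_of_le hab.le, integral_Ioc_eq_integral_Ioo,
        ← Set.inter_eq_self_of_subset_right (Set.Ioo_subset_Ioo ha hb),
        ← setIntegral_indicator measurableSet_Ioo]
      rw [Set.inter_eq_self_of_subset_right (Set.Ioo_subset_Ioo ha hb)]
      congr 1; ext x
      by_cases hx : x ∈ Set.Ioo a b <;> simp [hx]
    rw [e1, e2] at e
    rw [sinMeas_Ioo ha hab.le hb, ← ENNReal.ofReal_mul hκ, ← e, ofReal_measureReal]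
  have hnull : ∀ x, Measure.map (geodist (npole d)) (sphMeasure d) {x} = 0 ∨ x ∈ Set.Ioo 0 Real.pi := by
    intro x
    by_cases hx : x ∈ Set.Ioo 0 Real.pi
    · exact Or.inr hx
    left
    rw [Measure.map_apply hmeas (measurableSet_singleton _)]
    have : geodist (npole d) ⁻¹' {x} ⊆ {npole d} ∪ {- npole d} := by
      intro η hη
      have hη : geodist (npole d) η = x := hη
      rw [← hη] at hx
      by_cases h0 : geodist (npole d) η = 0
      · left; exact (geodist_eq_zero h0).symm
      by_cases h1 : geodist (npole d) η = Real.pi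
      · right; exact geodist_eq_pi h1
      exact absurd ⟨lt_of_le_of_ne (geodist_nonneg _ _) (Ne.symm h0),
        lt_of_le_of_ne (geodist_le_pi _ _) h1⟩ hx
    refine measure_mono_null this (measure_union_null (sph_singleton hd _) (sph_singleton hd _))
  have hcompl : Measure.map (geodist (npole d)) (sphMeasure d) (Set.Ioo 0 Real.pi)ᶜ = 0 := by
    have h1 : Measure.map (geodist (npole d)) (sphMeasure d) ({0} ∪ {Real.pi}) = 0 := by
      refine measure_union_null ?_ ?_
      · exact (hnull 0).resolve_right (by simp)
      · exact (hnull Real.pi).resolve_right (by simp)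
    have h2 : Measure.map (geodist (npole d)) (sphMeasure d) (Set.Icc 0 Real.pi)ᶜ = 0 := by
      rw [Measure.map_apply hmeas measurableSet_Icc.compl]
      convert measure_empty (μ := sphMeasure d)
      ext η
      simpa [geodist_nonneg] using geodist_le_pi _ _
    refine measure_mono_null ?_ (measure_union_null h1 h2)
    intro x hx
    by_cases h : x ∈ Set.Icc 0 Real.pi
    · left
      by_cases h0 : x = 0
      · left; exact h0
      by_cases h3 : x = Real.pi
      · right; exact h3
      exact absurd ⟨lt_of_le_of_ne h.1 (Ne.symm h0), lt_of_le_of_ne h.2 h3⟩ hx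
    · right; exact h
  have hcompl2 : sinMeas d (Set.Ioo 0 Real.pi)ᶜ = 0 := by
    rw [sinMeas]
    refine withDensity_absolutelyContinuous _ _ ?_
    rw [Measure.restrict_apply measurableSet_Ioo.compl]; simp
  have hIntU : ∀ m : Measure ℝ, m (Set.Ioo 0 Real.pi)ᶜ = 0 →
      m (Set.Ioo (a:ℝ) b) = m (Set.Ioo (max (a:ℝ) 0) (min (b:ℝ) Real.pi)) := by
    intro m hm
    rw [← Set.Ioo_inter_Ioo, measure_inter_conull hm]
  rw [Measure.smul_apply, smul_eq_mul, hIntU _ hcompl, hIntU _ hcompl2]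
  rcases lt_or_ge (max (a:ℝ) 0) (min (b:ℝ) Real.pi) with h | h
  · exact hIoo _ _ (le_max_right _ _) h (min_le_right _ _)
  · rw [Set.Ioo_eq_empty (not_lt.2 h)]; simp

lemma polar_map {d : ℕ} (hd : 1 ≤ d) : ∃ κ : ℝ, 0 ≤ κ ∧ ∀ p : Sph d,
    Measure.map (geodist p) (sphMeasure d) = ENNReal.ofReal κ • sinMeas d := by
  obtain ⟨κ, hκ, h⟩ := polar_map_npole hd
  refine ⟨κ, hκ, fun p => ?_⟩
  obtain ⟨T, hT, -⟩ := exists_iso_swap p (npole d)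
  have : geodist p = geodist (npole d) ∘ sphIso T := by
    ext ξ
    simp only [Function.comp]
    rw [← hT, geodist_sphIso]
  rw [this, ← Measure.map_map (continuous_geodist_right _).measurable
    (sphIso T).continuous.measurable, (measurePreserving_sphIso T).map_eq, h]

/-! ### A one-dimensional du Bois-Reymond lemma -/

/-- Local integrability on `(0, π)`. -/
def LI (F : ℝ → ℝ) : Prop := ∀ δ : ℝ, 0 < δ → IntegrableOn F (Set.Icc δ (Real.pi - δ))

lemma LI.integrable_mul {F k : ℝ → ℝ} (hF : LI F) (hk : Continuous k) {δ : ℝ} (hδ : 0 < δ)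
    (hs : ∀ x, k x ≠ 0 → δ ≤ x ∧ x ≤ Real.pi - δ) : Integrable (fun x => F x * k x) := by
  have h1 : IntegrableOn (fun x => F x * k x) (Set.Icc δ (Real.pi - δ)) :=
    (hF δ hδ).mul_continuousOn hk.continuousOn isCompact_Icc
  refine (integrableOn_iff_integrable_of_support_subset ?_).1 h1
  intro x hx
  exact hs x (right_ne_zero_of_mul hx)

lemma LI.integrable_test {F k : ℝ → ℝ} (hF : LI F) (hk : TestF k) :
    Integrable (fun x => F x * k x) := by
  obtain ⟨hc, δ, hδ, hs⟩ := hk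
  exact hF.integrable_mul hc.continuous hδ hs

lemma LI.integrable_deriv {F k : ℝ → ℝ} (hF : LI F) (hk : TestF k) :
    Integrable (fun x => F x * deriv k x) := by
  obtain ⟨δ, hδ, -, hs⟩ := hk.deriv_eq_zero
  exact hF.integrable_mul (hk.1.continuous_deriv (by simp)) hδ hs

lemma LI.intervalIntegrable {F : ℝ → ℝ} (hF : LI F) {a b : ℝ} (ha : a ∈ Set.Ioo 0 Real.pi)
    (hb : b ∈ Set.Ioo 0 Real.pi) : IntervalIntegrable F volume a b := by
  rw [intervalIntegrable_iff]
  set δ := min (min a b) (Real.pi - max a b) with hδ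
  have h0 : 0 < δ := by
    refine lt_min (lt_min ha.1 hb.1) ?_
    have := max_lt ha.2 hb.2
    linarith
  refine (hF δ h0).mono_set ?_
  intro x hx
  rw [Set.uIoc, Set.mem_Ioc] at hx
  have h1 : δ ≤ min a b := min_le_left _ _
  have h2 : δ ≤ Real.pi - max a b := min_le_right _ _
  exact ⟨by linarith [hx.1], by linarith [hx.2]⟩

lemma ae_mem_Ioo_of_forall {p : ℝ → Prop}
    (h : ∀ n : ℕ, ∀ᵐ x, x ∈ Set.Icc (1 / ((n : ℝ) + 1)) (Real.pi - 1 / ((n : ℝ) + 1)) → p x) :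
    ∀ᵐ x, x ∈ Set.Ioo 0 Real.pi → p x := by
  filter_upwards [ae_all_iff.2 h] with x hx hx'
  obtain ⟨n, hn⟩ := exists_nat_one_div_lt (lt_min hx'.1 (sub_pos.2 hx'.2))
  refine hx n ⟨(hn.le.trans (min_le_left _ _)), ?_⟩
  have := hn.le.trans (min_le_right _ _)
  linarith

lemma LI.continuousOn_integral {h : ℝ → ℝ} (hh : LI h) :
    ContinuousOn (fun x => ∫ t in (Real.pi / 2)..x, h t) (Set.Ioo 0 Real.pi) := by
  intro x hx
  have hpi : Real.pi / 2 ∈ Set.Ioo 0 Real.pi := ⟨by positivity, by linarith [Real.pi_pos]⟩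
  obtain ⟨a, ha0, ha⟩ := exists_between (lt_min hx.1 hpi.1)
  obtain ⟨b, hb0, hb⟩ := exists_between (max_lt hx.2 hpi.2)
  have hab : a ≤ b := ((ha.le.trans (min_le_left _ _)).trans (le_max_left _ _)).trans hb0.le
  have := (hh.intervalIntegrable (a := a) (b := b) ⟨ha0, hab.trans_lt hb⟩
    ⟨ha0.trans_le hab, hb⟩).absolutelyContinuousOnInterval_intervalIntegral (c := Real.pi / 2) (by
      rw [Set.uIcc_of_le hab]
      exact ⟨ha.le.trans (min_le_right _ _), (le_max_right _ _).trans hb0.le⟩)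
  have h2 := this.continuousOn
  rw [Set.uIcc_of_le hab] at h2
  refine (h2.continuousAt (Icc_mem_nhds ?_ ?_)).continuousWithinAt
  · exact ha.trans_le (min_le_left _ _)
  · exact (le_max_left _ _).trans_lt hb0

lemma LI.integral_parts {h χ : ℝ → ℝ} (hh : LI h) (hχ : TestF χ) :
    ∫ x, (∫ t in (Real.pi / 2)..x, h t) * deriv χ x = - ∫ x, h x * χ x := by
  obtain ⟨δ0, hδ0, h10, h20⟩ := hχ.deriv_eq_zero
  have hpi := Real.pi_gt_three
  set δ := min δ0 1 with hδdef
  have hδ : 0 < δ := lt_min hδ0 one_pos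
  have hδ1 : δ ≤ 1 := min_le_right _ _
  have hδ' : δ ≤ δ0 := min_le_left _ _
  have h1 : ∀ x, χ x ≠ 0 → δ ≤ x ∧ x ≤ Real.pi - δ := fun x hx =>
    ⟨by linarith [(h10 x hx).1], by linarith [(h10 x hx).2]⟩
  have h2 : ∀ x, deriv χ x ≠ 0 → δ ≤ x ∧ x ≤ Real.pi - δ := fun x hx =>
    ⟨by linarith [(h20 x hx).1], by linarith [(h20 x hx).2]⟩
  set a := δ / 2
  set b := Real.pi - δ / 2
  have hab : a ≤ b := by simp only [a, b]; linarith
  have ha : a ∈ Set.Ioo 0 Real.pi := ⟨by simp only [a]; linarith, by simp only [a]; linarith⟩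
  have hb : b ∈ Set.Ioo 0 Real.pi := ⟨by simp only [b]; linarith, by simp only [b]; linarith⟩
  have hc : Real.pi / 2 ∈ Set.uIcc a b := by
    rw [Set.uIcc_of_le hab]; exact ⟨by simp only [a]; linarith, by simp only [b]; linarith⟩
  have hI := hh.intervalIntegrable ha hb
  have hAC := hI.absolutelyContinuousOnInterval_intervalIntegral hc
  have hAC2 : AbsolutelyContinuousOnInterval χ a b :=
    ((hχ.1.of_le (by simp : (1 : WithTop ℕ∞) ≤ (⊤ : ℕ∞))).contDiffOn).absolutelyContinuousOnInterval
  have key := hAC.integral_mul_deriv_eq_deriv_mul hAC2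
  have ea : χ a = 0 := by
    by_contra h'; have := (h1 a h').1; simp only [a] at this; linarith
  have eb : χ b = 0 := by
    by_contra h'; have := (h1 b h').2; simp only [b] at this; linarith
  have e1 : ∫ x, (∫ t in (Real.pi / 2)..x, h t) * deriv χ x =
      ∫ x in a..b, (∫ t in (Real.pi / 2)..x, h t) * deriv χ x := by
    rw [intervalIntegral.integral_of_le hab, setIntegral_eq_integral_of_forall_compl_eq_zero]
    intro x hx
    by_contra h'
    have := h2 x (right_ne_zero_of_mul h')
    exact hx ⟨by simp only [a]; linarith, by simp only [b]; linarith⟩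
  have e2 : ∫ x, h x * χ x = ∫ x in a..b, h x * χ x := by
    rw [intervalIntegral.integral_of_le hab, setIntegral_eq_integral_of_forall_compl_eq_zero]
    intro x hx
    by_contra h'
    have := h1 x (right_ne_zero_of_mul h')
    exact hx ⟨by simp only [a]; linarith, by simp only [b]; linarith⟩
  rw [e1, e2, key, ea, eb]
  simp only [mul_zero, sub_self, zero_sub, neg_inj]
  refine intervalIntegral.integral_congr_ae ?_
  filter_upwards [hI.ae_hasDerivAt_integral] with x hx hx'
  rw [(hx (Set.uIoc_subset_uIcc hx') _ hc).deriv]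

lemma LI.add {F G : ℝ → ℝ} (hF : LI F) (hG : LI G) : LI (fun x => F x + G x) :=
  fun δ hδ => (hF δ hδ).add (hG δ hδ)

lemma LI.of_continuousOn {F : ℝ → ℝ} (hF : ContinuousOn F (Set.Ioo 0 Real.pi)) : LI F := by
  intro δ hδ
  refine (hF.mono ?_).integrableOn_Icc
  intro x hx
  exact ⟨by linarith [hx.1], by linarith [hx.2]⟩

lemma testF_of_compact {g : ℝ → ℝ} (h1 : ContDiff ℝ (⊤ : ℕ∞) g) (h2 : HasCompactSupport g)
    (h3 : tsupport g ⊆ Set.Ioo 0 Real.pi) : TestF g := by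
  refine ⟨h1, ?_⟩
  by_cases hne : (tsupport g).Nonempty
  · obtain ⟨a, ha, ha'⟩ := h2.isCompact.exists_isMinOn hne continuousOn_id
    obtain ⟨b, hb, hb'⟩ := h2.isCompact.exists_isMaxOn hne continuousOn_id
    refine ⟨min a (Real.pi - b), lt_min (h3 ha).1 (by linarith [(h3 hb).2]), fun x hx => ?_⟩
    have hx' : x ∈ tsupport g := subset_tsupport g hx
    have i1 : a ≤ x := ha' hx'
    have i2 : x ≤ b := hb' hx'
    exact ⟨(min_le_left _ _).trans i1, by linarith [min_le_right a (Real.pi - b)]⟩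
  · refine ⟨1, one_pos, fun x hx => ?_⟩
    exact absurd ⟨x, subset_tsupport g hx⟩ hne

lemma TestF.integral_eq {h : ℝ → ℝ} (hh : TestF h) :
    ∫ x in (0:ℝ)..Real.pi, h x = ∫ x, h x := by
  obtain ⟨_, δ, hδ, hs⟩ := hh
  rw [intervalIntegral.integral_of_le Real.pi_pos.le, setIntegral_eq_integral_of_forall_compl_eq_zero]
  intro x hx
  by_contra h'
  have := hs x h'
  exact hx ⟨by linarith, by linarith⟩

lemma du_bois {F h : ℝ → ℝ} (hF : LI F) (hh : LI h)
    (H : ∀ χ, TestF χ → ∫ x, F x * deriv χ x = ∫ x, h x * χ x) :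
    ∃ c : ℝ, ∀ᵐ x, x ∈ Set.Ioo 0 Real.pi → F x = c - ∫ t in (Real.pi / 2)..x, h t := by
  have hHc := hh.continuousOn_integral
  have hHL := LI.of_continuousOn hHc
  set K : ℝ → ℝ := fun x => F x + ∫ t in (Real.pi / 2)..x, h t with hK
  have hKL : LI K := hF.add hHL
  have h0 : ∀ χ, TestF χ → ∫ x, K x * deriv χ x = 0 := by
    intro χ hχ
    simp only [hK, add_mul]
    rw [integral_add (hF.integrable_deriv hχ) (hHL.integrable_deriv hχ), H χ hχ,
      hh.integral_parts hχ]
    ring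
  obtain ⟨b, hb, hb0, hb1, hb2, hb3⟩ := testF_bump (le_refl (0:ℝ)) Real.pi_pos le_rfl 0
  have hbi : 0 < ∫ x in (0:ℝ)..Real.pi, b x := by
    refine intervalIntegral.integral_pos Real.pi_pos hb.1.continuous.continuousOn
      (fun x _ => hb0 x) ⟨Real.pi / 2, ⟨by positivity, by linarith [Real.pi_pos]⟩, ?_⟩
    rw [hb3]
    · norm_num
    · simp; positivity
  set c := (∫ x, K x * b x) / ∫ x in (0:ℝ)..Real.pi, b x with hc
  refine ⟨c, ?_⟩
  have hcL : LI (fun _ => -c) := LI.of_continuousOn continuousOn_const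
  have hlast := isOpen_Ioo.ae_eq_zero_of_integral_contDiff_smul_eq_zero (μ := volume)
    (U := Set.Ioo 0 Real.pi) (f := fun x => K x + -c) ?_ ?_
  · filter_upwards [hlast] with x hx hx'
    have := hx hx'
    simp only [hK] at this
    linarith
  · rw [locallyIntegrableOn_iff isOpen_Ioo.isLocallyClosed]
    intro k hk hkc
    by_cases hne : k.Nonempty
    · obtain ⟨a, ha, ha'⟩ := hkc.exists_isMinOn hne continuousOn_id
      obtain ⟨b, hb, hb'⟩ := hkc.exists_isMaxOn hne continuousOn_id
      have := hKL.add hcL (min a (Real.pi - b)) (lt_min (hk ha).1 (by linarith [(hk hb).2]))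
      refine this.mono_set fun x hx => ?_
      have i1 : a ≤ x := ha' hx
      have i2 : x ≤ b := hb' hx
      exact ⟨(min_le_left _ _).trans i1, by linarith [min_le_right a (Real.pi - b)]⟩
    · rw [Set.not_nonempty_iff_eq_empty.1 hne]; simp
  · intro g g1 g2 g3
    have hg := testF_of_compact g1 g2 g3
    set t := (∫ x in (0:ℝ)..Real.pi, g x) / ∫ x in (0:ℝ)..Real.pi, b x with ht
    have hT := hg.sub (hb.const_mul t)
    have hprim := hT.primitive (by
      rw [intervalIntegral.integral_sub (hg.1.continuous.intervalIntegrable _ _)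
        ((hb.1.continuous.const_mul t |>.intervalIntegrable _ _)),
        intervalIntegral.integral_const_mul, ht, div_mul_cancel₀ _ hbi.ne', sub_self])
    have := h0 _ hprim.1
    rw [hprim.2] at this
    have e : ∀ x, K x * (g x - t * b x) = K x * g x - t * (K x * b x) := fun x => by ring
    simp only [e] at this
    rw [integral_sub (hKL.integrable_test hg) ((hKL.integrable_test hb).const_mul t),
      integral_const_mul] at this
    have e2 : ∀ x, g x • (K x + -c) = K x * g x - c * g x := fun x => by
      rw [smul_eq_mul]; ring
    simp only [e2]
    have hgi : Integrable g := hg.1.continuous.integrable_of_hasCompactSupport g2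
    rw [integral_sub (hKL.integrable_test hg) (hgi.const_mul c), integral_const_mul,
      ← hg.integral_eq]
    rw [hc, sub_eq_zero.1 this, ht]
    field_simp
    ring

/-! ### Reduction of a polar Sobolev function to one dimension -/

lemma polar_factor {d : ℕ} {f : Sph d → ℝ} (hp : IsPolar f)
    (hf : AEStronglyMeasurable f (sphMeasure d)) :
    ∃ F : ℝ → ℝ, Measurable F ∧ ∀ᵐ η ∂(sphMeasure d), f η = F (geodist (npole d) η) := by
  have hpol : ∀ ξ η : Sph d, geodist (npole d) ξ = geodist (npole d) η → f ξ = f η := by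
    intro ξ η h
    apply hp
    have := cos_geodist (npole d) ξ
    rw [h, cos_geodist (npole d) η] at this
    rw [real_inner_comm, ← this, real_inner_comm]
  obtain ⟨f', hf', hff⟩ := hf
  set N := toMeasurable (sphMeasure d) {η | ¬ f η = f' η} with hN
  have hN0 : sphMeasure d N = 0 := by
    rw [hN, measure_toMeasurable]; exact hff
  have hNm : MeasurableSet N := measurableSet_toMeasurable _ _
  have hZ : ∀ η ∈ Nᶜ, f η = f' η := by
    intro η hη
    by_contra h
    exact hη (subset_toMeasurable _ _ h)
  have hSB : StandardBorelSpace (Nᶜ : Set (Sph d)) := hNm.compl.standardBorel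
  let τ : (Nᶜ : Set (Sph d)) → ℝ := fun η => geodist (npole d) η.1
  have hτ : Measurable τ := (continuous_geodist_right _).measurable.comp measurable_subtype_coe
  let τ' : (Nᶜ : Set (Sph d)) → Set.range τ := Set.rangeFactorization τ
  have hτ' : Measurable τ' := hτ.subtype_mk
  let F' : Set.range τ → ℝ := fun u => f (Classical.choose u.2).1
  have hF' : ∀ η, F' (τ' η) = f η.1 := by
    intro η
    apply hpol
    exact Classical.choose_spec (τ' η).2
  have hm : Measurable F' := by
    rw [← hτ'.measurable_comp_iff_of_surjective Set.rangeFactorization_surjective]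
    have : F' ∘ τ' = fun η => f' η.1 := by
      ext η
      rw [← hZ η.1 η.2]
      exact hF' η
    rw [this]
    exact hf'.measurable.comp measurable_subtype_coe
  obtain ⟨F, hF, hFe⟩ := Measurable.exists_eq_measurable_comp (f := (Subtype.val : Set.range τ → ℝ))
    (g := F') hm
  refine ⟨F, hF, ?_⟩
  have : ∀ᵐ η ∂(sphMeasure d), η ∈ Nᶜ := by
    rw [ae_iff]; simpa using hN0
  filter_upwards [this] with η hη
  have h1 := hF' ⟨η, hη⟩
  rw [hFe] at h1
  exact h1.symm

/-- `κ` is the constant in the polar coordinates formula. -/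
def IsKappa (d : ℕ) (κ : ℝ) : Prop := ∀ p : Sph d,
    Measure.map (geodist p) (sphMeasure d) = ENNReal.ofReal κ • sinMeas d

lemma IsKappa.lintegral {d : ℕ} {κ : ℝ} (h : IsKappa d κ) (p : Sph d) {k : ℝ → ℝ≥0∞}
    (hk : Measurable k) : ∫⁻ η, k (geodist p η) ∂(sphMeasure d) =
      ENNReal.ofReal κ * ∫⁻ u in Set.Ioo 0 Real.pi, ENNReal.ofReal (Real.sin u ^ (d - 1)) * k u := by
  rw [← lintegral_map hk (continuous_geodist_right p).measurable, h p, lintegral_smul_measure,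
    sinMeas, lintegral_withDensity_eq_lintegral_mul _ (by fun_prop) hk, smul_eq_mul]
  rfl

lemma IsKappa.integrable {d : ℕ} {κ : ℝ} (h : IsKappa d κ) (hκ : 0 < κ) (p : Sph d) {k : ℝ → ℝ}
    (hk : Measurable k) : Integrable (fun η => k (geodist p η)) (sphMeasure d) ↔
      IntegrableOn (fun u => k u * Real.sin u ^ (d - 1)) (Set.Ioo 0 Real.pi) := by
  have h1 : Integrable k (Measure.map (geodist p) (sphMeasure d)) ↔
    Integrable (k ∘ geodist p) (sphMeasure d) := integrable_map_measure
      hk.aestronglyMeasurable (continuous_geodist_right p).measurable.aemeasurable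
  have h2 : Integrable (fun η => k (geodist p η)) (sphMeasure d) ↔ Integrable k
    (Measure.map (geodist p) (sphMeasure d)) := h1.symm
  rw [h2, h p, integrable_smul_measure (by simpa using hκ) (by simp), sinMeas,
    integrable_withDensity_iff (by fun_prop) (by simp), IntegrableOn]
  refine integrable_congr ?_
  refine (ae_restrict_iff' measurableSet_Ioo).2 (Eventually.of_forall fun u hu => ?_)
  dsimp only
  rw [ENNReal.toReal_ofReal (pow_nonneg (Real.sin_pos_of_pos_of_lt_pi hu.1 hu.2).le _)]

lemma IsKappa.integral {d : ℕ} {κ : ℝ} (h : IsKappa d κ) (hκ : 0 < κ) (p : Sph d) {k : ℝ → ℝ}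
    (hk : Measurable k) : ∫ η, k (geodist p η) ∂(sphMeasure d) =
      κ * ∫ u in Set.Ioo 0 Real.pi, k u * Real.sin u ^ (d - 1) := by
  rw [← integral_map (φ := geodist p) (continuous_geodist_right p).measurable.aemeasurable
    hk.aestronglyMeasurable, h p, integral_smul_measure,
    sinMeas, integral_withDensity_eq_integral_toReal_smul (by fun_prop) (by simp),
    ENNReal.toReal_ofReal hκ.le, smul_eq_mul]
  congr 1
  refine setIntegral_congr_fun measurableSet_Ioo fun u hu => ?_
  rw [ENNReal.toReal_ofReal (pow_nonneg (Real.sin_pos_of_pos_of_lt_pi hu.1 hu.2).le _), smul_eq_mul,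
    mul_comm]

lemma li_of_weight {d : ℕ} {k : ℝ → ℝ}
    (hi : IntegrableOn (fun u => k u * Real.sin u ^ (d - 1)) (Set.Ioo 0 Real.pi)) : LI k := by
  intro δ hδ
  have hsub : Set.Icc δ (Real.pi - δ) ⊆ Set.Ioo 0 Real.pi := fun x hx =>
    ⟨by linarith [hx.1], by linarith [hx.2]⟩
  have hpos : ∀ x ∈ Set.Icc δ (Real.pi - δ), Real.sin x ≠ 0 := fun x hx =>
    (Real.sin_pos_of_pos_of_lt_pi (hsub hx).1 (hsub hx).2).ne'
  have h1 := (hi.mono_set hsub).mul_continuousOn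
    (g' := fun u => (Real.sin u ^ (d - 1))⁻¹) (ContinuousOn.inv₀ (by fun_prop)
      fun x hx => pow_ne_zero _ (hpos x hx)) isCompact_Icc
  refine h1.congr_fun (fun x hx => ?_) measurableSet_Icc
  dsimp only
  rw [mul_assoc, mul_inv_cancel₀ (pow_ne_zero _ (hpos x hx)), mul_one]

/-- The Sobolev function in one variable. -/
structure OneDim (d : ℕ) (P : ℝ → ℝ) (D : ℝ → ℝ≥0∞) : Prop where
  measD : Measurable D
  measP : Measurable P
  nonneg : ∀ u, 0 ≤ P u
  cont : ContinuousOn P (Set.Ioo 0 Real.pi)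
  bound : ∀ a b, 0 < a → a ≤ b → b < Real.pi →
    ENNReal.ofReal |P b - P a| ≤ ∫⁻ u in Set.Ioc a b, D u
  fin : ∫⁻ u in Set.Ioo 0 Real.pi, ENNReal.ofReal (Real.sin u ^ (d - 1)) * D u ≠ ⊤
  integ : IntegrableOn (fun u => P u * Real.sin u ^ (d - 1)) (Set.Ioo 0 Real.pi)

lemma condExp_factor {X : Type*} [MeasurableSpace X] {μ : Measure X} [IsFiniteMeasure μ]
    {G : X → ℝ} (hG : Integrable G μ) {θ : X → ℝ} (hθ : Measurable θ) :
    ∃ h : ℝ → ℝ, Measurable h ∧ Integrable (fun x => h (θ x)) μ ∧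
      (∫⁻ x, ‖h (θ x)‖ₑ ∂μ ≤ ∫⁻ x, ‖G x‖ₑ ∂μ) ∧
      ∀ w : ℝ → ℝ, Measurable w → ∀ C : ℝ, (∀ u, |w u| ≤ C) →
        ∫ x, w (θ x) * G x ∂μ = ∫ x, w (θ x) * h (θ x) ∂μ := by
  obtain ⟨h, hhm, hhe⟩ := (stronglyMeasurable_condExp (f := G)
    (m := MeasurableSpace.comap θ Real.measurableSpace) (μ := μ)).exists_eq_measurable_comp
  have hE : ∀ η, (μ[G | MeasurableSpace.comap θ Real.measurableSpace]) η = h (θ η) :=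
    fun η => congrFun hhe η
  refine ⟨h, hhm.measurable, ?_, ?_, ?_⟩
  · exact (integrable_condExp (m := MeasurableSpace.comap θ Real.measurableSpace) (f := G)
      (μ := μ)).congr (Eventually.of_forall hE)
  · have h1 := eLpNorm_condExp_le_eLpNorm (m := MeasurableSpace.comap θ Real.measurableSpace)
      (μ := μ) (p := 1) G le_rfl
    rw [eLpNorm_one_eq_lintegral_enorm, eLpNorm_one_eq_lintegral_enorm] at h1
    simpa only [hE] using h1
  · intro w hw C hC
    have hwm : StronglyMeasurable[MeasurableSpace.comap θ Real.measurableSpace]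
        (fun η => w (θ η)) := (hw.comp (comap_measurable θ)).stronglyMeasurable
    have hi : Integrable ((fun η => w (θ η)) * G) μ :=
      hG.bdd_mul (c := C) (hw.comp hθ).aestronglyMeasurable
        (Eventually.of_forall fun η => hC _)
    have hp := condExp_mul_of_stronglyMeasurable_left hwm hi hG
    have e := integral_condExp (μ := μ) hθ.comap_le (f := (fun η => w (θ η)) * G)
    rw [integral_congr_ae hp] at e
    simp only [Pi.mul_apply, hE] at e
    exact e.symm

lemma extract {d : ℕ} (hd : 1 ≤ d) {κ : ℝ} (hκ : 0 < κ) (hK : IsKappa d κ)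
    {f : Sph d → ℝ} {g : Sph d → Euc (d + 1)} (hfg : MemW11 f g) (hpol : IsPolar f) :
    ∃ P D, OneDim d P D ∧ (∀ᵐ η ∂(sphMeasure d), |f η| = P (geodist (npole d) η)) ∧
      ENNReal.ofReal κ * ∫⁻ u in Set.Ioo 0 Real.pi, ENNReal.ofReal (Real.sin u ^ (d - 1)) * D u
        ≤ ENNReal.ofReal (∫ η, ‖g η‖ ∂(sphMeasure d)) := by
  obtain ⟨hf, hg, htan, hw⟩ := hfg
  obtain ⟨F, hFm, hFe⟩ := polar_factor hpol hf.1
  set θ : Sph d → ℝ := geodist (npole d) with hθ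
  have hθc : Continuous θ := continuous_geodist_right _
  have hθm : Measurable θ := hθc.measurable
  -- the component of the gradient
  set g0 : Sph d → ℝ := fun η => g η 0 with hg0
  have hcoordc : Continuous (fun x : Euc (d + 1) => x 0) := by fun_prop
  let L : Euc (d + 1) →L[ℝ] ℝ := PiLp.proj (𝕜 := ℝ) 2 (fun _ : Fin (d + 1) => ℝ) 0
  have hg0i : Integrable g0 (sphMeasure d) := L.integrable_comp hg
  have H : ∀ φ : Euc (d + 1) → ℝ, ContDiff ℝ (⊤ : ℕ∞) φ →
      ∫ η : Sph d, φ η * g0 η ∂(sphMeasure d) =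
        - ∫ η : Sph d, f η * (tangProj η (gradient φ η)) 0 ∂(sphMeasure d)
        + d * ∫ η : Sph d, f η * φ η * (η : Euc (d + 1)) 0 ∂(sphMeasure d) := by
    intro φ hφ
    have hφc : Continuous (fun η : Sph d => φ η) := hφ.continuous.comp continuous_subtype_val
    have hgc : Continuous (fun η : Sph d => gradient φ η) :=
      (continuous_gradient hφ).comp continuous_subtype_val
    have htc : Continuous (fun η : Sph d => tangProj η (gradient φ (η : Euc (d + 1)))) := by
      have hin : Continuous (fun η : Sph d => ⟪gradient φ (η : Euc (d + 1)), (η : Euc (d + 1))⟫) :=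
        hgc.inner continuous_subtype_val
      have hsm : Continuous (fun η : Sph d =>
          ⟪gradient φ (η : Euc (d + 1)), (η : Euc (d + 1))⟫ • (η : Euc (d + 1))) := by fun_prop
      exact hgc.sub hsm
    have hbd : ∀ {E : Type} [NormedAddCommGroup E] (k : Sph d → E), Continuous k →
        ∃ C, ∀ η, ‖k η‖ ≤ C := by
      intro E _ k hk
      obtain ⟨C, hC⟩ := isCompact_univ.exists_bound_of_continuousOn (f := k) hk.continuousOn
      exact ⟨C, fun η => hC η trivial⟩
    have i1 : Integrable (fun η : Sph d => φ η • g η) (sphMeasure d) := by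
      obtain ⟨C, hC⟩ := hbd _ hφc
      exact hg.bdd_smul C (hφc.aestronglyMeasurable) (Eventually.of_forall hC)
    have i2 : Integrable (fun η : Sph d => f η • tangProj η (gradient φ (η : Euc (d + 1))))
        (sphMeasure d) := by
      obtain ⟨C, hC⟩ := hbd _ htc
      exact hf.smul_bdd C (htc.aestronglyMeasurable) (Eventually.of_forall hC)
    have i3 : Integrable (fun η : Sph d => (f η * φ η) • (η : Euc (d + 1))) (sphMeasure d) := by
      have hc : Continuous (fun η : Sph d => φ η • (η : Euc (d + 1))) :=
        hφc.smul continuous_subtype_val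
      obtain ⟨C, hC⟩ := hbd _ hc
      simp_rw [mul_smul]
      exact hf.smul_bdd C (hc.aestronglyMeasurable) (Eventually.of_forall hC)
    have h1 := congrArg L (hw φ hφ)
    rw [← L.integral_comp_comm i1, map_add, map_neg, map_smul, ← L.integral_comp_comm i2,
      ← L.integral_comp_comm i3] at h1
    exact h1
  have hwi := weak_identity' f g0 hf H
  have hsin : ∀ η : Sph d, 0 ≤ Real.sin (θ η) := fun η =>
    Real.sin_nonneg_of_nonneg_of_le_pi (geodist_nonneg _ _) (geodist_le_pi _ _)
  have htb : ∀ᵐ η ∂(sphMeasure d), |g0 η| ≤ Real.sin (θ η) * ‖g η‖ := by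
    filter_upwards [htan] with η hη
    have e1 : g0 η = ⟪g η, (npole d : Euc (d + 1)) - Real.cos (θ η) • (η : Euc (d + 1))⟫ := by
      rw [inner_sub_right, inner_smul_right, hη]
      simp [npole, EuclideanSpace.inner_single_right, hg0]
    have e2 : ‖(npole d : Euc (d + 1)) - Real.cos (θ η) • (η : Euc (d + 1))‖ = Real.sin (θ η) := by
      rw [← sq_eq_sq₀ (norm_nonneg _) (hsin η), norm_sub_sq_real, norm_smul, norm_sph, norm_sph,
        inner_smul_right, ← cos_geodist, Real.sin_sq]
      simp only [Real.norm_eq_abs, mul_one, sq_abs, hθ]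
      ring
    rw [e1, ← e2, mul_comm]
    exact abs_real_inner_le_norm _ _
  set G0 : Sph d → ℝ := fun η => (Real.sin (θ η))⁻¹ * g0 η with hG0
  have hG0b : ∀ᵐ η ∂(sphMeasure d), ‖G0 η‖ ≤ ‖g η‖ := by
    filter_upwards [htb] with η hη
    rw [hG0]
    dsimp only
    rw [norm_mul, norm_inv, Real.norm_eq_abs, Real.norm_eq_abs, abs_of_nonneg (hsin η)]
    rcases (hsin η).eq_or_lt with h0 | h0
    · rw [← h0]; simp
    · rw [inv_mul_le_iff₀ h0]; exact hη
  have hG0m : AEStronglyMeasurable G0 (sphMeasure d) := by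
    refine AEStronglyMeasurable.mul ?_ hg0i.1
    exact ((Real.continuous_sin.comp hθc).measurable.inv).aestronglyMeasurable
  have hG0i : Integrable G0 (sphMeasure d) := hg.mono hG0m hG0b
  -- conditional expectation
  obtain ⟨h, hhm', hhi, hhle, hhint⟩ := condExp_factor hG0i hθm
  have hhw := (hK.integrable hκ (npole d) hhm').1 hhi
  have hhL : LI h := li_of_weight hhw
  have hFi : Integrable (fun η => F (θ η)) (sphMeasure d) := hf.congr hFe
  have hFw := (hK.integrable hκ (npole d) hFm).1 hFi
  have hFL : LI F := li_of_weight hFw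
  have hkey : ∀ χ, TestF χ → ∫ x, F x * deriv χ x = ∫ x, h x * χ x := by
    intro χ hχ
    have h1 := hwi χ hχ
    -- the left side
    set w : ℝ → ℝ := fun x => χ x * Real.sin x * (Real.sin x ^ d)⁻¹ with hw'
    have hwT : TestF w := (hχ.mul_smooth Real.contDiff_sin).div_sin d
    have hsupp : ∀ u, χ u ≠ 0 → u ∈ Set.Ioo 0 Real.pi := by
      obtain ⟨δ, hδ, h2⟩ := hχ.2
      intro u hu
      exact ⟨by linarith [(h2 u hu).1], by linarith [(h2 u hu).2]⟩
    have hsupp' : ∀ u, deriv χ u ≠ 0 → u ∈ Set.Ioo 0 Real.pi := by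
      obtain ⟨δ, hδ, -, h2⟩ := hχ.deriv_eq_zero
      intro u hu
      exact ⟨by linarith [(h2 u hu).1], by linarith [(h2 u hu).2]⟩
    have hcancel : ∀ u ∈ Set.Ioo 0 Real.pi,
        Real.sin u * (Real.sin u ^ d)⁻¹ * Real.sin u ^ (d - 1) = 1 := by
      intro u hu
      have : Real.sin u ≠ 0 := (Real.sin_pos_of_pos_of_lt_pi hu.1 hu.2).ne'
      rw [mul_right_comm, ← pow_succ', Nat.sub_add_cancel hd, mul_inv_cancel₀ (pow_ne_zero _ this)]
    have l1 : ∫ η : Sph d, χ (θ η) * (Real.sin (θ η) ^ d)⁻¹ * g0 η ∂(sphMeasure d)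
        = ∫ η : Sph d, w (θ η) * h (θ η) ∂(sphMeasure d) := by
      obtain ⟨C, hC⟩ := hwT.bound
      have e := hhint w hwT.1.continuous.measurable C hC
      have e2 : ∫ η : Sph d, χ (θ η) * (Real.sin (θ η) ^ d)⁻¹ * g0 η ∂(sphMeasure d)
          = ∫ η, w (θ η) * G0 η ∂(sphMeasure d) := by
        congr 1; ext η
        simp only [hw', hG0]
        by_cases h0 : χ (θ η) = 0
        · simp [h0]
        have : Real.sin (θ η) ≠ 0 :=
          (Real.sin_pos_of_pos_of_lt_pi (hsupp _ h0).1 (hsupp _ h0).2).ne'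
        field_simp
      rw [e2, e]
    have l2 : ∫ η : Sph d, w (θ η) * h (θ η) ∂(sphMeasure d) = κ * ∫ x, h x * χ x := by
      rw [hK.integral hκ (npole d) (k := fun u => w u * h u)
        (hwT.1.continuous.measurable.mul hhm')]
      congr 1
      rw [← setIntegral_eq_integral_of_forall_compl_eq_zero (μ := volume) (f := fun x => h x * χ x) (s := Set.Ioo 0 Real.pi)]
      · refine setIntegral_congr_fun measurableSet_Ioo fun u hu => ?_
        simp only [hw']
        have := hcancel u hu
        linear_combination (χ u * h u) * this
      · intro x hx
        by_contra h'
        exact hx (hsupp x (right_ne_zero_of_mul h'))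
    have r1 : ∫ η : Sph d, f η * (deriv χ (θ η) * Real.sin (θ η)
        * (Real.sin (θ η) ^ d)⁻¹) ∂(sphMeasure d) = κ * ∫ x, F x * deriv χ x := by
      have : ∫ η : Sph d, f η * (deriv χ (θ η) * Real.sin (θ η)
        * (Real.sin (θ η) ^ d)⁻¹) ∂(sphMeasure d) = ∫ η : Sph d, F (θ η) * (deriv χ (θ η) *
        Real.sin (θ η) * (Real.sin (θ η) ^ d)⁻¹) ∂(sphMeasure d) := by
        refine integral_congr_ae ?_
        filter_upwards [hFe] with η hη
        rw [hη]
      rw [this, hK.integral hκ (npole d) (k := fun u => F u * (deriv χ u * Real.sin u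
        * (Real.sin u ^ d)⁻¹)) ?_]
      · congr 1
        rw [← setIntegral_eq_integral_of_forall_compl_eq_zero (μ := volume)
          (f := fun x => F x * deriv χ x) (s := Set.Ioo 0 Real.pi)]
        · refine setIntegral_congr_fun measurableSet_Ioo fun u hu => ?_
          have := hcancel u hu
          linear_combination (F u * deriv χ u) * this
        · intro x hx
          by_contra h'
          exact hx (hsupp' x (right_ne_zero_of_mul h'))
      · have := (hχ.1.continuous_deriv (by simp)).measurable
        fun_prop
    rw [l1, l2, r1] at h1
    exact (mul_left_cancel₀ hκ.ne' h1).symm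
  obtain ⟨c, hc⟩ := du_bois hFL hhL hkey
  set Q : ℝ → ℝ := fun x => |c - ∫ t in (Real.pi / 2)..x, h t| with hQ
  have hQc : ContinuousOn Q (Set.Ioo 0 Real.pi) :=
    (continuousOn_const.sub hhL.continuousOn_integral).abs
  set P : ℝ → ℝ := (Set.Ioo 0 Real.pi).piecewise Q 0 with hP
  have hPQ : ∀ u ∈ Set.Ioo 0 Real.pi, P u = Q u := fun u hu => Set.piecewise_eq_of_mem _ _ _ hu
  have hPm : Measurable P := hQc.measurable_piecewise continuousOn_const measurableSet_Ioo
  have hPF : ∀ᵐ u, u ∈ Set.Ioo 0 Real.pi → |F u| = P u := by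
    filter_upwards [hc] with u hu hu'
    rw [hPQ u hu', hu hu', hQ]
  have hsD : ∫⁻ η, ‖h (θ η)‖ₑ ∂(sphMeasure d) = ENNReal.ofReal κ *
      ∫⁻ u in Set.Ioo 0 Real.pi, ENNReal.ofReal (Real.sin u ^ (d - 1)) * ‖h u‖ₑ :=
    hK.lintegral (npole d) hhm'.enorm
  have hle : ∫⁻ η, ‖h (θ η)‖ₑ ∂(sphMeasure d) ≤ ENNReal.ofReal (∫ η, ‖g η‖ ∂(sphMeasure d)) := by
    refine hhle.trans ?_
    rw [ofReal_integral_norm_eq_lintegral_enorm hg]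
    refine lintegral_mono_ae ?_
    filter_upwards [hG0b] with η hη
    exact enorm_le_iff_norm_le.2 hη
  refine ⟨P, fun u => ‖h u‖ₑ, ⟨hhm'.enorm, hPm, ?_, ?_, ?_, ?_, ?_⟩, ?_, ?_⟩
  · intro u
    by_cases hu : u ∈ Set.Ioo 0 Real.pi
    · rw [hPQ u hu]; exact abs_nonneg _
    · rw [hP, Set.piecewise_eq_of_notMem _ _ _ hu]; simp
  · exact hQc.congr hPQ
  · intro a b ha hab hb
    have ha' : a ∈ Set.Ioo 0 Real.pi := ⟨ha, hab.trans_lt hb⟩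
    have hb' : b ∈ Set.Ioo 0 Real.pi := ⟨ha.trans_le hab, hb⟩
    have hpi : Real.pi / 2 ∈ Set.Ioo 0 Real.pi := ⟨by positivity, by linarith [Real.pi_pos]⟩
    rw [hPQ a ha', hPQ b hb', hQ]
    dsimp only
    have e1 : |(|c - ∫ t in (Real.pi / 2)..b, h t| - |c - ∫ t in (Real.pi / 2)..a, h t|)| ≤
        |∫ t in a..b, h t| := by
      refine (abs_abs_sub_abs_le_abs_sub _ _).trans ?_
      rw [← intervalIntegral.integral_add_adjacent_intervals (hhL.intervalIntegrable hpi ha')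
        (hhL.intervalIntegrable ha' hb')]
      rw [← abs_neg]
      apply le_of_eq
      congr 1
      ring
    refine (ENNReal.ofReal_le_ofReal e1).trans ?_
    rw [intervalIntegral.integral_of_le hab, ← Real.norm_eq_abs, ofReal_norm]
    exact enorm_integral_le_lintegral_enorm _
  · intro htop
    rw [hsD, htop, ENNReal.mul_top (by simpa using hκ)] at hle
    simp at hle
  · have : IntegrableOn (fun u => |F u| * Real.sin u ^ (d - 1)) (Set.Ioo 0 Real.pi) := by
      refine IntegrableOn.congr_fun (hFw.abs) (fun u hu => ?_) measurableSet_Ioo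
      rw [abs_mul, abs_of_nonneg (pow_nonneg (Real.sin_pos_of_pos_of_lt_pi hu.1 hu.2).le _)]
    refine Integrable.congr this ?_
    refine (ae_restrict_iff' measurableSet_Ioo).2 ?_
    filter_upwards [hPF] with u hu hu'
    rw [hu hu']
  · have h1 : ∀ᵐ u ∂(Measure.map θ (sphMeasure d)), |F u| = P u := by
      rw [hθ, hK (npole d)]
      refine Measure.ae_smul_measure ?_ _
      refine (withDensity_absolutelyContinuous _ _).ae_le ?_
      exact (ae_restrict_iff' measurableSet_Ioo).2 hPF
    filter_upwards [hFe, ae_of_ae_map hθm.aemeasurable h1] with η e1 e2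
    rw [e1, e2]
  · rw [← hsD]; exact hle

/-! ### Volumes of balls, averages -/

/-- Normalised volume of a ball of radius `r`. -/
def vv (d : ℕ) (r : ℝ) : ℝ := ∫ x in (0:ℝ)..r, Real.sin x ^ (d - 1)

/-- Lower volume constant. -/
def c1 (d : ℕ) : ℝ := (1 / 4) * (1 / (2 * Real.pi)) ^ (d - 1)

lemma c1_pos (d : ℕ) : 0 < c1 d := by unfold c1; positivity

lemma c1_le (d : ℕ) : c1 d ≤ 1 := by
  unfold c1
  have : (1 / (2 * Real.pi)) ^ (d - 1) ≤ 1 := by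
    apply pow_le_one₀ (by positivity)
    rw [div_le_one (by positivity)]
    linarith [Real.pi_gt_three]
  linarith

lemma sin_pow_ii (d : ℕ) (a b : ℝ) :
    IntervalIntegrable (fun x => Real.sin x ^ (d - 1)) volume a b :=
  (by fun_prop : Continuous fun x => Real.sin x ^ (d - 1)).intervalIntegrable _ _

lemma vv_sub (d : ℕ) (a b : ℝ) : vv d b - vv d a = ∫ x in a..b, Real.sin x ^ (d - 1) := by
  unfold vv
  rw [← intervalIntegral.integral_add_adjacent_intervals (sin_pow_ii d 0 a) (sin_pow_ii d a b)]
  ring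

lemma sin_nn {x : ℝ} (h : x ∈ Set.Icc 0 Real.pi) : 0 ≤ Real.sin x :=
  Real.sin_nonneg_of_nonneg_of_le_pi h.1 h.2

lemma vv_mono {d : ℕ} {a b : ℝ} (ha : 0 ≤ a) (hab : a ≤ b) (hb : b ≤ Real.pi) :
    vv d a ≤ vv d b := by
  rw [← sub_nonneg, vv_sub]
  exact intervalIntegral.integral_nonneg hab fun x hx =>
    pow_nonneg (sin_nn ⟨ha.trans hx.1, hx.2.trans hb⟩) _

lemma vv_sub_le {d : ℕ} {a b m : ℝ} (ha : 0 ≤ a) (hab : a ≤ b) (hb : b ≤ Real.pi)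
    (hm : ∀ x ∈ Set.Icc a b, Real.sin x ≤ m) : vv d b - vv d a ≤ (b - a) * m ^ (d - 1) := by
  rw [vv_sub]
  have h1 : ∫ x in a..b, Real.sin x ^ (d - 1) ≤ ∫ _x in a..b, m ^ (d - 1) :=
    intervalIntegral.integral_mono_on hab (sin_pow_ii d a b) (by simp) fun x hx =>
      pow_le_pow_left₀ (sin_nn ⟨ha.trans hx.1, hx.2.trans hb⟩) (hm x hx) _
  simpa using h1

lemma vv_sub_le1 {d : ℕ} {a b : ℝ} (ha : 0 ≤ a) (hab : a ≤ b) (hb : b ≤ Real.pi) :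
    vv d b - vv d a ≤ (b - a) * b ^ (d - 1) :=
  vv_sub_le ha hab hb fun x hx => (Real.sin_le (ha.trans hx.1)).trans hx.2

lemma vv_sub_le2 {d : ℕ} {a : ℝ} (ha : 0 ≤ a) (hab : a ≤ Real.pi) :
    vv d Real.pi - vv d a ≤ (Real.pi - a) * (Real.pi - a) ^ (d - 1) :=
  vv_sub_le ha hab le_rfl fun _ hx => by
    rw [← Real.sin_pi_sub]
    exact (Real.sin_le (by linarith [hx.2])).trans (by linarith [hx.1])

lemma vv_zero (d : ℕ) : vv d 0 = 0 := by simp [vv]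

lemma pow_sub_one_mul' {d : ℕ} (hd : 1 ≤ d) (b : ℝ) : b * b ^ (d - 1) = b ^ d := by
  rw [← pow_succ', Nat.sub_add_cancel hd]

lemma vv_le {d : ℕ} (hd : 1 ≤ d) {r : ℝ} (h0 : 0 ≤ r) (hr : r ≤ Real.pi) : vv d r ≤ r ^ d := by
  have := vv_sub_le1 (d := d) le_rfl h0 hr
  rwa [vv_zero, sub_zero, sub_zero, pow_sub_one_mul' hd] at this

lemma vv_ge {d : ℕ} (hd : 1 ≤ d) {r : ℝ} (h0 : 0 ≤ r) (hr : r ≤ Real.pi) :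
    c1 d * r ^ d ≤ vv d r := by
  have h1 : vv d (r / 2) ≤ vv d r := vv_mono (by linarith) (by linarith) hr
  have h2 : 0 ≤ vv d (r / 4) := by
    have := vv_mono (d := d) le_rfl (show 0 ≤ r / 4 by linarith) (by linarith)
    rwa [vv_zero] at this
  have h3 : (r / 2 - r / 4) * (r / (2 * Real.pi)) ^ (d - 1) ≤ vv d (r / 2) - vv d (r / 4) := by
    rw [vv_sub]
    have h1 : ∫ _x in (r/4)..(r/2), (r / (2 * Real.pi)) ^ (d - 1) ≤
        ∫ x in (r/4)..(r/2), Real.sin x ^ (d - 1) :=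
      intervalIntegral.integral_mono_on (by linarith) (by simp) (sin_pow_ii d _ _) fun x hx => by
        refine pow_le_pow_left₀ (by positivity) ?_ _
        refine le_trans ?_ (Real.mul_le_sin (by linarith [hx.1]) (by linarith [hx.2]))
        rw [div_mul_eq_mul_div, div_le_div_iff₀ (by positivity) (by positivity)]
        nlinarith [hx.1, Real.pi_pos]
    simpa using h1
  refine le_trans (le_of_eq ?_) (show (r / 2 - r / 4) * (r / (2 * Real.pi)) ^ (d - 1) ≤ _ by linarith)
  rw [c1, ← pow_sub_one_mul' hd r, div_pow, div_pow, one_pow]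
  ring

lemma vv_pos {d : ℕ} (hd : 1 ≤ d) {r : ℝ} (h0 : 0 < r) (hr : r ≤ Real.pi) : 0 < vv d r :=
  lt_of_lt_of_le (mul_pos (c1_pos d) (by positivity)) (vv_ge hd h0.le hr)

lemma IsKappa.ball {d : ℕ} {κ : ℝ} (hK : IsKappa d κ) (ζ : Sph d) {r : ℝ}
    (h0 : 0 ≤ r) (hr : r ≤ Real.pi) :
    sphMeasure d (gball ζ r) = ENNReal.ofReal κ * ENNReal.ofReal (vv d r) := by
  have h1 := congrArg (fun μ => μ (Set.Iio r)) (hK ζ)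
  simp only [Measure.smul_apply] at h1
  rw [Measure.map_apply (continuous_geodist_right ζ).measurable measurableSet_Iio] at h1
  have h2 : sinMeas d (Set.Iio r) = sinMeas d (Set.Ioo 0 r) := by
    unfold sinMeas
    rw [withDensity_apply _ measurableSet_Iio, withDensity_apply _ measurableSet_Ioo,
      Measure.restrict_restrict measurableSet_Iio, Measure.restrict_restrict measurableSet_Ioo]
    congr 2
    ext x
    simp only [Set.mem_inter_iff, Set.mem_Iio, Set.mem_Ioo]
    constructor
    · rintro ⟨a, b, c⟩; exact ⟨⟨b, a⟩, b, c⟩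
    · rintro ⟨⟨a, b⟩, c, e⟩; exact ⟨b, c, e⟩
  rw [h2, sinMeas_Ioo le_rfl h0 hr] at h1
  exact h1

lemma IsKappa.ball_real {d : ℕ} {κ : ℝ} (hκ : 0 < κ) (hK : IsKappa d κ) (ζ : Sph d) {r : ℝ}
    (h0 : 0 ≤ r) (hr : r ≤ Real.pi) : (sphMeasure d).real (gball ζ r) = κ * vv d r := by
  have hv : 0 ≤ vv d r := by
    have := vv_mono (d := d) le_rfl h0 hr
    rwa [vv_zero] at this
  rw [measureReal_def, hK.ball ζ h0 hr, ENNReal.toReal_mul, ENNReal.toReal_ofReal hκ.le,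
    ENNReal.toReal_ofReal hv]

/-- averages of a function over balls -/
def av {d : ℕ} (F : Sph d → ℝ) (ζ : Sph d) (r : ℝ) : ℝ := ⨍ η in gball ζ r, F η ∂(sphMeasure d)

lemma av_eq {d : ℕ} {κ : ℝ} (hκ : 0 < κ) (hK : IsKappa d κ) (F : Sph d → ℝ) (ζ : Sph d) {r : ℝ}
    (h0 : 0 ≤ r) (hr : r ≤ Real.pi) :
    av F ζ r = (∫ η in gball ζ r, F η ∂(sphMeasure d)) / (κ * vv d r) := by
  rw [av, setAverage_eq, hK.ball_real hκ ζ h0 hr, smul_eq_mul, div_eq_inv_mul]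

lemma av_nonneg {d : ℕ} {F : Sph d → ℝ} (hF : ∀ η, 0 ≤ F η) (ζ : Sph d) (r : ℝ) :
    0 ≤ av F ζ r := by
  rw [av, setAverage_eq]
  exact mul_nonneg (inv_nonneg.2 measureReal_nonneg) (integral_nonneg hF)

/-- comparison of averages over nested balls -/
lemma av_nested {d : ℕ} (hd : 1 ≤ d) {κ : ℝ} (hκ : 0 < κ) (hK : IsKappa d κ) {F : Sph d → ℝ}
    (hF : ∀ η, 0 ≤ F η) (hi : Integrable F (sphMeasure d)) {ζ ζ' : Sph d} {r r' : ℝ}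
    (h0 : 0 < r) (hr : r ≤ Real.pi) (h0' : 0 < r') (hr' : r' ≤ Real.pi)
    (hsub : gball ζ r ⊆ gball ζ' r') : av F ζ r * (vv d r / vv d r') ≤ av F ζ' r' := by
  rw [av_eq hκ hK F ζ h0.le hr, av_eq hκ hK F ζ' h0'.le hr']
  have hv := vv_pos hd h0 hr
  have hv' := vv_pos hd h0' hr'
  have h1 : ∫ η in gball ζ r, F η ∂(sphMeasure d) ≤ ∫ η in gball ζ' r', F η ∂(sphMeasure d) :=
    setIntegral_mono_set hi.integrableOn (Eventually.of_forall hF)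
      (Eventually.of_forall hsub)
  rw [div_mul_div_comm, div_le_div_iff₀ (by positivity) (by positivity)]
  calc _ = (∫ η in gball ζ r, F η ∂(sphMeasure d)) * (κ * vv d r * vv d r') := by ring
    _ ≤ (∫ η in gball ζ' r', F η ∂(sphMeasure d)) * (κ * vv d r * vv d r') := by gcongr
    _ = _ := by ring

lemma gball_subset {d : ℕ} {ζ ζ' : Sph d} {r r' : ℝ} (h : geodist ζ' ζ + r ≤ r') :
    gball ζ r ⊆ gball ζ' r' := by
  intro η hη
  have := geodist_triangle ζ' ζ η
  have h2 : geodist ζ η < r := hη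
  show geodist ζ' η < r'
  linarith

/-- enlarging a ball -/
lemma enlarge {d : ℕ} (hd : 1 ≤ d) {κ β : ℝ} (hκ : 0 < κ) (hK : IsKappa d κ) (hβ : 0 < β)
    {F : Sph d → ℝ} (hF : ∀ η, 0 ≤ F η) (hi : Integrable F (sphMeasure d)) {ζ x x' : Sph d}
    {r : ℝ} (h0 : 0 < r) (hr : r ≤ Real.pi) (hx : geodist ζ x ≤ r) :
    ∃ r', 0 < r' ∧ r' ≤ Real.pi ∧ geodist ζ x' ≤ r' ∧
      r ^ β * av F ζ r * (1 - geodist x x' / (c1 d * r)) ≤ r' ^ β * av F ζ r' := by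
  have hh := geodist_nonneg x x'
  set h := geodist x x' with hh'
  set r' := min (r + h) Real.pi with hr'
  have hrr : r ≤ r' := le_min (by linarith) hr
  have hpi : r' ≤ Real.pi := min_le_right _ _
  have h0' : 0 < r' := h0.trans_le hrr
  refine ⟨r', h0', hpi, le_min ?_ (geodist_le_pi _ _), ?_⟩
  · have := geodist_triangle ζ x x'
    linarith
  have hA := av_nonneg hF ζ r
  have h1 := av_nested hd hκ hK hF hi h0 hr h0' hpi (ζ := ζ) (ζ' := ζ)
    (gball_subset (by rw [geodist_self]; linarith))
  have h2 : 1 - h / (c1 d * r) ≤ vv d r / vv d r' := by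
    have hv' := vv_pos hd h0' hpi
    have e1 : vv d r' - vv d r ≤ h * r' ^ (d - 1) :=
      (vv_sub_le1 h0.le hrr hpi).trans (by
        have : r' - r ≤ h := by linarith [min_le_left (r + h) Real.pi]
        gcongr)
    have e2 := vv_ge hd h0'.le hpi
    have c0 := c1_pos d
    rw [le_div_iff₀ hv', sub_mul, one_mul]
    have e3 : h * r' ^ (d - 1) ≤ h / (c1 d * r) * vv d r' := by
      rw [div_mul_eq_mul_div, le_div_iff₀ (by positivity)]
      rw [← pow_sub_one_mul' hd] at e2
      have : h * r' ^ (d - 1) * (c1 d * r) ≤ h * (c1 d * (r' * r' ^ (d - 1))) := by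
        have : h * r' ^ (d - 1) * (c1 d * r) ≤ h * r' ^ (d - 1) * (c1 d * r') := by gcongr
        exact this.trans (le_of_eq (by ring))
      exact this.trans (by gcongr)
    linarith
  calc r ^ β * av F ζ r * (1 - h / (c1 d * r)) ≤ r ^ β * av F ζ r * (vv d r / vv d r') := by gcongr
    _ = r ^ β * (av F ζ r * (vv d r / vv d r')) := by ring
    _ ≤ r' ^ β * av F ζ r' := by
      refine mul_le_mul (Real.rpow_le_rpow h0.le hrr hβ.le) h1 ?_ (by positivity)
      exact mul_nonneg hA (div_nonneg (vv_pos hd h0 hr).le (vv_pos hd h0' hpi).le)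

/-! ### The maximal function along a meridian -/

/-- polar function with profile `P` -/
def pf {d : ℕ} (P : ℝ → ℝ) (p : Sph d) : Sph d → ℝ := fun η => P (geodist p η)

/-- All data: `U` is the maximal function along the meridian `γ`. -/
structure Dat (d : ℕ) (κ β : ℝ) (p : Sph d) (γ : ℝ → Sph d) (P : ℝ → ℝ) (D : ℝ → ℝ≥0∞)
    (U : ℝ → ℝ) : Prop where
  hd : 1 ≤ d
  κ0 : 0 < κ
  hK : IsKappa d κ
  β0 : 0 < β
  βd : β < d
  one : OneDim d P D
  γc : Continuous γ
  γp : ∀ θ ∈ Set.Icc 0 Real.pi, geodist p (γ θ) = θ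
  γd : ∀ s ∈ Set.Icc 0 Real.pi, ∀ t ∈ Set.Icc 0 Real.pi, geodist (γ s) (γ t) = |s - t|
  ub : ∀ θ ∈ Set.Ioo 0 Real.pi, ∀ ζ r, 0 < r → r ≤ Real.pi → geodist ζ (γ θ) ≤ r →
    r ^ β * av (pf P p) ζ r ≤ U θ
  lub : ∀ θ ∈ Set.Ioo 0 Real.pi, ∀ a, a < U θ → ∃ ζ r, 0 < r ∧ r ≤ Real.pi ∧
    geodist ζ (γ θ) ≤ r ∧ a < r ^ β * av (pf P p) ζ r

lemma pf_integrable {d : ℕ} {κ : ℝ} (hκ : 0 < κ) (hK : IsKappa d κ) {P : ℝ → ℝ} {D : ℝ → ℝ≥0∞}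
    (h : OneDim d P D) (p : Sph d) : Integrable (pf P p) (sphMeasure d) :=
  (hK.integrable hκ p h.measP).2 h.integ

lemma ball_ne_zero {d : ℕ} (hd : 1 ≤ d) {κ : ℝ} (hκ : 0 < κ) (hK : IsKappa d κ) (ζ : Sph d) {r : ℝ}
    (h0 : 0 < r) (hr : r ≤ Real.pi) : sphMeasure d (gball ζ r) ≠ 0 := by
  rw [hK.ball ζ h0.le hr]
  have := vv_pos hd h0 hr
  simp [hκ, this]

lemma small_ball {d : ℕ} (hd : 1 ≤ d) {κ : ℝ} (hκ : 0 < κ) (hK : IsKappa d κ) {P : ℝ → ℝ}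
    {D : ℝ → ℝ≥0∞} (h : OneDim d P D) (p : Sph d) {δ : ℝ} (hδ : 0 < δ) :
    ∃ M : ℝ, 0 ≤ M ∧ ∀ ξ, geodist p ξ ∈ Set.Icc δ (Real.pi - δ) → ∀ ζ r, 0 < r → r ≤ Real.pi →
      r ≤ δ / 4 → geodist ζ ξ ≤ r → av (pf P p) ζ r ≤ M := by
  have hc : ContinuousOn P (Set.Icc (δ / 2) (Real.pi - δ / 2)) :=
    h.cont.mono fun x hx => ⟨by linarith [hx.1], by linarith [hx.2]⟩
  obtain ⟨M, hM⟩ := isCompact_Icc.exists_bound_of_continuousOn hc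
  refine ⟨max M 0, le_max_right _ _, fun ξ hξ ζ r h0 hr hrδ hζ => ?_⟩
  obtain ⟨η, hη, hle⟩ := exists_setAverage_le (ball_ne_zero hd hκ hK ζ h0 hr) (measure_ne_top _ _)
    (pf_integrable hκ hK h p).integrableOn
  refine hle.trans (le_trans (le_trans (le_abs_self _) (hM (geodist p η) ?_)) (le_max_left _ _))
  have h1 : geodist ζ η < r := hη
  have h2 := geodist_triangle p ξ η
  have h3 := geodist_triangle p η ξ
  have h4 := geodist_triangle ξ ζ η
  have h5 := geodist_comm ξ ζ
  have h6 := geodist_comm ξ η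
  exact ⟨by linarith [hξ.1], by linarith [hξ.2]⟩

lemma av_le_total {d : ℕ} (hd : 1 ≤ d) {κ : ℝ} (hκ : 0 < κ) (hK : IsKappa d κ) {F : Sph d → ℝ}
    (hF : ∀ η, 0 ≤ F η) (hi : Integrable F (sphMeasure d)) (ζ : Sph d) {s r : ℝ}
    (h0 : 0 < s) (hs : s ≤ r) (hr : r ≤ Real.pi) :
    av F ζ r ≤ (∫ η, F η ∂(sphMeasure d)) / (κ * vv d s) := by
  rw [av_eq hκ hK F ζ (h0.le.trans hs) hr]
  have hv := vv_pos hd h0 (hs.trans hr)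
  have hm := vv_mono (d := d) h0.le hs hr
  exact div_le_div₀ (integral_nonneg hF) (setIntegral_le_integral hi (Eventually.of_forall hF))
    (by positivity) (by gcongr)

lemma val_bdd {d : ℕ} (hd : 1 ≤ d) {κ β : ℝ} (hκ : 0 < κ) (hK : IsKappa d κ) (hβ : 0 < β)
    {P : ℝ → ℝ} {D : ℝ → ℝ≥0∞} (h : OneDim d P D) (p : Sph d) {δ : ℝ} (hδ : 0 < δ) :
    ∃ M : ℝ, 0 ≤ M ∧ ∀ ξ, geodist p ξ ∈ Set.Icc δ (Real.pi - δ) → ∀ ζ r, 0 < r → r ≤ Real.pi →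
      geodist ζ ξ ≤ r → r ^ β * av (pf P p) ζ r ≤ M := by
  obtain ⟨M, hM0, hM⟩ := small_ball hd hκ hK h p hδ
  have hpn : ∀ η, 0 ≤ pf P p η := fun η => h.nonneg _
  have hI : 0 ≤ ∫ η, pf P p η ∂(sphMeasure d) := integral_nonneg hpn
  set M' := (∫ η, pf P p η ∂(sphMeasure d)) / (κ * vv d (δ / 4)) with hM'
  refine ⟨Real.pi ^ β * max M M', by positivity, fun ξ hξ ζ r h0 hr hζ => ?_⟩
  have h1 : r ^ β ≤ Real.pi ^ β := Real.rpow_le_rpow h0.le hr hβ.le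
  refine mul_le_mul h1 ?_ (av_nonneg hpn _ _) (by positivity)
  rcases le_total r (δ / 4) with h2 | h2
  · exact (hM ξ hξ ζ r h0 hr h2 hζ).trans (le_max_left _ _)
  · exact (av_le_total hd hκ hK hpn (pf_integrable hκ hK h p) ζ (by positivity) h2 hr).trans
      (le_max_right _ _)

section
variable {d : ℕ} {κ β : ℝ} {p : Sph d} {γ : ℝ → Sph d} {P : ℝ → ℝ} {D : ℝ → ℝ≥0∞} {U : ℝ → ℝ}

lemma Dat.nn (_h : Dat d κ β p γ P D U) (η : Sph d) : 0 ≤ pf P p η := _h.one.nonneg _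

lemma Dat.int (h : Dat d κ β p γ P D U) : Integrable (pf P p) (sphMeasure d) :=
  pf_integrable h.κ0 h.hK h.one p

lemma Dat.n0_le (h : Dat d κ β p γ P D U) {θ : ℝ} (hθ : θ ∈ Set.Ioo 0 Real.pi) :
    Real.pi ^ β * av (pf P p) p Real.pi ≤ U θ :=
  h.ub θ hθ p Real.pi Real.pi_pos le_rfl (geodist_le_pi _ _)

lemma Dat.n0_nonneg (h : Dat d κ β p γ P D U) : 0 ≤ Real.pi ^ β * av (pf P p) p Real.pi :=
  mul_nonneg (by positivity) (av_nonneg h.nn _ _)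

lemma Dat.U_nonneg (h : Dat d κ β p γ P D U) {θ : ℝ} (hθ : θ ∈ Set.Ioo 0 Real.pi) : 0 ≤ U θ :=
  h.n0_nonneg.trans (h.n0_le hθ)

lemma Dat.shift (h : Dat d κ β p γ P D U) {θ θ' : ℝ} (hθ : θ ∈ Set.Ioo 0 Real.pi)
    (hθ' : θ' ∈ Set.Ioo 0 Real.pi) {ζ : Sph d} {r : ℝ} (h0 : 0 < r) (hr : r ≤ Real.pi)
    (hζ : geodist ζ (γ θ) ≤ r) :
    r ^ β * av (pf P p) ζ r * (1 - |θ - θ'| / (c1 d * r)) ≤ U θ' := by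
  obtain ⟨r', a, b, c, e⟩ := enlarge h.hd h.κ0 h.hK h.β0 h.nn h.int h0 hr hζ (x' := γ θ')
  rw [h.γd θ (Set.Ioo_subset_Icc_self hθ) θ' (Set.Ioo_subset_Icc_self hθ')] at e
  exact e.trans (h.ub θ' hθ' ζ r' a b c)

lemma Dat.lip (h : Dat d κ β p γ P D U) {δ : ℝ} (hδ : 0 < δ) :
    ∃ K : ℝ≥0, LipschitzOnWith K U (Set.Icc δ (Real.pi - δ)) := by
  have hsub : Set.Icc δ (Real.pi - δ) ⊆ Set.Ioo 0 Real.pi := fun x hx =>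
    ⟨by linarith [hx.1], by linarith [hx.2]⟩
  have key : ∃ K : ℝ, 0 ≤ K ∧ ∀ θ ∈ Set.Icc δ (Real.pi - δ), ∀ θ' ∈ Set.Icc δ (Real.pi - δ),
      U θ ≤ U θ' + K * |θ - θ'| := by
    rcases h.n0_nonneg.eq_or_lt with hn | hn
    · refine ⟨0, le_rfl, fun θ hθ θ' hθ' => ?_⟩
      have hI : ∫ η, pf P p η ∂(sphMeasure d) ≤ 0 := by
        have h1 : av (pf P p) p Real.pi = 0 := by
          rcases mul_eq_zero.1 hn.symm with h2 | h2
          · exact absurd h2 (by positivity)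
          · exact h2
        rw [av_eq h.κ0 h.hK _ _ Real.pi_pos.le le_rfl, div_eq_zero_iff] at h1
        rcases h1 with h1 | h1
        · rw [← h1, setIntegral_congr_set (t := Set.univ), setIntegral_univ]
          have hne : ∀ᵐ η ∂(sphMeasure d), geodist p η ≠ Real.pi := by
            have : {η : Sph d | geodist p η = Real.pi} ⊆ {-p} := fun η hη => geodist_eq_pi hη
            exact measure_mono_null (fun η hη => this (by simpa using hη)) (sph_singleton h.hd (-p))
          rw [ae_eq_univ]
          refine measure_mono_null (fun η hη => ?_) hne
          intro h3
          exact hη (lt_of_le_of_ne (geodist_le_pi _ _) h3)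
        · exact absurd h1 (mul_pos h.κ0 (vv_pos h.hd Real.pi_pos le_rfl)).ne'
      have h1 : U θ ≤ 0 := by
        by_contra hU
        push Not at hU
        obtain ⟨ζ, r, h0, hr, hζ, hlt⟩ := h.lub θ (hsub hθ) 0 hU
        have := av_le_total h.hd h.κ0 h.hK h.nn h.int ζ h0 le_rfl hr
        have h2 := div_nonpos_of_nonpos_of_nonneg hI (mul_pos h.κ0 (vv_pos h.hd h0 hr)).le
        have h3 : 0 < r ^ β := by positivity
        nlinarith
      linarith [h.U_nonneg (hsub hθ')]
    · set n0 := Real.pi ^ β * av (pf P p) p Real.pi with hn0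
      obtain ⟨M, hM0, hM⟩ := small_ball h.hd h.κ0 h.hK h.one p hδ
      obtain ⟨M', hM0', hM'⟩ := val_bdd h.hd h.κ0 h.hK h.β0 h.one p hδ
      set rs := min (δ / 4) ((n0 / 2 / (M + 1)) ^ (1 / β)) with hrs
      have hrs0 : 0 < rs := lt_min (by positivity) (by positivity)
      have c0 := c1_pos d
      refine ⟨M' / (c1 d * rs), by positivity, fun θ hθ θ' hθ' => ?_⟩
      have hθi := hsub hθ
      have hγ : geodist p (γ θ) ∈ Set.Icc δ (Real.pi - δ) := by
        rw [h.γp θ (Set.Ioo_subset_Icc_self hθi)]; exact hθ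
      refine le_of_forall_lt fun a ha => ?_
      have hU := h.n0_le hθi
      obtain ⟨ζ, r, h0, hr, hζ, hlt⟩ := h.lub θ hθi (max a (n0 / 2))
        (max_lt ha (by linarith))
      have hrr : rs ≤ r := by
        by_contra hlt'
        push Not at hlt'
        have h1 := hM _ hγ ζ r h0 hr (hlt'.le.trans (min_le_left _ _)) hζ
        have h2 : r ^ β < n0 / 2 / (M + 1) := by
          have : r < (n0 / 2 / (M + 1)) ^ (1 / β) := hlt'.trans_le (min_le_right _ _)
          have := Real.rpow_lt_rpow h0.le this h.β0
          rwa [← Real.rpow_mul (by positivity), one_div_mul_cancel h.β0.ne', Real.rpow_one] at this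
        rw [lt_div_iff₀ (by positivity)] at h2
        have h3 : r ^ β * av (pf P p) ζ r ≤ r ^ β * (M + 1) := by gcongr; linarith
        linarith [le_max_right a (n0 / 2)]
      have h1 := h.shift hθi (hsub hθ') h0 hr hζ
      have hv := hM' _ hγ ζ r h0 hr hζ
      set val := r ^ β * av (pf P p) ζ r with hval
      have h2 : val * (|θ - θ'| / (c1 d * r)) ≤ M' / (c1 d * rs) * |θ - θ'| := by
        rw [div_mul_eq_mul_div, ← mul_div_assoc]
        gcongr
      have h3 := le_max_left a (n0 / 2)
      linarith [mul_sub val 1 (|θ - θ'| / (c1 d * r))]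
  obtain ⟨K, hK0, hK⟩ := key
  refine ⟨⟨K, hK0⟩, LipschitzOnWith.of_le_add_mul _ fun θ hθ θ' hθ' => ?_⟩
  rw [Real.dist_eq]
  exact hK θ hθ θ' hθ'

lemma deriv_bound_of_lower {U : ℝ → ℝ} {u' θ K : ℝ} (hU : HasDerivAt U u' θ)
    (h : ∀ᶠ y in 𝓝 θ, U θ - K * |y - θ| ≤ U y) : |u'| ≤ K := by
  refine le_of_forall_pos_le_add fun ε hε => ?_
  have h1 := (hasDerivAt_iff_isLittleO.1 hU).bound hε
  obtain ⟨δ, hδ, hb⟩ := Metric.eventually_nhds_iff.1 (h.and h1)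
  have key : ∀ s : ℝ, |s| = δ / 2 → -(u' * s) ≤ (K + ε) * (δ / 2) := by
    intro s hs
    have h2 := hb (y := θ + s) (by rw [Real.dist_eq, add_sub_cancel_left, hs]; linarith)
    simp only [add_sub_cancel_left, smul_eq_mul, Real.norm_eq_abs, hs] at h2
    have h3 := (abs_le.1 h2.2).2
    nlinarith [h2.1]
  have k1 := key (δ / 2) (abs_of_pos (by linarith))
  have k2 := key (-(δ / 2)) (by rw [abs_neg, abs_of_pos (by linarith)])
  rw [abs_le]
  constructor <;> nlinarith

lemma Dat.deriv_ball (h : Dat d κ β p γ P D U) {θ u' : ℝ} (hθ : θ ∈ Set.Ioo 0 Real.pi)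
    (hU : HasDerivAt U u' θ) (hu : u' ≠ 0) : ∃ ζ r, 0 < r ∧ r ≤ Real.pi ∧ geodist ζ (γ θ) ≤ r ∧
      U θ / 2 ≤ r ^ β * av (pf P p) ζ r ∧
      Real.pi ^ β * av (pf P p) p Real.pi < r ^ β * av (pf P p) ζ r ∧
      |u'| ≤ 2 / c1 d * (r ^ β * av (pf P p) ζ r / r) := by
  have hnhds : ∀ᶠ y in 𝓝 θ, y ∈ Set.Ioo 0 Real.pi := isOpen_Ioo.mem_nhds hθ
  have hn : Real.pi ^ β * av (pf P p) p Real.pi < U θ := by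
    refine lt_of_le_of_ne (h.n0_le hθ) fun he => hu ?_
    refine IsLocalMin.hasDerivAt_eq_zero ?_ hU
    filter_upwards [hnhds] with y hy
    rw [← he]; exact h.n0_le hy
  have h0n := h.n0_nonneg
  by_contra hcon
  push Not at hcon
  have c0 := c1_pos d
  have : |u'| ≤ |u'| / 2 := by
    refine deriv_bound_of_lower hU ?_
    filter_upwards [hnhds] with y hy
    rw [sub_le_iff_le_add]
    refine le_of_forall_lt fun a ha => ?_
    obtain ⟨ζ, r, h0, hr, hζ, hlt⟩ := h.lub θ hθ
      (max a (max (U θ / 2) (Real.pi ^ β * av (pf P p) p Real.pi)))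
      (max_lt ha (max_lt (by linarith) hn))
    have h1 := hcon ζ r h0 hr hζ (((le_max_left _ _).trans (le_max_right _ _)).trans hlt.le)
      (lt_of_le_of_lt ((le_max_right _ _).trans (le_max_right _ _)) hlt)
    have h2 := h.shift hθ hy h0 hr hζ
    set val := r ^ β * av (pf P p) ζ r with hval
    have h3 : val * (|θ - y| / (c1 d * r)) ≤ |u'| / 2 * |y - θ| := by
      rw [abs_sub_comm y θ]
      have : val * (|θ - y| / (c1 d * r)) = (2 / c1 d * (val / r)) / 2 * |θ - y| := by
        field_simp
      rw [this]
      gcongr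
    have h4 := lt_of_le_of_lt (le_max_left _ _) hlt
    linarith [mul_sub val 1 (|θ - y| / (c1 d * r))]
  have := abs_pos.2 hu
  linarith

end

/-! ### Oscillation estimates -/

/-- the one-dimensional weighted variation -/
def VV (d : ℕ) (D : ℝ → ℝ≥0∞) : ℝ≥0∞ :=
  ∫⁻ u in Set.Ioo 0 Real.pi, ENNReal.ofReal (Real.sin u ^ (d - 1)) * D u

lemma gball_pi_ae {d : ℕ} (hd : 1 ≤ d) (p : Sph d) :
    gball p Real.pi =ᵐ[sphMeasure d] (Set.univ : Set (Sph d)) := by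
  rw [ae_eq_univ]
  refine measure_mono_null (fun η hη => ?_) (sph_singleton hd (-p))
  refine geodist_eq_pi (le_antisymm (geodist_le_pi _ _) ?_)
  exact not_lt.1 hη

lemma ae_Ioo {d : ℕ} (hd : 1 ≤ d) (p : Sph d) :
    ∀ᵐ η ∂(sphMeasure d), geodist p η ∈ Set.Ioo 0 Real.pi := by
  have h1 : ∀ᵐ η ∂(sphMeasure d), η ≠ p := by
    rw [ae_iff]; simpa using sph_singleton hd p
  have h2 : ∀ᵐ η ∂(sphMeasure d), η ≠ -p := by
    rw [ae_iff]; simpa using sph_singleton hd (-p)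
  filter_upwards [h1, h2] with η a b
  refine ⟨lt_of_le_of_ne (geodist_nonneg _ _) fun h => a (geodist_eq_zero h.symm).symm,
    lt_of_le_of_ne (geodist_le_pi _ _) fun h => b (geodist_eq_pi h)⟩

lemma IsKappa.univ {d : ℕ} (hd : 1 ≤ d) {κ : ℝ} (hK : IsKappa d κ) :
    sphMeasure d Set.univ = ENNReal.ofReal κ * ENNReal.ofReal (vv d Real.pi) := by
  rw [← measure_congr (gball_pi_ae hd (npole d)), hK.ball _ Real.pi_pos.le le_rfl]

lemma IsKappa.compl {d : ℕ} (hd : 1 ≤ d) {κ : ℝ} (hK : IsKappa d κ) (ζ : Sph d) {r : ℝ}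
    (h0 : 0 ≤ r) (hr : r ≤ Real.pi) :
    sphMeasure d (gball ζ r)ᶜ ≤ ENNReal.ofReal κ * ENNReal.ofReal ((Real.pi - r) ^ d) := by
  rw [measure_compl (measurableSet_gball _ _) (measure_ne_top _ _), hK.univ hd, hK.ball ζ h0 hr,
    ← ENNReal.mul_sub (by simp), ← ENNReal.ofReal_sub]
  · gcongr
    have := vv_sub_le2 (d := d) h0 hr
    rwa [pow_sub_one_mul' hd] at this
  · have := vv_mono (d := d) le_rfl h0 hr
    rwa [vv_zero] at this

lemma tonelli {d : ℕ} (hd : 1 ≤ d) {P : ℝ → ℝ} {D : ℝ → ℝ≥0∞} (h : OneDim d P D) (p : Sph d)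
    {Q : Set (Sph d)} (hQ : MeasurableSet Q) {L : ℝ} (hL : L ∈ Set.Ioo 0 Real.pi) :
    ∫⁻ η in Q, ENNReal.ofReal |pf P p η - P L| ∂(sphMeasure d) ≤
      ∫⁻ u in Set.Ioo 0 Real.pi, D u * sphMeasure d (Q ∩ {η | u ∈ Set.uIoc (geodist p η) L}) := by
  have hθ : Measurable (geodist p) := (continuous_geodist_right p).measurable
  have hE : MeasurableSet {x : Sph d × ℝ | x.2 ∈ Set.uIoc (geodist p x.1) L} := by
    have : {x : Sph d × ℝ | x.2 ∈ Set.uIoc (geodist p x.1) L} =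
      {x | min (geodist p x.1) L < x.2} ∩ {x | x.2 ≤ max (geodist p x.1) L} := rfl
    rw [this]
    exact (measurableSet_lt (by fun_prop) (by fun_prop)).inter
      (measurableSet_le (by fun_prop) (by fun_prop))
  set k : Sph d × ℝ → ℝ≥0∞ := fun x => D x.2 * Set.indicator {x : Sph d × ℝ |
    x.2 ∈ Set.uIoc (geodist p x.1) L} 1 x with hk
  have hkm : Measurable k := (h.measD.comp measurable_snd).mul (measurable_one.indicator hE)
  have h1 : ∫⁻ η in Q, ENNReal.ofReal |pf P p η - P L| ∂(sphMeasure d) ≤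
      ∫⁻ η in Q, (∫⁻ u in Set.Ioo 0 Real.pi, k (η, u)) ∂(sphMeasure d) := by
    refine lintegral_mono_ae (ae_restrict_of_ae ?_)
    filter_upwards [ae_Ioo hd p] with η hη
    have e1 : ENNReal.ofReal |pf P p η - P L| ≤ ∫⁻ u in Set.uIoc (geodist p η) L, D u := by
      rcases le_total (geodist p η) L with hle | hle
      · rw [Set.uIoc_of_le hle, abs_sub_comm]
        exact h.bound _ _ hη.1 hle hL.2
      · rw [Set.uIoc_of_ge hle]
        exact h.bound _ _ hL.1 hle hη.2
    refine e1.trans (le_of_eq ?_)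
    have e2 : ∀ u, k (η, u) = Set.indicator (Set.uIoc (geodist p η) L) D u := by
      intro u
      by_cases hu : u ∈ Set.uIoc (geodist p η) L
      · have hu' : (η, u) ∈ {x : Sph d × ℝ | x.2 ∈ Set.uIoc (geodist p x.1) L} := hu
        simp only [hk, Set.indicator_of_mem hu, Set.indicator_of_mem hu', Pi.one_apply, mul_one]
      · have hu' : (η, u) ∉ {x : Sph d × ℝ | x.2 ∈ Set.uIoc (geodist p x.1) L} := hu
        simp only [hk, Set.indicator_of_notMem hu, Set.indicator_of_notMem hu', mul_zero]
    simp_rw [e2]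
    rw [lintegral_indicator measurableSet_uIoc, Measure.restrict_restrict measurableSet_uIoc,
      Set.inter_eq_self_of_subset_left]
    intro u hu
    exact ⟨lt_of_lt_of_le' hu.1 (le_min hη.1.le hL.1.le), lt_of_le_of_lt hu.2 (max_lt hη.2 hL.2)⟩
  refine h1.trans (le_of_eq ?_)
  rw [lintegral_lintegral_swap hkm.aemeasurable]
  congr 1
  ext u
  simp only [hk]
  have hmm : Measurable fun η : Sph d => Set.indicator {x : Sph d × ℝ |
      x.2 ∈ Set.uIoc (geodist p x.1) L} (1 : Sph d × ℝ → ℝ≥0∞) (η, u) :=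
    (measurable_one.indicator hE).comp measurable_prodMk_right
  rw [lintegral_const_mul _ hmm]
  congr 1
  have e3 : ∀ η, Set.indicator {x : Sph d × ℝ | x.2 ∈ Set.uIoc (geodist p x.1) L}
      (1 : Sph d × ℝ → ℝ≥0∞) (η, u) = Set.indicator {η | u ∈ Set.uIoc (geodist p η) L} 1 η := by
    intro η; rfl
  simp_rw [e3]
  have hm : MeasurableSet {η | u ∈ Set.uIoc (geodist p η) L} := measurable_prodMk_right hE
  rw [lintegral_indicator_one hm, Measure.restrict_apply hm, Set.inter_comm]

lemma sin_lower {u : ℝ} (hu : u ∈ Set.Icc 0 Real.pi) :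
    min u (Real.pi - u) ≤ Real.pi / 2 * Real.sin u := by
  have key : ∀ x : ℝ, 0 ≤ x → x ≤ Real.pi / 2 → x ≤ Real.pi / 2 * Real.sin x := by
    intro x h0 h1
    have := Real.mul_le_sin h0 h1
    have hp := Real.pi_pos
    calc x = Real.pi / 2 * (2 / Real.pi * x) := by field_simp
      _ ≤ _ := by gcongr
  rcases le_total u (Real.pi / 2) with h | h
  · exact (min_le_left _ _).trans (key u hu.1 h)
  · rw [← Real.sin_pi_sub]
    exact (min_le_right _ _).trans (key _ (by linarith [hu.2]) (by linarith))

lemma J_bound {d : ℕ} (hd : 1 ≤ d) {κ : ℝ} (hκ : 0 < κ) (hK : IsKappa d κ) {P : ℝ → ℝ}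
    {D : ℝ → ℝ≥0∞} (h : OneDim d P D) (p : Sph d) {Q : Set (Sph d)} (hQ : MeasurableSet Q)
    {s : ℝ} (hs : 0 ≤ s) (hQs : sphMeasure d Q ≤ ENNReal.ofReal κ * ENNReal.ofReal (s ^ d)) :
    ∫ η in Q, |pf P p η - P (Real.pi / 2)| ∂(sphMeasure d) ≤
      κ * ((Real.pi / 2) ^ (d - 1) * s) * (VV d D).toReal := by
  have hpi := Real.pi_pos
  have hi : Integrable (fun η => |pf P p η - P (Real.pi / 2)|) ((sphMeasure d).restrict Q) :=
    (((pf_integrable hκ hK h p).sub (integrable_const _)).abs).integrableOn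
  have hpi2 : Real.pi / 2 ∈ Set.Ioo 0 Real.pi := ⟨by positivity, by linarith⟩
  have hmain : ∫⁻ η in Q, ENNReal.ofReal |pf P p η - P (Real.pi / 2)| ∂(sphMeasure d) ≤
      ENNReal.ofReal (κ * ((Real.pi / 2) ^ (d - 1) * s)) * VV d D := by
    refine (tonelli hd h p hQ hpi2).trans ?_
    have hmd := h.measD
    rw [VV, ← lintegral_const_mul _ (by fun_prop : Measurable fun u : ℝ =>
      ENNReal.ofReal (Real.sin u ^ (d - 1)) * D u)]
    refine setLIntegral_mono' measurableSet_Ioo fun u hu => ?_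
    set w := min u (Real.pi - u) with hw
    have hw0 : 0 ≤ w := le_min hu.1.le (by linarith [hu.2])
    have hsu : 0 ≤ Real.sin u := sin_nn (Set.Ioo_subset_Icc_self hu)
    have h1 : sphMeasure d (Q ∩ {η | u ∈ Set.uIoc (geodist p η) (Real.pi / 2)}) ≤
        ENNReal.ofReal κ * ENNReal.ofReal (w ^ d) := by
      rcases le_total u (Real.pi / 2) with hle | hle
      · have hwu : w = u := min_eq_left (by linarith)
        have hsub : Q ∩ {η | u ∈ Set.uIoc (geodist p η) (Real.pi / 2)} ⊆ gball p u := by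
          rintro η ⟨-, hη⟩
          rcases min_lt_iff.1 hη.1 with h2 | h2
          · exact h2
          · exact absurd h2 (not_lt.2 hle)
        refine (measure_mono hsub).trans ?_
        rw [hK.ball p hu.1.le hu.2.le, hwu]
        gcongr
        exact vv_le hd hu.1.le hu.2.le
      · have hwu : w = Real.pi - u := min_eq_right (by linarith)
        by_cases heq : u = Real.pi / 2
        · have hsub : Q ∩ {η | u ∈ Set.uIoc (geodist p η) (Real.pi / 2)} ⊆ gball p u := by
            rintro η ⟨-, hη⟩
            rcases min_lt_iff.1 hη.1 with h2 | h2
            · exact h2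
            · exact absurd h2 (not_lt.2 heq.le)
          refine (measure_mono hsub).trans ?_
          have : w = u := by rw [hwu, heq]; ring
          rw [hK.ball p hu.1.le hu.2.le, this]
          gcongr
          exact vv_le hd hu.1.le hu.2.le
        have hsub : Q ∩ {η | u ∈ Set.uIoc (geodist p η) (Real.pi / 2)} ⊆ (gball p u)ᶜ := by
          rintro η ⟨-, hη⟩
          rcases le_max_iff.1 hη.2 with h2 | h2
          · exact not_lt.2 h2
          · exact absurd (le_antisymm h2 hle) heq
        refine (measure_mono hsub).trans ?_
        rw [hwu]
        exact hK.compl hd p hu.1.le hu.2.le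
    have h2 : sphMeasure d (Q ∩ {η | u ∈ Set.uIoc (geodist p η) (Real.pi / 2)}) ≤
        ENNReal.ofReal κ * ENNReal.ofReal (s ^ d) :=
      (measure_mono Set.inter_subset_left).trans hQs
    have hsw : min (s ^ d) (w ^ d) ≤ s * w ^ (d - 1) := by
      rcases le_total s w with hle | hle
      · refine (min_le_left _ _).trans ?_
        rw [← pow_sub_one_mul' hd]
        gcongr
      · refine (min_le_right _ _).trans ?_
        rw [← pow_sub_one_mul' hd]
        gcongr
    have h3 : sphMeasure d (Q ∩ {η | u ∈ Set.uIoc (geodist p η) (Real.pi / 2)}) ≤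
        ENNReal.ofReal κ * ENNReal.ofReal (s * w ^ (d - 1)) := by
      refine le_trans ?_ (mul_le_mul_right (ENNReal.ofReal_le_ofReal hsw) _)
      rcases le_total (s ^ d) (w ^ d) with hle | hle
      · rw [min_eq_left hle]; exact h2
      · rw [min_eq_right hle]; exact h1
    calc _ ≤ D u * (ENNReal.ofReal κ * ENNReal.ofReal (s * (Real.pi / 2 * Real.sin u) ^ (d - 1))) := by
          refine mul_le_mul_right (h3.trans ?_) _
          have := sin_lower (Set.Ioo_subset_Icc_self hu)
          gcongr
      _ = _ := by
          rw [mul_comm (D u), ← ENNReal.ofReal_mul hκ.le, ← mul_assoc (ENNReal.ofReal _),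
            ← ENNReal.ofReal_mul (by positivity)]
          congr 2
          rw [mul_pow]; ring
  rw [← ENNReal.ofReal_le_ofReal_iff (by positivity), ofReal_integral_eq_lintegral_ofReal hi
    (Eventually.of_forall fun _ => abs_nonneg _), ENNReal.ofReal_mul (by positivity),
    ENNReal.ofReal_toReal (show VV d D ≠ ⊤ from h.fin)]
  exact hmain

lemma one_sub_rpow_ge {x β : ℝ} (hβ : 0 < β) (h0 : 0 < x) (h1 : x ≤ 1) :
    min β 1 * (1 - x) ≤ 1 - x ^ β := by
  rcases le_total β 1 with h | h
  · rw [min_eq_left h]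
    have := rpow_one_add_le_one_add_mul_self (s := x - 1) (p := β) (by linarith) hβ.le h
    rw [add_sub_cancel] at this
    linarith
  · rw [min_eq_right h]
    have := Real.rpow_le_rpow_of_exponent_ge h0 h1 h
    rw [Real.rpow_one] at this
    linarith

/-- constant for big balls -/
def C4 (d : ℕ) (β r0 : ℝ) : ℝ := Real.pi / min β 1 *
  ((Real.pi / 2) ^ (d - 1) / vv d Real.pi * (Real.pi ^ d / vv d r0 + 1))

lemma Dat.big_ball {d : ℕ} {κ β : ℝ} {p : Sph d} {γ : ℝ → Sph d} {P : ℝ → ℝ} {D : ℝ → ℝ≥0∞}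
    {U : ℝ → ℝ} (h : Dat d κ β p γ P D U) {ζ : Sph d} {r0 r : ℝ} (h0 : 0 < r0) (hr0 : r0 ≤ r)
    (hr : r ≤ Real.pi)
    (hlt : Real.pi ^ β * av (pf P p) p Real.pi < r ^ β * av (pf P p) ζ r) :
    av (pf P p) ζ r ≤ C4 d β r0 * (VV d D).toReal := by
  have hrp : 0 < r := h0.trans_le hr0
  have hd := h.hd
  have hκ := h.κ0
  have hpi := Real.pi_pos
  set F := pf P p with hF
  set c := P (Real.pi / 2) with hc
  set V := (VV d D).toReal with hV
  have hV0 : 0 ≤ V := ENNReal.toReal_nonneg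
  set A := av F ζ r with hA
  set AS := av F p Real.pi with hAS
  have hvr := vv_pos hd hrp hr
  have hvp := vv_pos hd hpi le_rfl
  have hv0 := vv_pos hd h0 (hr0.trans hr)
  have hv0r := vv_mono (d := d) h0.le hr0 hr
  have hrpi : r < Real.pi := by
    refine lt_of_le_of_ne hr fun he => ?_
    have : A = AS := by
      rw [hA, hAS, he, av, av, setAverage_congr (gball_pi_ae hd ζ), setAverage_congr (gball_pi_ae hd p)]
    rw [this, he] at hlt
    exact lt_irrefl _ hlt
  set s := Real.pi - r with hs
  have hs0 : 0 < s := by linarith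
  have hi : Integrable F (sphMeasure d) := h.int
  have hB : ∫ η in gball ζ r, (F η - c) ∂(sphMeasure d) = κ * vv d r * (A - c) := by
    rw [integral_sub hi.integrableOn (integrable_const _), hA, av_eq hκ h.hK F ζ hrp.le hr]
    rw [setIntegral_const, h.hK.ball_real hκ ζ hrp.le hr, smul_eq_mul]
    field_simp
  have hS : ∫ η, (F η - c) ∂(sphMeasure d) = κ * vv d Real.pi * (AS - c) := by
    rw [← setIntegral_univ, ← setIntegral_congr_set (gball_pi_ae hd p),
      integral_sub hi.integrableOn (integrable_const _), hAS, av_eq hκ h.hK F p hpi.le le_rfl]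
    rw [setIntegral_const, h.hK.ball_real hκ p hpi.le le_rfl, smul_eq_mul]
    field_simp
  have hiF : Integrable (fun η => F η - c) (sphMeasure d) := hi.sub (integrable_const _)
  have hsplit := integral_add_compl (measurableSet_gball ζ r) hiF
  have j1 : ∫ η, |F η - c| ∂(sphMeasure d) ≤ κ * ((Real.pi / 2) ^ (d - 1) * Real.pi) * V := by
    have := J_bound hd hκ h.hK h.one p MeasurableSet.univ hpi.le (by
      rw [h.hK.univ hd]
      gcongr
      exact vv_le hd hpi.le le_rfl)
    rwa [setIntegral_univ] at this
  have j2 := J_bound hd hκ h.hK h.one p (measurableSet_gball ζ r).compl hs0.le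
    (h.hK.compl hd ζ hrp.le hr)
  have k1 : κ * vv d r * (A - c) ≤ κ * ((Real.pi / 2) ^ (d - 1) * Real.pi) * V := by
    rw [← hB]
    refine le_trans ?_ j1
    refine (integral_mono hiF.integrableOn hiF.abs.integrableOn fun _ => le_abs_self _).trans ?_
    exact setIntegral_le_integral hiF.abs (Eventually.of_forall fun _ => abs_nonneg _)
  have k2 : κ * vv d r * (A - c) - κ * vv d Real.pi * (AS - c) ≤
      κ * ((Real.pi / 2) ^ (d - 1) * s) * V := by
    refine le_trans ?_ j2
    rw [← hB, ← hS, ← hsplit]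
    have : -∫ η in (gball ζ r)ᶜ, (F η - c) ∂(sphMeasure d) ≤
        ∫ η in (gball ζ r)ᶜ, |F η - c| ∂(sphMeasure d) := by
      refine (neg_le_abs _).trans ?_
      exact abs_integral_le_integral_abs
    linarith
  have k1' : vv d r * (A - c) ≤ ((Real.pi / 2) ^ (d - 1) * Real.pi) * V := by
    have : κ * (vv d r * (A - c)) ≤ κ * (((Real.pi / 2) ^ (d - 1) * Real.pi) * V) := by linarith
    exact le_of_mul_le_mul_left this hκ
  have k2' : vv d r * (A - c) - vv d Real.pi * (AS - c) ≤ ((Real.pi / 2) ^ (d - 1) * s) * V := by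
    have : κ * (vv d r * (A - c) - vv d Real.pi * (AS - c)) ≤
      κ * (((Real.pi / 2) ^ (d - 1) * s) * V) := by linarith
    exact le_of_mul_le_mul_left this hκ
  have hvd : vv d Real.pi - vv d r ≤ s * Real.pi ^ (d - 1) := by
    refine (vv_sub_le2 hrp.le hr).trans ?_
    gcongr
    linarith
  have hvd0 : 0 ≤ vv d Real.pi - vv d r := sub_nonneg.2 (vv_mono hrp.le hr le_rfl)
  set E := (Real.pi / 2) ^ (d - 1) with hE
  have hE0 : 0 < E := by positivity
  have hx1 : A - c ≤ E * Real.pi * V / vv d r0 := by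
    rw [le_div_iff₀ hv0]
    rcases le_total (A - c) 0 with hn | hn
    · exact (mul_nonpos_of_nonpos_of_nonneg hn hv0.le).trans (by positivity)
    · nlinarith
  have m1 : vv d Real.pi * (A - AS) ≤ s * (E * V * (Real.pi ^ d / vv d r0 + 1)) := by
    have e1 : (vv d Real.pi - vv d r) * (A - c) ≤ (s * Real.pi ^ (d - 1)) * (E * Real.pi * V / vv d r0) :=
      (mul_le_mul_of_nonneg_left hx1 hvd0).trans (by gcongr)
    have e2 : (s * Real.pi ^ (d - 1)) * (E * Real.pi * V / vv d r0) =
        s * (E * V * (Real.pi ^ d / vv d r0)) := by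
      rw [← pow_sub_one_mul' hd]; field_simp
    nlinarith
  -- lower bound
  have hA0 : 0 ≤ A := av_nonneg h.nn _ _
  have hx : AS ≤ (r / Real.pi) ^ β * A := by
    rw [Real.div_rpow hrp.le hpi.le, div_mul_eq_mul_div, le_div_iff₀ (by positivity)]
    linarith
  have hmin : 0 < min β 1 := lt_min h.β0 one_pos
  have m2 := one_sub_rpow_ge h.β0 (div_pos hrp hpi) ((div_le_one hpi).2 hr)
  have m3 : min β 1 * (s / Real.pi) * A ≤ A - AS := by
    have : 1 - r / Real.pi = s / Real.pi := by rw [hs]; field_simp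
    rw [this] at m2
    have := mul_le_mul_of_nonneg_right m2 hA0
    linarith
  have m4 : vv d Real.pi * (min β 1 * (s / Real.pi) * A) ≤
      s * (E * V * (Real.pi ^ d / vv d r0 + 1)) := (mul_le_mul_of_nonneg_left m3 hvp.le).trans m1
  have m5 : vv d Real.pi * (min β 1 / Real.pi) * A ≤ E * V * (Real.pi ^ d / vv d r0 + 1) := by
    refine le_of_mul_le_mul_left (a := s) ?_ hs0
    calc _ = vv d Real.pi * (min β 1 * (s / Real.pi) * A) := by ring
      _ ≤ _ := m4
  unfold C4
  rw [← hE]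
  rw [← le_div_iff₀' (by positivity)] at m5
  refine m5.trans (le_of_eq ?_)
  field_simp

/-! ### Small balls -/

def CT (d : ℕ) : ℝ := 2 * (4 ^ d / c1 d)
def CD (d : ℕ) : ℝ := 4 / c1 d * CT d
def KK (d : ℕ) (β : ℝ) : ℝ := (2 * CT d) ^ (1 / β)
def R0 (d : ℕ) (β : ℝ) : ℝ := Real.pi / (12 * KK d β)

lemma CT_ge (d : ℕ) : 1 ≤ CT d := by
  have h0 := c1_pos d
  have h1 := c1_le d
  have h2 : (1:ℝ) ≤ 4 ^ d := one_le_pow₀ (by norm_num)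
  have : 1 ≤ (4:ℝ) ^ d / c1 d := by rw [le_div_iff₀ h0]; linarith
  unfold CT; linarith

lemma CD_pos (d : ℕ) : 0 < CD d := by
  have h0 := c1_pos d
  have := CT_ge d
  unfold CD; positivity

lemma KK_ge (d : ℕ) {β : ℝ} (hβ : 0 < β) : 1 ≤ KK d β := by
  have := CT_ge d
  exact Real.one_le_rpow (by linarith) (by positivity)

lemma KK_rpow (d : ℕ) {β : ℝ} (hβ : 0 < β) : KK d β ^ β = 2 * CT d := by
  have := CT_ge d
  unfold KK
  rw [← Real.rpow_mul (by linarith), one_div_mul_cancel hβ.ne', Real.rpow_one]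

lemma R0_pos (d : ℕ) {β : ℝ} (hβ : 0 < β) : 0 < R0 d β := by
  have := KK_ge d hβ
  have := Real.pi_pos
  unfold R0; positivity

lemma KR0 (d : ℕ) {β : ℝ} (hβ : 0 < β) : 3 * (KK d β * R0 d β) = Real.pi / 4 := by
  have := KK_ge d hβ
  unfold R0; field_simp; norm_num

/-- interval selection -/
lemma drop_interval {P : ℝ → ℝ} {a b x y : ℝ} (hxy : x ≤ y) (hc : ContinuousOn P (Set.Icc x y))
    (hx : a ≤ P x) (hy : P y ≤ b) :
    ∃ s t, x ≤ s ∧ s ≤ t ∧ t ≤ y ∧ a ≤ P s ∧ P t ≤ b ∧ ∀ u ∈ Set.Ioo s t, b < P u ∧ P u < a := by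
  have h1 : IsCompact (Set.Icc x y ∩ P ⁻¹' Set.Iic b) :=
    (isCompact_Icc).of_isClosed_subset (hc.preimage_isClosed_of_isClosed isClosed_Icc isClosed_Iic)
      Set.inter_subset_left
  obtain ⟨t, ⟨ht, htb⟩, hmin⟩ := h1.exists_isLeast ⟨y, ⟨hxy, le_rfl⟩, hy⟩
  have hc' : ContinuousOn P (Set.Icc x t) := hc.mono (Set.Icc_subset_Icc_right ht.2)
  have h2 : IsCompact (Set.Icc x t ∩ P ⁻¹' Set.Ici a) :=
    (isCompact_Icc).of_isClosed_subset (hc'.preimage_isClosed_of_isClosed isClosed_Icc isClosed_Ici)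
      Set.inter_subset_left
  obtain ⟨s, ⟨hs, hsa⟩, hmax⟩ := h2.exists_isGreatest ⟨x, ⟨le_rfl, ht.1⟩, hx⟩
  refine ⟨s, t, hs.1, hs.2, ht.2, hsa, htb, fun u hu => ⟨?_, ?_⟩⟩
  · by_contra hcon
    have := hmin ⟨⟨hs.1.trans hu.1.le, hu.2.le.trans ht.2⟩, not_lt.1 hcon⟩
    linarith [hu.2]
  · by_contra hcon
    have := hmax ⟨⟨hs.1.trans hu.1.le, hu.2.le⟩, not_lt.1 hcon⟩
    linarith [hu.1]

/-- variation needed to drop from `a` to `b` -/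
lemma drop_var {d : ℕ} {P : ℝ → ℝ} {D : ℝ → ℝ≥0∞} (h : OneDim d P D) {a b A B x y : ℝ}
    (hA : 0 ≤ A) (hB : B ≤ Real.pi) (hx : x ∈ Set.Ioo A B) (hy : y ∈ Set.Ioo A B)
    (hxa : a ≤ P x) (hyb : P y ≤ b) (hb : b < a) :
    ENNReal.ofReal (a - b) ≤ ∫⁻ u in Set.Ioo A B ∩ {u | b < P u ∧ P u < a}, D u := by
  have key : ∀ s t, A < s → s ≤ t → t < B → a - b ≤ |P t - P s| →
      (∀ u ∈ Set.Ioo s t, b < P u ∧ P u < a) →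
      ENNReal.ofReal (a - b) ≤ ∫⁻ u in Set.Ioo A B ∩ {u | b < P u ∧ P u < a}, D u := by
    intro s t hs hst ht hab hu
    calc ENNReal.ofReal (a - b) ≤ ENNReal.ofReal |P t - P s| := ENNReal.ofReal_le_ofReal hab
      _ ≤ ∫⁻ u in Set.Ioc s t, D u := h.bound s t (by linarith) hst (by linarith)
      _ = ∫⁻ u in Set.Ioo s t, D u := by rw [restrict_Ioo_eq_restrict_Ioc]
      _ ≤ _ := lintegral_mono_set (fun u hu' => Set.mem_inter
        (Set.mem_Ioo.2 ⟨hs.trans hu'.1, hu'.2.trans ht⟩) (hu u hu'))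
  rcases le_total x y with hxy | hxy
  · obtain ⟨s, t, h1, h2, h3, h4, h5, h6⟩ := drop_interval hxy (h.cont.mono fun u hu =>
      ⟨by linarith [hu.1, hx.1], by linarith [hu.2, hy.2]⟩) hxa hyb
    refine key s t (by linarith [hx.1]) h2 (by linarith [hy.2]) ?_ h6
    rw [abs_sub_comm]
    exact le_trans (by linarith) (le_abs_self _)
  · obtain ⟨s, t, h1, h2, h3, h4, h5, h6⟩ := drop_interval (P := fun u => - P u) (a := -b) (b := -a)
      hxy ((h.cont.mono fun u hu =>
      ⟨by linarith [hu.1, hy.1], by linarith [hu.2, hx.2]⟩).neg) (by linarith) (by linarith)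
    refine key s t (by linarith [hy.1]) h2 (by linarith [hx.2]) ?_ fun u hu => ?_
    · exact le_trans (by linarith) (le_abs_self _)
    · have := h6 u hu
      constructor <;> linarith [this.1, this.2]

section
variable {d : ℕ} {κ β : ℝ} {p : Sph d} {γ : ℝ → Sph d} {P : ℝ → ℝ} {D : ℝ → ℝ≥0∞} {U : ℝ → ℝ}

lemma Dat.small (h : Dat d κ β p γ P D U) {θ u' : ℝ} {ζ : Sph d} {r R : ℝ}
    (h0 : 0 < r) (hR1 : 2 * r ≤ R) (hR2 : R ≤ 4 * r) (hRpi : R ≤ Real.pi)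
    (hζ : geodist ζ (γ θ) ≤ r) (hU : U θ / 2 ≤ r ^ β * av (pf P p) ζ r)
    (hu : |u'| ≤ 2 / c1 d * (r ^ β * av (pf P p) ζ r / r)) :
    U θ ≤ CT d * (R ^ β * av (pf P p) (γ θ) R) ∧
    |u'| ≤ CD d * (R ^ β * av (pf P p) (γ θ) R / R) := by
  have hR0 : 0 < R := by linarith
  have hrpi : r ≤ Real.pi := by linarith
  have h1 := av_nested h.hd h.κ0 h.hK h.nn h.int h0 hrpi hR0 hRpi (ζ := ζ) (ζ' := γ θ)
    (gball_subset (by rw [geodist_comm]; linarith))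
  have c0 := c1_pos d
  have v1 := vv_pos h.hd h0 hrpi
  have v2 := vv_pos h.hd hR0 hRpi
  set a := av (pf P p) (γ θ) R
  set A := av (pf P p) ζ r with hA
  have hA0 : 0 ≤ A := av_nonneg h.nn _ _
  have h2 : A ≤ 4 ^ d / c1 d * a := by
    have e1 : A ≤ vv d R / vv d r * a := by
      calc A = vv d R / vv d r * (A * (vv d r / vv d R)) := by field_simp
        _ ≤ _ := by gcongr
    have e2 : vv d R / vv d r ≤ 4 ^ d / c1 d := by
      rw [div_le_div_iff₀ v1 c0]
      have := vv_ge h.hd h0.le hrpi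
      calc vv d R * c1 d ≤ R ^ d * c1 d := by gcongr; exact vv_le h.hd hR0.le hRpi
        _ ≤ (4 * r) ^ d * c1 d := by gcongr
        _ = 4 ^ d * (c1 d * r ^ d) := by rw [mul_pow]; ring
        _ ≤ _ := by gcongr
    have : 0 ≤ a := av_nonneg h.nn _ _
    exact e1.trans (by gcongr)
  have h3 : r ^ β * A ≤ 4 ^ d / c1 d * (R ^ β * a) := by
    have : r ^ β ≤ R ^ β := Real.rpow_le_rpow h0.le (by linarith) h.β0.le
    calc r ^ β * A ≤ R ^ β * (4 ^ d / c1 d * a) := by gcongr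
      _ = _ := by ring
  constructor
  · unfold CT; linarith
  · refine hu.trans ?_
    have h4 : r ^ β * A / r ≤ (4 ^ d / c1 d * (R ^ β * a)) * (4 / R) := by
      rw [div_eq_mul_inv]
      have : r⁻¹ ≤ 4 / R := by
        rw [inv_eq_one_div, div_le_div_iff₀ h0 hR0]; linarith
      have : 0 ≤ r ^ β := by positivity
      gcongr
      exact (mul_nonneg this hA0).trans h3
    calc _ ≤ 2 / c1 d * ((4 ^ d / c1 d * (R ^ β * a)) * (4 / R)) := by gcongr
      _ = _ := by unfold CD CT; ring

lemma Dat.far (h : Dat d κ β p γ P D U) {θ : ℝ} (hθ : θ ∈ Set.Ioo 0 Real.pi) {R ρ : ℝ} {ζ : Sph d}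
    (hR : 0 < R) (hT : U θ ≤ CT d * (R ^ β * av (pf P p) (γ θ) R))
    (hρ : KK d β * R ≤ ρ) (hρpi : ρ ≤ Real.pi) (hζ : geodist ζ (γ θ) ≤ ρ) :
    av (pf P p) ζ ρ ≤ av (pf P p) (γ θ) R / 2 := by
  have hK := KK_ge d h.β0
  have hρ0 : 0 < ρ := lt_of_lt_of_le (by positivity) hρ
  have h1 := (h.ub θ hθ ζ ρ hρ0 hρpi hζ).trans hT
  have h2 : 2 * CT d * R ^ β ≤ ρ ^ β := by
    rw [← KK_rpow d h.β0, ← Real.mul_rpow (by linarith) hR.le]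
    exact Real.rpow_le_rpow (by positivity) hρ h.β0.le
  have hA0 : 0 ≤ av (pf P p) ζ ρ := av_nonneg h.nn _ _
  have hc := CT_ge d
  have hRb : 0 < R ^ β := by positivity
  have h3 : 2 * CT d * R ^ β * av (pf P p) ζ ρ ≤ CT d * (R ^ β * av (pf P p) (γ θ) R) :=
    (by gcongr : _ ≤ ρ ^ β * av (pf P p) ζ ρ).trans h1
  have h4 : (CT d * R ^ β) * (2 * av (pf P p) ζ ρ) ≤ (CT d * R ^ β) * av (pf P p) (γ θ) R := by
    linarith
  have := le_of_mul_le_mul_left h4 (by positivity)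
  linarith

lemma Dat.caseII (h : Dat d κ β p γ P D U) {θ : ℝ} (hθ : θ ∈ Set.Ioo 0 Real.pi) {R : ℝ}
    (hR : 0 < R) (hKR : KK d β * R ≤ Real.pi)
    (hT : U θ ≤ CT d * (R ^ β * av (pf P p) (γ θ) R))
    (h1 : KK d β * R ≤ θ) (h2 : θ + KK d β * R ≤ Real.pi) (ha : 0 < av (pf P p) (γ θ) R) :
    ENNReal.ofReal (av (pf P p) (γ θ) R / 2) ≤
      ∫⁻ u in Set.Ioo (θ - KK d β * R) (θ + KK d β * R) ∩
        {u | av (pf P p) (γ θ) R / 2 < P u ∧ P u < av (pf P p) (γ θ) R}, D u := by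
  have hK := KK_ge d h.β0
  have hRK : R ≤ KK d β * R := by nlinarith
  have hfar := h.far hθ hR hT le_rfl hKR (ζ := γ θ) (by rw [geodist_self]; positivity)
  have near : ∀ ρ η, ρ ≤ KK d β * R → η ∈ gball (γ θ) ρ →
      geodist p η ∈ Set.Ioo (θ - KK d β * R) (θ + KK d β * R) := by
    intro ρ η hρ hη
    have e1 : geodist (γ θ) η < ρ := hη
    have e2 := geodist_triangle p (γ θ) η
    have e3 := geodist_triangle p η (γ θ)
    have e4 := geodist_comm η (γ θ)
    have e5 := h.γp θ (Set.Ioo_subset_Icc_self hθ)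
    constructor <;> linarith
  obtain ⟨η1, hη1, hle1⟩ := exists_setAverage_le (ball_ne_zero h.hd h.κ0 h.hK (γ θ) hR
    (hRK.trans hKR)) (measure_ne_top _ _) h.int.integrableOn
  obtain ⟨η2, hη2, hle2⟩ := exists_le_setAverage (ball_ne_zero h.hd h.κ0 h.hK (γ θ)
    (hR.trans_le hRK) hKR) (measure_ne_top _ _) h.int.integrableOn
  have := drop_var h.one (A := θ - KK d β * R) (B := θ + KK d β * R) (by linarith) (by linarith)
    (near R η1 hRK hη1) (near _ η2 le_rfl hη2) (a := av (pf P p) (γ θ) R)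
    (b := av (pf P p) (γ θ) R / 2) hle1 (le_trans hle2 hfar) (by linarith)
  convert this using 2
  ring

lemma Dat.caseI (h : Dat d κ β p γ P D U) {θ : ℝ} (hθ : θ ∈ Set.Ioo 0 Real.pi) {R : ℝ}
    (hR : 0 < R) (hKR : 3 * (KK d β * R) < Real.pi)
    (hT : U θ ≤ CT d * (R ^ β * av (pf P p) (γ θ) R))
    (h1 : θ ≤ 2 * (KK d β * R)) :
    ENNReal.ofReal (av (pf P p) (γ θ) R) ≤ ENNReal.ofReal (4 / (c1 d * R ^ d)) *
      ∫⁻ u in Set.Ioc 0 (3 * (KK d β * R)), ENNReal.ofReal (u ^ d) * D u := by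
  have hK := KK_ge d h.β0
  have hκ := h.κ0
  have hRK : R ≤ KK d β * R := by nlinarith
  set L := 3 * (KK d β * R) with hL
  have hL0 : 0 < L := by positivity
  have hRL : R ≤ L := by linarith
  have e5 := h.γp θ (Set.Ioo_subset_Icc_self hθ)
  set a := av (pf P p) (γ θ) R with ha
  have hfar := h.far hθ hR hT (by linarith : _ ≤ L) hKR.le (ζ := p) (by rw [e5]; linarith)
  have v1 := vv_pos h.hd hR (hRL.trans hKR.le)
  have v2 := vv_mono (d := d) hR.le hRL hKR.le
  have c0 := c1_pos d
  have v3 := vv_ge h.hd hR.le (hRL.trans hKR.le)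
  have hi : Integrable (fun η => |pf P p η - P L|) (sphMeasure d) :=
    (h.int.sub (integrable_const _)).abs
  set I := ∫ η in gball p L, |pf P p η - P L| ∂(sphMeasure d) with hI
  have hI0 : 0 ≤ I := integral_nonneg fun _ => abs_nonneg _
  -- generic estimate
  have gen : ∀ ζ ρ, R ≤ ρ → ρ ≤ Real.pi → gball ζ ρ ⊆ gball p L →
      |av (pf P p) ζ ρ - P L| ≤ I / (κ * vv d R) := by
    intro ζ ρ hρ hρpi hsub
    have w1 := vv_mono (d := d) hR.le hρ hρpi
    have e1 : av (pf P p) ζ ρ - P L =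
        (∫ η in gball ζ ρ, (pf P p η - P L) ∂(sphMeasure d)) / (κ * vv d ρ) := by
      rw [integral_sub h.int.integrableOn (integrable_const _), av_eq hκ h.hK _ _
        (hR.le.trans hρ) hρpi, setIntegral_const, h.hK.ball_real hκ ζ (hR.le.trans hρ) hρpi]
      have : 0 < κ * vv d ρ := by have := v1.trans_le w1; positivity
      rw [smul_eq_mul, sub_div, mul_div_cancel_left₀ _ this.ne']
    rw [e1, abs_div, abs_of_nonneg (by have := v1.trans_le w1; positivity : 0 ≤ κ * vv d ρ)]
    refine div_le_div₀ hI0 ?_ (by positivity) (by gcongr)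
    refine (abs_integral_le_integral_abs).trans ?_
    exact setIntegral_mono_set hi.integrableOn (Eventually.of_forall fun _ => abs_nonneg _)
      (Eventually.of_forall hsub)
  have g1 := gen (γ θ) R le_rfl (hRL.trans hKR.le) (gball_subset (by rw [e5]; linarith))
  have g2 := gen p L hRL hKR.le subset_rfl
  have g3 : a ≤ 4 * (I / (κ * vv d R)) := by
    have := (abs_le.1 g1).2
    have := (abs_le.1 g2).1
    linarith
  have g4 : a ≤ 4 / (c1 d * R ^ d) * (I / κ) := by
    refine g3.trans ?_
    calc 4 * (I / (κ * vv d R)) ≤ 4 * (I / (κ * (c1 d * R ^ d))) := by gcongr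
      _ = _ := by field_simp
  refine (ENNReal.ofReal_le_ofReal g4).trans ?_
  rw [ENNReal.ofReal_mul (by positivity)]
  gcongr
  rw [ENNReal.ofReal_div_of_pos hκ]
  refine ENNReal.div_le_of_le_mul ?_
  rw [hI, ofReal_integral_eq_lintegral_ofReal hi.integrableOn
    (Eventually.of_forall fun _ => abs_nonneg _)]
  refine (tonelli h.hd h.one p (measurableSet_gball p L) ⟨hL0, hKR⟩).trans ?_
  have hmd := h.one.measD
  rw [mul_comm, ← lintegral_const_mul _ (by fun_prop), ← lintegral_indicator measurableSet_Ioo,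
    ← lintegral_indicator measurableSet_Ioc]
  refine lintegral_mono fun u => ?_
  by_cases hu : u ∈ Set.Ioo 0 Real.pi
  · rw [Set.indicator_of_mem hu]
    by_cases huL : u ≤ L
    · have hm : u ∈ Set.Ioc 0 L := ⟨hu.1, huL⟩
      rw [Set.indicator_of_mem hm, mul_comm, ← mul_assoc]
      gcongr
      refine (measure_mono (?_ : _ ⊆ gball p u)).trans ?_
      · rintro η ⟨hη1, hη2⟩
        have : geodist p η < L := hη1
        have h3 : min (geodist p η) L < u := hη2.1
        rw [min_eq_left this.le] at h3
        exact h3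
      · rw [h.hK.ball p hu.1.le hu.2.le]
        gcongr
        exact vv_le h.hd hu.1.le hu.2.le
    · have : gball p L ∩ {η | u ∈ Set.uIoc (geodist p η) L} = ∅ := by
        ext η
        simp only [Set.mem_inter_iff, Set.mem_empty_iff_false, iff_false, not_and]
        intro hη1 hη2
        have : geodist p η < L := hη1
        have h3 : u ≤ max (geodist p η) L := hη2.2
        rw [max_eq_right this.le] at h3
        exact huL h3
      rw [this]; simp
  · rw [Set.indicator_of_notMem hu]; simp

/-- comparison of two good scales -/
lemma Dat.scales (h : Dat d κ β p γ P D U) {θ1 θ2 u R1 R2 : ℝ} (hθ1 : θ1 ∈ Set.Ioo 0 Real.pi)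
    (hθ2 : θ2 ∈ Set.Ioo 0 Real.pi) (hR2 : 0 < R2) (hR : R2 ≤ R1)
    (hKR : 3 * (KK d β * R1) ≤ Real.pi)
    (hT : U θ2 ≤ CT d * (R2 ^ β * av (pf P p) (γ θ2) R2))
    (hu1 : |u - θ1| ≤ KK d β * R1) (hu2 : |u - θ2| ≤ KK d β * R2)
    (hP1 : P u < av (pf P p) (γ θ1) R1) (hP2 : av (pf P p) (γ θ2) R2 / 2 < P u) :
    R1 ^ β ≤ (2 * CT d * ((3 * KK d β) ^ d / c1 d)) * R2 ^ β := by
  have hK := KK_ge d h.β0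
  have hc := CT_ge d
  have c0 := c1_pos d
  have hR1 : 0 < R1 := hR2.trans_le hR
  set ρ := 3 * (KK d β * R1) with hρ
  have hRρ : R1 ≤ ρ := by nlinarith
  have hρ0 : 0 < ρ := by positivity
  set a1 := av (pf P p) (γ θ1) R1
  have hd12 : |θ1 - θ2| ≤ ρ := by
    have e1 := abs_le.1 hu1
    have e2 := abs_le.1 hu2
    have : KK d β * R2 ≤ KK d β * R1 := by gcongr
    have : 0 < KK d β * R1 := by positivity
    rw [abs_le]; constructor <;> linarith [e1.1, e1.2, e2.1, e2.2]
  have h1 := h.ub θ2 hθ2 (γ θ1) ρ hρ0 hKR (by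
    rw [h.γd θ1 (Set.Ioo_subset_Icc_self hθ1) θ2 (Set.Ioo_subset_Icc_self hθ2)]; exact hd12)
  have h2 := av_nested h.hd h.κ0 h.hK h.nn h.int hR1 (hRρ.trans hKR) hρ0 hKR (ζ := γ θ1)
    (ζ' := γ θ1) (gball_subset (by rw [geodist_self]; linarith))
  have v1 := vv_pos h.hd hρ0 hKR
  have v2 := vv_ge h.hd hR1.le (hRρ.trans hKR)
  have v3 := vv_le h.hd hρ0.le hKR
  have ha1 : 0 < a1 := (h.one.nonneg u).trans_lt hP1
  have h3 : c1 d / (3 * KK d β) ^ d ≤ vv d R1 / vv d ρ := by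
    rw [div_le_div_iff₀ (by positivity) v1]
    calc c1 d * vv d ρ ≤ c1 d * ρ ^ d := by gcongr
      _ = c1 d * R1 ^ d * (3 * KK d β) ^ d := by rw [hρ, ← mul_assoc, mul_pow (3 * KK d β)]; ring
      _ ≤ _ := by gcongr
  have h4 : R1 ^ β * (a1 * (c1 d / (3 * KK d β) ^ d)) ≤ CT d * (R2 ^ β * (2 * a1)) := by
    calc R1 ^ β * (a1 * (c1 d / (3 * KK d β) ^ d)) ≤ ρ ^ β * (a1 * (vv d R1 / vv d ρ)) := by
          have : R1 ^ β ≤ ρ ^ β := Real.rpow_le_rpow hR1.le hRρ h.β0.le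
          gcongr
      _ ≤ ρ ^ β * av (pf P p) (γ θ1) ρ := by gcongr
      _ ≤ CT d * (R2 ^ β * av (pf P p) (γ θ2) R2) := h1.trans hT
      _ ≤ _ := by gcongr; linarith
  have h5 : a1 * R1 ^ β ≤ a1 * ((2 * CT d * ((3 * KK d β) ^ d / c1 d)) * R2 ^ β) := by
    calc a1 * R1 ^ β = (R1 ^ β * (a1 * (c1 d / (3 * KK d β) ^ d))) * ((3 * KK d β) ^ d / c1 d) := by
          field_simp
      _ ≤ CT d * (R2 ^ β * (2 * a1)) * ((3 * KK d β) ^ d / c1 d) := by gcongr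
      _ = _ := by ring
  exact le_of_mul_le_mul_left h5 ha1

end

/-! ### Summation over scales -/

def WW (d : ℕ) (D : ℝ → ℝ≥0∞) : ℝ≥0∞ :=
  ∫⁻ u in Set.Ioo 0 (3 * Real.pi / 4), ENNReal.ofReal (u ^ (d - 1)) * D u

lemma WW_le (d : ℕ) {D : ℝ → ℝ≥0∞} (hD : Measurable D) :
    WW d D ≤ ENNReal.ofReal ((3 * Real.pi / 2) ^ (d - 1)) * VV d D := by
  have hpi := Real.pi_pos
  unfold WW VV
  rw [← lintegral_const_mul _ (by fun_prop)]
  refine (setLIntegral_mono' measurableSet_Ioo fun u hu => ?_).trans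
    (lintegral_mono_set (Set.Ioo_subset_Ioo_right (by linarith)))
  rw [← mul_assoc, ← ENNReal.ofReal_mul (by positivity), ← mul_pow]
  gcongr
  · exact hu.1.le
  have h1 := sin_lower (u := u) ⟨hu.1.le, by linarith [hu.2]⟩
  have h2 : u / 3 ≤ min u (Real.pi - u) := le_min (by linarith [hu.1]) (by linarith [hu.2])
  linarith

def Rk (d : ℕ) (β : ℝ) (k : ℕ) : ℝ := R0 d β / 2 ^ k

lemma Rk_pos (d : ℕ) {β : ℝ} (hβ : 0 < β) (k : ℕ) : 0 < Rk d β k := by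
  have := R0_pos d hβ
  unfold Rk; positivity

lemma Rk_le (d : ℕ) {β : ℝ} (hβ : 0 < β) (k : ℕ) : Rk d β k ≤ R0 d β :=
  div_le_self (R0_pos d hβ).le (one_le_pow₀ (by norm_num))

lemma KRk (d : ℕ) {β : ℝ} (hβ : 0 < β) (k : ℕ) : 3 * (KK d β * Rk d β k) ≤ Real.pi / 4 := by
  rw [← KR0 d hβ]
  have := KK_ge d hβ
  have := Rk_le d hβ k
  gcongr

lemma Rk_exists (d : ℕ) {β : ℝ} {r : ℝ} (h0 : 0 < r) (hr : r < R0 d β / 4) :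
    ∃ k, 2 * r ≤ Rk d β k ∧ Rk d β k ≤ 4 * r := by
  have h1 : 1 ≤ R0 d β / (4 * r) := by rw [le_div_iff₀ (by positivity)]; linarith
  obtain ⟨n, hn1, hn2⟩ := exists_nat_pow_near h1 (by norm_num : (1:ℝ) < 2)
  refine ⟨n + 1, ?_, ?_⟩
  · rw [le_div_iff₀ (by positivity)] at hn1
    unfold Rk
    rw [le_div_iff₀ (by positivity), pow_succ]
    linarith
  · rw [div_lt_iff₀ (by positivity)] at hn2
    unfold Rk
    rw [div_le_iff₀ (by positivity)]
    linarith

lemma geom_sum_aux (x : ℝ) (hx : 0 ≤ x) (n : ℕ) :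
    (∑ k ∈ Finset.range n, if (2:ℝ) ^ k < x then (2:ℝ) ^ k else 0) ≤ min (2 ^ n) (2 * x) := by
  induction n with
  | zero => simp; exact hx
  | succ n ih =>
    rw [Finset.sum_range_succ]
    have h1 := ih.trans (min_le_left _ _)
    have h2 := ih.trans (min_le_right _ _)
    have h3 : (0:ℝ) < 2 ^ n := by positivity
    split_ifs with h
    · rw [pow_succ]; exact le_min (by linarith) (by linarith)
    · rw [pow_succ]; exact le_min (by linarith) (by linarith)

/-- `∑_{R_k > w} 1 / R_k ≤ 2 / w` -/
lemma geom_tsum (d : ℕ) {β : ℝ} (hβ : 0 < β) {w : ℝ} (hw : 0 < w) :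
    ∑' k, ENNReal.ofReal (if w < Rk d β k then (Rk d β k)⁻¹ else 0) ≤ ENNReal.ofReal (2 / w) := by
  refine ENNReal.tsum_le_of_sum_range_le fun n => ?_
  have h0 := R0_pos d hβ
  rw [← ENNReal.ofReal_sum_of_nonneg fun k _ => by
    have := Rk_pos d hβ k
    split_ifs <;> positivity]
  refine ENNReal.ofReal_le_ofReal ?_
  have h1 := (geom_sum_aux (R0 d β / w) (by positivity) n).trans (min_le_right _ _)
  have h2 : (∑ k ∈ Finset.range n, if w < Rk d β k then (Rk d β k)⁻¹ else 0) =
      (R0 d β)⁻¹ * ∑ k ∈ Finset.range n, if (2:ℝ) ^ k < R0 d β / w then (2:ℝ) ^ k else 0 := by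
    rw [Finset.mul_sum]
    refine Finset.sum_congr rfl fun k _ => ?_
    have : w < Rk d β k ↔ (2:ℝ) ^ k < R0 d β / w := by
      unfold Rk
      rw [lt_div_iff₀ (by positivity), lt_div_iff₀ hw, mul_comm]
    simp only [this, mul_ite, mul_zero]
    congr 1
    unfold Rk
    rw [inv_div]; field_simp
  rw [h2]
  calc _ ≤ (R0 d β)⁻¹ * (2 * (R0 d β / w)) := by gcongr
    _ = _ := by field_simp

section
variable {d : ℕ} {κ β : ℝ} {p : Sph d} {γ : ℝ → Sph d} {P : ℝ → ℝ} {D : ℝ → ℝ≥0∞} {U : ℝ → ℝ}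

def C7 (d : ℕ) (β : ℝ) : ℝ := 12 * KK d β / c1 d * (3 * Real.pi / 2) ^ (d - 1)

lemma C7_pos (d : ℕ) {β : ℝ} (hβ : 0 < β) : 0 < C7 d β := by
  have := KK_ge d hβ
  have := c1_pos d
  have := Real.pi_pos
  unfold C7; positivity

lemma Dat.a_bound (h : Dat d κ β p γ P D U) {θ : ℝ} (hθ : θ ∈ Set.Ioo 0 (Real.pi / 2)) {R : ℝ}
    (hR : 0 < R) (hKR : 3 * (KK d β * R) ≤ Real.pi / 4)
    (hT : U θ ≤ CT d * (R ^ β * av (pf P p) (γ θ) R)) :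
    av (pf P p) (γ θ) R * R ^ (d - 1) ≤ C7 d β * (VV d D).toReal := by
  have hpi := Real.pi_pos
  have hK := KK_ge d h.β0
  have c0 := c1_pos d
  have c2 := c1_le d
  have hmd := h.one.measD
  set a := av (pf P p) (γ θ) R with ha
  have ha0 : 0 ≤ a := av_nonneg h.nn _ _
  have hθ' : θ ∈ Set.Ioo 0 Real.pi := ⟨hθ.1, by linarith [hθ.2]⟩
  have hKR0 : 0 < KK d β * R := by positivity
  have key : ENNReal.ofReal (a * R ^ (d - 1)) ≤ ENNReal.ofReal (12 * KK d β / c1 d) * WW d D := by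
    rcases le_or_gt θ (2 * (KK d β * R)) with h1 | h1
    · have e := h.caseI hθ' hR (by linarith) hT h1
      have e2 : ∫⁻ u in Set.Ioc 0 (3 * (KK d β * R)), ENNReal.ofReal (u ^ d) * D u ≤
          ENNReal.ofReal (3 * (KK d β * R)) * WW d D := by
        unfold WW
        rw [← lintegral_const_mul _ (by fun_prop)]
        refine (setLIntegral_mono' measurableSet_Ioc fun u hu => ?_).trans
          (lintegral_mono_set fun u hu => ⟨hu.1, by linarith [hu.2]⟩)
        rw [← mul_assoc, ← ENNReal.ofReal_mul (by positivity), ← pow_sub_one_mul' h.hd]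
        have := hu.1.le
        gcongr
        exact hu.2
      rw [ENNReal.ofReal_mul ha0]
      calc _ ≤ ENNReal.ofReal (4 / (c1 d * R ^ d)) * (ENNReal.ofReal (3 * (KK d β * R)) * WW d D) *
            ENNReal.ofReal (R ^ (d - 1)) := by
              gcongr
              exact e.trans (by gcongr)
        _ = ENNReal.ofReal (4 / (c1 d * R ^ d) * (3 * (KK d β * R)) * R ^ (d - 1)) * WW d D := by
            rw [ENNReal.ofReal_mul (q := R ^ (d - 1)) (by positivity),
              ENNReal.ofReal_mul (p := 4 / (c1 d * R ^ d)) (by positivity)]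
            ring
        _ = _ := by
            congr 2
            rw [← pow_sub_one_mul' h.hd]
            field_simp
            norm_num
    · rcases ha0.eq_or_lt with h2 | h2
      · rw [← h2]; simp
      have e := h.caseII hθ' hR (by linarith) hT (by linarith) (by linarith [hθ.2]) h2
      have e2 : ENNReal.ofReal (R ^ (d - 1)) * ENNReal.ofReal (a / 2) ≤ WW d D := by
        refine (mul_le_mul_right e _).trans ?_
        rw [← lintegral_const_mul _ hmd]
        unfold WW
        refine (lintegral_mono_set Set.inter_subset_left).trans ?_
        refine (setLIntegral_mono' measurableSet_Ioo fun u hu => ?_).trans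
          (lintegral_mono_set fun u hu => ⟨by linarith [hu.1], by linarith [hu.2, hθ.2]⟩)
        have : R ≤ u := by nlinarith [hu.1]
        gcongr
      have e3 : a * R ^ (d - 1) = 2 * (R ^ (d - 1) * (a / 2)) := by ring
      rw [e3, ENNReal.ofReal_mul (by norm_num), ENNReal.ofReal_mul (by positivity)]
      gcongr
      rw [le_div_iff₀ c0]; linarith
  have h2 : ENNReal.ofReal (a * R ^ (d - 1)) ≤ ENNReal.ofReal (C7 d β * (VV d D).toReal) := by
    refine key.trans ((mul_le_mul_right (WW_le d hmd) _).trans ?_)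
    rw [← mul_assoc, ← ENNReal.ofReal_mul (by positivity), ENNReal.ofReal_mul (C7_pos d h.β0).le,
      ENNReal.ofReal_toReal (show VV d D ≠ ⊤ from h.one.fin)]
    rfl
  have := C7_pos d h.β0
  exact (ENNReal.ofReal_le_ofReal_iff (by positivity)).1 h2

lemma rpow_step {d : ℕ} {β q c R a M u' : ℝ} (hd : 1 ≤ d) (hβ : 0 < β) (hβd : β < d)
    (hq : q = d / (d - β)) (hc : 0 ≤ c) (hR : 0 < R) (ha : 0 ≤ a) (h : |u'| ≤ c * (R ^ β * a / R))
    (hM : a * R ^ (d - 1) ≤ M) : |u'| ^ q ≤ c ^ q * M ^ (q - 1) * (R⁻¹ * a) := by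
  have hdb : 0 < (d:ℝ) - β := by linarith
  have hq1 : 1 < q := by rw [hq, lt_div_iff₀ hdb]; linarith
  rcases ha.eq_or_lt with h0 | h0
  · rw [← h0] at h ⊢
    have : |u'| = 0 := le_antisymm (by simpa using h) (abs_nonneg _)
    rw [this, Real.zero_rpow (by linarith)]; simp
  have hq2 : (β - 1) * q - (d - 1) * (q - 1) = -1 := by
    rw [hq]; field_simp; ring
  have hRd : (R ^ (d - 1) : ℝ) = R ^ ((d:ℝ) - 1) := by
    rw [← Real.rpow_natCast, Nat.cast_sub hd]; simp
  calc |u'| ^ q ≤ (c * (R ^ β * a / R)) ^ q := Real.rpow_le_rpow (abs_nonneg _) h (by linarith)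
    _ = c ^ q * (R ^ (-1:ℝ) * (a * R ^ (d - 1)) ^ (q - 1) * a) := by
        have e1 : R ^ β * a / R = R ^ (β - 1) * a := by
          rw [Real.rpow_sub hR, Real.rpow_one]; ring
        rw [e1, Real.mul_rpow hc (by positivity), Real.mul_rpow (by positivity) ha,
          Real.mul_rpow ha (by positivity), hRd, ← Real.rpow_mul hR.le, ← Real.rpow_mul hR.le]
        congr 1
        have e2 : a ^ q = a ^ (q - 1) * a := by
          rw [← Real.rpow_add_one h0.ne']; simp
        have e3 : R ^ ((β - 1) * q) = R ^ (-1:ℝ) * R ^ (((d:ℝ) - 1) * (q - 1)) := by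
          rw [← Real.rpow_add hR]; congr 1; linarith
        rw [e2, e3]; ring
    _ ≤ c ^ q * (R ^ (-1:ℝ) * M ^ (q - 1) * a) := by
        have : (a * R ^ (d - 1)) ^ (q - 1) ≤ M ^ (q - 1) :=
          Real.rpow_le_rpow (by positivity) hM (by linarith)
        gcongr
    _ = _ := by rw [Real.rpow_neg_one]; ring

end

/-- good points at scale `k` -/
def Gd (d : ℕ) (β : ℝ) (p : Sph d) (γ : ℝ → Sph d) (P U : ℝ → ℝ) (k : ℕ) : Set ℝ :=
  {u | u ∈ Set.Ioo 0 Real.pi ∧ ∃ θ ∈ Set.Ioo 0 (Real.pi / 2),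
    U θ ≤ CT d * (Rk d β k ^ β * av (pf P p) (γ θ) (Rk d β k)) ∧
    |u - θ| < KK d β * Rk d β k ∧ av (pf P p) (γ θ) (Rk d β k) / 2 < P u ∧
    P u < av (pf P p) (γ θ) (Rk d β k)}

lemma Gd_meas {d : ℕ} {β : ℝ} {p : Sph d} {γ : ℝ → Sph d} {P U : ℝ → ℝ}
    (hc : ContinuousOn P (Set.Ioo 0 Real.pi)) (k : ℕ) : MeasurableSet (Gd d β p γ P U k) := by
  have : Gd d β p γ P U k = ⋃ θ ∈ {θ | θ ∈ Set.Ioo 0 (Real.pi / 2) ∧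
      U θ ≤ CT d * (Rk d β k ^ β * av (pf P p) (γ θ) (Rk d β k))},
      (Set.Ioo 0 Real.pi ∩ P ⁻¹' Set.Ioo (av (pf P p) (γ θ) (Rk d β k) / 2)
        (av (pf P p) (γ θ) (Rk d β k))) ∩ {u | |u - θ| < KK d β * Rk d β k} := by
    ext u
    simp only [Set.mem_iUnion, exists_prop]
    constructor
    · rintro ⟨a, θ, b, c, e, f, g⟩
      exact ⟨θ, ⟨b, c⟩, ⟨a, f, g⟩, e⟩
    · rintro ⟨θ, ⟨b, c⟩, ⟨a, f, g⟩, e⟩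
      exact ⟨a, θ, b, c, e, f, g⟩
  rw [this]
  refine (isOpen_biUnion fun θ _ => ?_).measurableSet
  refine (hc.isOpen_inter_preimage isOpen_Ioo isOpen_Ioo).inter ?_
  exact isOpen_lt (by fun_prop) (by fun_prop)

lemma Gd_count (d : ℕ) {β : ℝ} (hβ : 0 < β) : ∃ N : ℕ, ∀ (κ : ℝ) (p : Sph d) (γ : ℝ → Sph d)
    (P : ℝ → ℝ) (D : ℝ → ℝ≥0∞) (U : ℝ → ℝ), Dat d κ β p γ P D U → ∀ u,
    ∑' k, (Gd d β p γ P U k).indicator (1 : ℝ → ℝ≥0∞) u ≤ N := by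
  have h2 : (1:ℝ) < 2 ^ β := Real.one_lt_rpow (by norm_num) hβ
  obtain ⟨N, hN⟩ := pow_unbounded_of_one_lt (2 * CT d * ((3 * KK d β) ^ d / c1 d)) h2
  refine ⟨N, fun κ p γ P D U h u => ?_⟩
  have key : ∀ k1 k2, k1 ≤ k2 → u ∈ Gd d β p γ P U k1 → u ∈ Gd d β p γ P U k2 → k2 < k1 + N := by
    rintro k1 k2 hk ⟨_, θ1, a1, b1, c1', d1, e1⟩ ⟨_, θ2, a2, b2, c2', d2, e2⟩
    have hpi := Real.pi_pos
    have hR2 := Rk_pos d hβ k2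
    have hRR : Rk d β k1 = 2 ^ (k2 - k1) * Rk d β k2 := by
      unfold Rk
      rw [← Nat.sub_add_cancel hk, pow_add]
      simp only [Nat.add_sub_cancel_right]
      field_simp
    have hR : Rk d β k2 ≤ Rk d β k1 := by
      rw [hRR]
      exact le_mul_of_one_le_left hR2.le (one_le_pow₀ (by norm_num))
    have := h.scales (θ1 := θ1) (θ2 := θ2) (u := u) ⟨a1.1, by linarith [a1.2]⟩
      ⟨a2.1, by linarith [a2.2]⟩ hR2 hR (by linarith [KRk d hβ k1]) b2 c1'.le c2'.le e1 d2
    rw [hRR, Real.mul_rpow (by positivity) hR2.le] at this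
    have h3 := le_of_mul_le_mul_right this (by positivity)
    have h4 : ((2:ℝ) ^ (k2 - k1)) ^ β = (2 ^ β) ^ (k2 - k1) := by
      rw [← Real.rpow_natCast, ← Real.rpow_natCast, ← Real.rpow_mul (by norm_num),
        ← Real.rpow_mul (by norm_num), mul_comm]
    rw [h4] at h3
    have h5 := (pow_lt_pow_iff_right₀ h2).1 (h3.trans_lt hN)
    omega
  by_cases hex : ∃ k, u ∈ Gd d β p γ P U k
  · classical
    set k0 := Nat.find hex with hk0
    have h0 : u ∈ Gd d β p γ P U k0 := Nat.find_spec hex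
    rw [tsum_eq_sum (s := Finset.Ico k0 (k0 + N))]
    · calc _ ≤ ∑ k ∈ Finset.Ico k0 (k0 + N), (1 : ℝ≥0∞) :=
            Finset.sum_le_sum fun k _ => by
              by_cases hm : u ∈ Gd d β p γ P U k
              · rw [Set.indicator_of_mem hm]; rfl
              · rw [Set.indicator_of_notMem hm]; exact zero_le
        _ = N := by simp
    · intro k hk
      refine Set.indicator_of_notMem (fun hu => hk ?_) _
      have := Nat.find_min' hex hu
      exact Finset.mem_Ico.2 ⟨this, key k0 k this h0 hu⟩
  · push Not at hex
    have : ∀ k, (Gd d β p γ P U k).indicator (1 : ℝ → ℝ≥0∞) u = 0 := fun k =>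
      Set.indicator_of_notMem (hex k) _
    simp [this]

def JJ (d : ℕ) (β : ℝ) (D : ℝ → ℝ≥0∞) (k : ℕ) : ℝ≥0∞ :=
  ∫⁻ u in Set.Ioc 0 (3 * (KK d β * Rk d β k)), ENNReal.ofReal (u ^ d) * D u

lemma JJ_sum {d : ℕ} (hd : 1 ≤ d) {β : ℝ} (hβ : 0 < β) {D : ℝ → ℝ≥0∞} (hD : Measurable D) :
    ∑' k, ENNReal.ofReal ((Rk d β k)⁻¹) * JJ d β D k ≤ ENNReal.ofReal (8 * KK d β) * WW d D := by
  have hpi := Real.pi_pos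
  have hK := KK_ge d hβ
  have h1 : ∀ k, ENNReal.ofReal ((Rk d β k)⁻¹) * JJ d β D k ≤
      ∫⁻ u in Set.Ioo 0 (3 * Real.pi / 4), ENNReal.ofReal
        (if u / (4 * KK d β) < Rk d β k then (Rk d β k)⁻¹ else 0) *
          (ENNReal.ofReal (u ^ d) * D u) := by
    intro k
    have hR := Rk_pos d hβ k
    have hk := KRk d hβ k
    unfold JJ
    rw [← lintegral_const_mul _ (by fun_prop)]
    refine (setLIntegral_mono' measurableSet_Ioc fun u hu => ?_).trans
      (lintegral_mono_set fun u hu => ⟨hu.1, by linarith [hu.2]⟩)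
    have : u / (4 * KK d β) < Rk d β k := by
      rw [div_lt_iff₀ (by positivity)]
      have : 0 < KK d β * Rk d β k := by positivity
      linarith [hu.2]
    rw [if_pos this]
  refine (ENNReal.tsum_le_tsum h1).trans ?_
  have hmeas : ∀ k, Measurable fun u : ℝ => ENNReal.ofReal
      (if u / (4 * KK d β) < Rk d β k then (Rk d β k)⁻¹ else 0) := fun k =>
    (Measurable.ite (measurableSet_lt (by fun_prop) (by fun_prop)) measurable_const
      measurable_const).ennreal_ofReal
  have hmeas2 : ∀ k, Measurable fun u : ℝ => ENNReal.ofReal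
      (if u / (4 * KK d β) < Rk d β k then (Rk d β k)⁻¹ else 0) *
          (ENNReal.ofReal (u ^ d) * D u) := fun k => (hmeas k).mul (by fun_prop)
  rw [← lintegral_tsum fun k => (hmeas2 k).aemeasurable]
  unfold WW
  rw [← lintegral_const_mul _ (by fun_prop)]
  refine setLIntegral_mono' measurableSet_Ioo fun u hu => ?_
  rw [ENNReal.tsum_mul_right]
  have hu0 : 0 < u := hu.1
  refine (mul_le_mul_left (geom_tsum d hβ (w := u / (4 * KK d β)) (by positivity)) _).trans ?_
  rw [← mul_assoc, ← mul_assoc, ← ENNReal.ofReal_mul (by positivity),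
    ← ENNReal.ofReal_mul (by positivity), ← pow_sub_one_mul' hd]
  refine mul_le_mul_left (ENNReal.ofReal_le_ofReal (le_of_eq ?_)) _
  field_simp
  norm_num

section
variable {d : ℕ} {κ β : ℝ} {p : Sph d} {γ : ℝ → Sph d} {P : ℝ → ℝ} {D : ℝ → ℝ≥0∞} {U : ℝ → ℝ}

def TI (d : ℕ) (β : ℝ) (D : ℝ → ℝ≥0∞) (k : ℕ) (θ : ℝ) : ℝ≥0∞ :=
  (Set.Ioc 0 (2 * (KK d β * Rk d β k))).indicator (fun _ =>
    ENNReal.ofReal ((2 * KK d β) ^ (d - 1) * (4 / c1 d) * (Rk d β k ^ 2)⁻¹) * JJ d β D k) θ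

lemma TI_meas (d : ℕ) (β : ℝ) (D : ℝ → ℝ≥0∞) (k : ℕ) : Measurable (TI d β D k) :=
  measurable_const.indicator measurableSet_Ioc

lemma TI_int (d : ℕ) {β : ℝ} (hβ : 0 < β) (D : ℝ → ℝ≥0∞) (k : ℕ) : ∫⁻ θ, TI d β D k θ =
    ENNReal.ofReal ((2 * KK d β) ^ d * (4 / c1 d)) * (ENNReal.ofReal ((Rk d β k)⁻¹) * JJ d β D k)
    ∨ d = 0 := by
  rcases Nat.eq_zero_or_pos d with h0 | hd
  · right; exact h0
  left
  have hK := KK_ge d hβ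
  have hR := Rk_pos d hβ k
  have c0 := c1_pos d
  unfold TI
  rw [lintegral_indicator measurableSet_Ioc, setLIntegral_const, Real.volume_Ioc, sub_zero,
    mul_right_comm, ← mul_assoc (ENNReal.ofReal ((2 * KK d β) ^ d * (4 / c1 d))),
    ← ENNReal.ofReal_mul (by positivity), ← ENNReal.ofReal_mul (by positivity)]
  congr 2
  rw [← pow_sub_one_mul' hd (2 * KK d β)]
  field_simp

def TS (d : ℕ) (β : ℝ) (G : Set ℝ) (k : ℕ) : Set (ℝ × ℝ) :=
  {x | 2 * (KK d β * Rk d β k) < x.1 ∧ x.1 < Real.pi / 2 ∧ |x.2 - x.1| < KK d β * Rk d β k ∧ x.2 ∈ G}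

lemma TS_meas (d : ℕ) (β : ℝ) {G : Set ℝ} (hG : MeasurableSet G) (k : ℕ) :
    MeasurableSet (TS d β G k) :=
  by
  have h1 : MeasurableSet {x : ℝ × ℝ | 2 * (KK d β * Rk d β k) < x.1} :=
    measurableSet_lt (by fun_prop) (by fun_prop)
  have h2 : MeasurableSet {x : ℝ × ℝ | x.1 < Real.pi / 2} :=
    measurableSet_lt (by fun_prop) (by fun_prop)
  have h3 : MeasurableSet {x : ℝ × ℝ | |x.2 - x.1| < KK d β * Rk d β k} :=
    (isOpen_lt (by fun_prop) (by fun_prop)).measurableSet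
  exact h1.inter (h2.inter (h3.inter (measurable_snd hG)))

def TF (d : ℕ) (β : ℝ) (D : ℝ → ℝ≥0∞) (G : Set ℝ) (k : ℕ) : ℝ × ℝ → ℝ≥0∞ :=
  (TS d β G k).indicator fun x => ENNReal.ofReal (2 * (Rk d β k)⁻¹ * x.1 ^ (d - 1)) * D x.2

lemma TF_meas (d : ℕ) (β : ℝ) {D : ℝ → ℝ≥0∞} (hD : Measurable D) {G : Set ℝ}
    (hG : MeasurableSet G) (k : ℕ) : Measurable (TF d β D G k) :=
  Measurable.indicator (by fun_prop) (TS_meas d β hG k)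

lemma TF_int (d : ℕ) {β : ℝ} (hβ : 0 < β) {D : ℝ → ℝ≥0∞} (hD : Measurable D) {G : Set ℝ}
    (hG : MeasurableSet G) (k : ℕ) : ∫⁻ θ, (∫⁻ u, TF d β D G k (θ, u)) ≤
    ENNReal.ofReal (4 * KK d β * 2 ^ (d - 1)) *
      ∫⁻ u in Set.Ioo 0 (3 * Real.pi / 4), (ENNReal.ofReal (u ^ (d - 1)) * D u) * G.indicator 1 u := by
  have hK := KK_ge d hβ
  have hR := Rk_pos d hβ k
  have hk := KRk d hβ k
  have hpi := Real.pi_pos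
  set ρ := KK d β * Rk d β k with hρ
  have hρ0 : 0 < ρ := by positivity
  rw [lintegral_lintegral_swap (f := fun θ u => TF d β D G k (θ, u))
      (TF_meas d β hD hG k).aemeasurable,
    ← lintegral_const_mul _ (by
      exact ((by fun_prop : Measurable fun u : ℝ => ENNReal.ofReal (u ^ (d - 1)) * D u)).mul
        (measurable_one.indicator hG)), ← lintegral_indicator measurableSet_Ioo]
  refine lintegral_mono fun u => ?_
  by_cases hu : u ∈ Set.Ioo 0 (3 * Real.pi / 4) ∧ u ∈ G
  · rw [Set.indicator_of_mem hu.1, Set.indicator_of_mem hu.2, Pi.one_apply, mul_one]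
    have hu0 := hu.1.1
    have h1 : ∀ θ, TF d β D G k (θ, u) ≤ (Set.Ioo (u - ρ) (u + ρ)).indicator (fun _ =>
        ENNReal.ofReal (2 * (Rk d β k)⁻¹ * (2 * u) ^ (d - 1)) * D u) θ := by
      intro θ
      by_cases hm : (θ, u) ∈ TS d β G k
      · obtain ⟨a, b, c, e⟩ := hm
        simp only at a b c e
        have c' := abs_lt.1 c
        have hθ : θ ∈ Set.Ioo (u - ρ) (u + ρ) := ⟨by linarith [c'.2], by linarith [c'.1]⟩
        rw [Set.indicator_of_mem hθ, TF, Set.indicator_of_mem (show (θ, u) ∈ TS d β G k from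
          ⟨a, b, c, e⟩)]
        simp only
        gcongr
        · linarith
        · linarith [c'.1, c'.2]
      · rw [TF, Set.indicator_of_notMem hm]; exact zero_le
    refine (lintegral_mono h1).trans ?_
    rw [lintegral_indicator measurableSet_Ioo, setLIntegral_const, Real.volume_Ioo, ← mul_assoc,
      mul_right_comm, ← ENNReal.ofReal_mul (by positivity), ← ENNReal.ofReal_mul (by positivity)]
    refine mul_le_mul_left (ENNReal.ofReal_le_ofReal (le_of_eq ?_)) _
    rw [mul_pow, hρ]
    field_simp
    ring
  · have h1 : ∀ θ, TF d β D G k (θ, u) = 0 := by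
      intro θ
      refine Set.indicator_of_notMem ?_ _
      rintro ⟨a, b, c, e⟩
      simp only at a b c e
      have c' := abs_lt.1 c
      exact hu ⟨⟨by linarith [c'.1], by linarith [c'.2]⟩, e⟩
    simp [h1]

end

def C8 (d : ℕ) (β : ℝ) : ℝ := 2 / c1 d * (Real.pi ^ β / (R0 d β / 4)) * C4 d β (R0 d β / 4)

lemma C4_pos {d : ℕ} (hd : 1 ≤ d) {β r : ℝ} (hβ : 0 < β) (h0 : 0 < r) (hr : r ≤ Real.pi) :
    0 < C4 d β r := by
  have hpi := Real.pi_pos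
  have := vv_pos hd h0 hr
  have := vv_pos hd hpi le_rfl
  have : 0 < min β 1 := lt_min hβ one_pos
  unfold C4; positivity

lemma R0_le (d : ℕ) {β : ℝ} (hβ : 0 < β) : R0 d β ≤ Real.pi := by
  have hpi := Real.pi_pos
  have hK := KK_ge d hβ
  unfold R0
  exact div_le_self hpi.le (by linarith)

lemma C8_pos {d : ℕ} (hd : 1 ≤ d) {β : ℝ} (hβ : 0 < β) : 0 < C8 d β := by
  have hpi := Real.pi_pos
  have h0 := R0_pos d hβ
  have := R0_le d hβ
  have := C4_pos hd hβ (r := R0 d β / 4) (by positivity) (by linarith)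
  have := c1_pos d
  unfold C8; positivity

section
variable {d : ℕ} {κ β : ℝ} {p : Sph d} {γ : ℝ → Sph d} {P : ℝ → ℝ} {D : ℝ → ℝ≥0∞} {U : ℝ → ℝ}

def EE (d : ℕ) (β q V : ℝ) : ℝ := CD d ^ q * (C7 d β * V) ^ (q - 1)

lemma Dat.pointwise (h : Dat d κ β p γ P D U) {q : ℝ} (hq : q = d / (d - β)) {θ : ℝ}
    (hθ : θ ∈ Set.Ioo 0 (Real.pi / 2)) :
    ENNReal.ofReal (|deriv U θ| ^ q * Real.sin θ ^ (d - 1)) ≤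
      ENNReal.ofReal ((C8 d β * (VV d D).toReal) ^ q) +
      ENNReal.ofReal (EE d β q (VV d D).toReal) * ∑' k, (TI d β D k θ +
        ∫⁻ u, TF d β D (Gd d β p γ P U k) k (θ, u)) := by
  have hpi := Real.pi_pos
  have hdb : 0 < (d:ℝ) - β := by linarith [h.βd]
  have hb := h.β0
  have hq1 : 1 < q := by rw [hq, lt_div_iff₀ hdb]; linarith
  have hK := KK_ge d hb
  have c0 := c1_pos d
  set V := (VV d D).toReal with hV
  have hV0 : 0 ≤ V := ENNReal.toReal_nonneg
  have hR0 := R0_pos d hb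
  have hR0' := R0_le d hb
  have hθ' : θ ∈ Set.Ioo 0 Real.pi := ⟨hθ.1, by linarith [hθ.2]⟩
  have hsin0 : 0 ≤ Real.sin θ := sin_nn (Set.Ioo_subset_Icc_self hθ')
  by_cases hu0 : deriv U θ = 0
  · rw [hu0, abs_zero, Real.zero_rpow (by linarith)]; simp
  have hdiff : DifferentiableAt ℝ U θ := by
    by_contra hc
    exact hu0 (deriv_zero_of_not_differentiableAt hc)
  obtain ⟨ζ, r, hr0, hrpi, hζ, hU1, hn, hder⟩ := h.deriv_ball hθ' hdiff.hasDerivAt hu0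
  set u' := deriv U θ
  rcases le_or_gt (R0 d β / 4) r with hr | hr
  · have h1 := h.big_ball (by positivity) hr hrpi hn
    refine le_trans (ENNReal.ofReal_le_ofReal ?_) le_self_add
    have h2 : |u'| ≤ C8 d β * V := by
      refine hder.trans ?_
      have h3 : r ^ β * av (pf P p) ζ r / r ≤
          (Real.pi ^ β / (R0 d β / 4)) * (C4 d β (R0 d β / 4) * V) := by
        have : r ^ β ≤ Real.pi ^ β := Real.rpow_le_rpow hr0.le hrpi hb.le
        have h4 : 0 ≤ av (pf P p) ζ r := av_nonneg h.nn _ _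
        calc r ^ β * av (pf P p) ζ r / r = r ^ β / r * av (pf P p) ζ r := by ring
          _ ≤ _ := by
            gcongr
      calc _ ≤ 2 / c1 d * ((Real.pi ^ β / (R0 d β / 4)) * (C4 d β (R0 d β / 4) * V)) := by gcongr
        _ = _ := by unfold C8; ring
    have h5 : Real.sin θ ^ (d - 1) ≤ 1 := pow_le_one₀ hsin0 (Real.sin_le_one _)
    have h6 : |u'| ^ q ≤ (C8 d β * V) ^ q := Real.rpow_le_rpow (abs_nonneg _) h2 (by linarith)
    have h7 : 0 ≤ |u'| ^ q := by positivity
    nlinarith [pow_nonneg hsin0 (d - 1)]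
  · obtain ⟨k, hk1, hk2⟩ := Rk_exists d hr0 hr
    have hRk := Rk_pos d hb k
    have hRk' := Rk_le d hb k
    have hKRk := KRk d hb k
    obtain ⟨hT, hD⟩ := h.small hr0 hk1 hk2 (by linarith) hζ hU1 hder
    have hA := h.a_bound hθ hRk hKRk hT
    set R := Rk d β k with hR
    set a := av (pf P p) (γ θ) R with ha
    have ha0 : 0 ≤ a := av_nonneg h.nn _ _
    have hE := rpow_step h.hd hb h.βd hq (CD_pos d).le hRk ha0 hD hA
    have hC7 := C7_pos d hb
    have hCD := CD_pos d
    have hE0 : 0 ≤ EE d β q V := by unfold EE; positivity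
    have hsinθ : Real.sin θ ≤ θ := Real.sin_le hθ.1.le
    refine le_trans ?_ le_add_self
    refine le_trans ?_ (mul_le_mul_right (ENNReal.le_tsum k) _)
    have hmain : ENNReal.ofReal (|u'| ^ q * Real.sin θ ^ (d - 1)) ≤
        ENNReal.ofReal (EE d β q V) * (ENNReal.ofReal (R⁻¹ * θ ^ (d - 1)) * ENNReal.ofReal a) := by
      rw [← ENNReal.ofReal_mul (by have := hθ.1.le; positivity), ← ENNReal.ofReal_mul hE0]
      refine ENNReal.ofReal_le_ofReal ?_
      calc |u'| ^ q * Real.sin θ ^ (d - 1) ≤ (EE d β q V * (R⁻¹ * a)) * θ ^ (d - 1) := by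
            refine mul_le_mul hE (by gcongr) (by positivity) (by positivity)
        _ = _ := by ring
    refine hmain.trans (mul_le_mul_right ?_ _)
    rcases le_or_gt θ (2 * (KK d β * R)) with h1 | h1
    · have e := h.caseI hθ' hRk (by linarith) hT h1
      refine le_trans ?_ le_self_add
      have hm : θ ∈ Set.Ioc 0 (2 * (KK d β * Rk d β k)) := ⟨hθ.1, h1⟩
      rw [TI, Set.indicator_of_mem hm]
      refine (mul_le_mul_right e _).trans ?_
      rw [← mul_assoc, ← ENNReal.ofReal_mul (by have := hθ.1.le; positivity)]
      refine mul_le_mul_left (ENNReal.ofReal_le_ofReal ?_) _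
      have hθ0 := hθ.1.le
      calc R⁻¹ * θ ^ (d - 1) * (4 / (c1 d * R ^ d)) ≤
          R⁻¹ * (2 * (KK d β * R)) ^ (d - 1) * (4 / (c1 d * R ^ d)) := by gcongr
        _ = (2 * KK d β) ^ (d - 1) * (4 / c1 d) * (R ^ 2)⁻¹ := by
          rw [← mul_assoc 2, mul_pow (2 * KK d β), ← pow_sub_one_mul' h.hd R]
          field_simp
    · rcases ha0.eq_or_lt with h2 | h2
      · rw [← h2]; simp
      have e := h.caseII hθ' hRk (by linarith) hT (by linarith) (by linarith [hθ.2]) h2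
      refine le_trans ?_ le_add_self
      have hGm := Gd_meas (d := d) (β := β) (p := p) (γ := γ) (P := P) (U := U) h.one.cont k
      have hset : MeasurableSet (Set.Ioo (θ - KK d β * R) (θ + KK d β * R) ∩
          {u | a / 2 < P u ∧ P u < a}) :=
        measurableSet_Ioo.inter (h.one.measP measurableSet_Ioo)
      have e2 : ENNReal.ofReal (R⁻¹ * θ ^ (d - 1)) * ENNReal.ofReal a =
          ENNReal.ofReal (2 * R⁻¹ * θ ^ (d - 1)) * ENNReal.ofReal (a / 2) := by
        have := hθ.1.le
        rw [← ENNReal.ofReal_mul (by positivity), ← ENNReal.ofReal_mul (by positivity)]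
        congr 1; ring
      rw [e2]
      refine (mul_le_mul_right e _).trans ?_
      rw [← lintegral_const_mul _ h.one.measD, ← lintegral_indicator hset]
      refine lintegral_mono fun u => ?_
      by_cases hu : u ∈ Set.Ioo (θ - KK d β * R) (θ + KK d β * R) ∩ {u | a / 2 < P u ∧ P u < a}
      · rw [Set.indicator_of_mem hu]
        obtain ⟨hu1, hu2, hu3⟩ := hu
        have habs : |u - θ| < KK d β * R := by
          rw [abs_lt]; exact ⟨by linarith [hu1.1], by linarith [hu1.2]⟩
        have hmem : (θ, u) ∈ TS d β (Gd d β p γ P U k) k :=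
          ⟨h1, hθ.2, habs, ⟨by linarith [hu1.1], by linarith [hu1.2, hθ.2]⟩, θ, hθ, hT, habs,
            hu2, hu3⟩
        rw [TF, Set.indicator_of_mem hmem]
      · rw [Set.indicator_of_notMem hu]; exact zero_le

lemma Dat.half {d : ℕ} {β q : ℝ} (hd : 1 ≤ d) (hβ : 0 < β) (hβd : β < d)
    (hq : q = d / (d - β)) : ∃ C : ℝ, 0 ≤ C ∧ ∀ (κ : ℝ) (p : Sph d) (γ : ℝ → Sph d)
    (P : ℝ → ℝ) (D : ℝ → ℝ≥0∞) (U : ℝ → ℝ), Dat d κ β p γ P D U →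
    ∫⁻ θ in Set.Ioo 0 (Real.pi / 2), ENNReal.ofReal (|deriv U θ| ^ q * Real.sin θ ^ (d - 1)) ≤
      ENNReal.ofReal (C * (VV d D).toReal ^ q) := by
  obtain ⟨N, hN⟩ := Gd_count d hβ
  have hpi := Real.pi_pos
  have hdb : 0 < (d:ℝ) - β := by linarith
  have hq1 : 1 < q := by rw [hq, lt_div_iff₀ hdb]; linarith
  have hK := KK_ge d hβ
  have c0 := c1_pos d
  have hC7 := C7_pos d hβ
  have hCD := CD_pos d
  have hC8 := C8_pos hd hβ
  set B : ℝ := (2 * KK d β) ^ d * (4 / c1 d) * (8 * KK d β) + 4 * KK d β * 2 ^ (d - 1) * N with hB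
  have hB0 : 0 ≤ B := by positivity
  refine ⟨C8 d β ^ q * (Real.pi / 2) + CD d ^ q * C7 d β ^ (q - 1) * (B *
    (3 * Real.pi / 2) ^ (d - 1)), by positivity, fun κ p γ P D U h => ?_⟩
  have hmd := h.one.measD
  set V := (VV d D).toReal with hV
  have hV0 : 0 ≤ V := ENNReal.toReal_nonneg
  have hE0 : 0 ≤ EE d β q V := by unfold EE; positivity
  have hGm := fun k => Gd_meas (d := d) (β := β) (p := p) (γ := γ) (P := P) (U := U) h.one.cont k
  have hm2 : ∀ k, Measurable fun θ => ∫⁻ u, TF d β D (Gd d β p γ P U k) k (θ, u) := fun k =>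
    (TF_meas d β hmd (hGm k) k).lintegral_prod_right'
  have hm : ∀ k, Measurable fun θ => TI d β D k θ +
      ∫⁻ u, TF d β D (Gd d β p γ P U k) k (θ, u) := fun k => (TI_meas d β D k).add (hm2 k)
  have hsum : ∫⁻ θ, ∑' k, (TI d β D k θ + ∫⁻ u, TF d β D (Gd d β p γ P U k) k (θ, u)) ≤
      ENNReal.ofReal B * WW d D := by
    rw [lintegral_tsum fun k => (hm k).aemeasurable]
    have e1 : ∀ k, ∫⁻ θ, (TI d β D k θ + ∫⁻ u, TF d β D (Gd d β p γ P U k) k (θ, u)) ≤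
        ENNReal.ofReal ((2 * KK d β) ^ d * (4 / c1 d)) *
          (ENNReal.ofReal ((Rk d β k)⁻¹) * JJ d β D k) +
        ENNReal.ofReal (4 * KK d β * 2 ^ (d - 1)) *
        ∫⁻ u in Set.Ioo 0 (3 * Real.pi / 4), (ENNReal.ofReal (u ^ (d - 1)) * D u) *
          (Gd d β p γ P U k).indicator 1 u := by
      intro k
      rw [lintegral_add_left (TI_meas d β D k)]
      refine add_le_add (le_of_eq ?_) (TF_int d hβ hmd (hGm k) k)
      rcases TI_int d hβ D k with h1 | h1
      · exact h1
      · omega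
    refine (ENNReal.tsum_le_tsum e1).trans ?_
    rw [ENNReal.tsum_add, ENNReal.tsum_mul_left, ENNReal.tsum_mul_left, hB,
      ENNReal.ofReal_add (by positivity) (by positivity), add_mul]
    refine add_le_add ?_ ?_
    · rw [ENNReal.ofReal_mul (p := (2 * KK d β) ^ d * (4 / c1 d)) (q := 8 * KK d β) (by positivity), mul_assoc]
      exact mul_le_mul_right (JJ_sum hd hβ hmd) _
    · rw [ENNReal.ofReal_mul (p := 4 * KK d β * 2 ^ (d - 1)) (q := (N:ℝ)) (by positivity),
        mul_assoc (ENNReal.ofReal (4 * KK d β * 2 ^ (d - 1))) (ENNReal.ofReal (N : ℝ))]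
      refine mul_le_mul_right ?_ _
      have hm3 : ∀ k, Measurable fun u : ℝ => (ENNReal.ofReal (u ^ (d - 1)) * D u) *
          (Gd d β p γ P U k).indicator (1 : ℝ → ℝ≥0∞) u := fun k =>
        (by fun_prop : Measurable fun u : ℝ => ENNReal.ofReal (u ^ (d - 1)) * D u).mul
          (measurable_one.indicator (hGm k))
      rw [← lintegral_tsum fun k => (hm3 k).aemeasurable]
      unfold WW
      rw [← lintegral_const_mul _ (by fun_prop)]
      refine lintegral_mono fun u => ?_
      rw [ENNReal.tsum_mul_left, mul_comm]
      refine mul_le_mul_left ((hN κ p γ P D U h u).trans ?_) _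
      rw [ENNReal.ofReal_natCast]
  have hVV : WW d D ≤ ENNReal.ofReal ((3 * Real.pi / 2) ^ (d - 1) * V) := by
    rw [ENNReal.ofReal_mul (by positivity), hV, ENNReal.ofReal_toReal
      (show VV d D ≠ ⊤ from h.one.fin)]
    exact WW_le d hmd
  calc _ ≤ ∫⁻ θ in Set.Ioo 0 (Real.pi / 2), (ENNReal.ofReal ((C8 d β * V) ^ q) +
      ENNReal.ofReal (EE d β q V) * ∑' k, (TI d β D k θ +
        ∫⁻ u, TF d β D (Gd d β p γ P U k) k (θ, u))) :=
        setLIntegral_mono' measurableSet_Ioo fun θ hθ => h.pointwise hq hθ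
    _ = ENNReal.ofReal ((C8 d β * V) ^ q) * ENNReal.ofReal (Real.pi / 2) +
      ENNReal.ofReal (EE d β q V) * ∫⁻ θ in Set.Ioo 0 (Real.pi / 2), ∑' k, (TI d β D k θ +
        ∫⁻ u, TF d β D (Gd d β p γ P U k) k (θ, u)) := by
        rw [lintegral_add_left measurable_const, setLIntegral_const, Real.volume_Ioo, sub_zero,
          lintegral_const_mul _ (Measurable.tsum hm)]
    _ ≤ ENNReal.ofReal ((C8 d β * V) ^ q) * ENNReal.ofReal (Real.pi / 2) +
      ENNReal.ofReal (EE d β q V) * (ENNReal.ofReal B *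
        ENNReal.ofReal ((3 * Real.pi / 2) ^ (d - 1) * V)) := by
        gcongr
        exact (setLIntegral_le_lintegral _ _).trans (hsum.trans (by gcongr))
    _ = _ := by
        rw [← ENNReal.ofReal_mul (by positivity), ← ENNReal.ofReal_mul (by positivity),
          ← ENNReal.ofReal_mul (by positivity), ← ENNReal.ofReal_add (by positivity)
            (by positivity)]
        congr 1
        rw [EE, Real.mul_rpow hC8.le hV0, Real.mul_rpow hC7.le hV0]
        have : V ^ (q - 1) * V = V ^ q := by
          rcases hV0.eq_or_lt with h0 | h0
          · rw [← h0, Real.zero_rpow (by linarith), Real.zero_rpow (by linarith)]; simp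
          · rw [← Real.rpow_add_one h0.ne']; simp
        rw [← this]; ring

/-- Reflection of the data. -/
lemma OneDim.refl {P : ℝ → ℝ} {D : ℝ → ℝ≥0∞} (h : OneDim d P D) :
    OneDim d (fun u => P (Real.pi - u)) (fun u => D (Real.pi - u)) := by
  have hpre : (fun u : ℝ => Real.pi - u) ⁻¹' Set.Ioo 0 Real.pi = Set.Ioo 0 Real.pi := by
    ext u; simp only [Set.mem_preimage, Set.mem_Ioo]; constructor <;> rintro ⟨a, b⟩ <;>
      constructor <;> linarith
  have hmp : MeasurePreserving (fun u : ℝ => Real.pi - u) volume volume :=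
    Measure.measurePreserving_sub_left volume Real.pi
  have hemb : MeasurableEmbedding (fun u : ℝ => Real.pi - u) :=
    (MeasurableEquiv.subLeft Real.pi).measurableEmbedding
  refine ⟨h.measD.comp (by fun_prop), h.measP.comp (by fun_prop), fun u => h.nonneg _, ?_, ?_, ?_,
    ?_⟩
  · refine h.cont.comp (by fun_prop) fun u hu => ?_
    exact ⟨by linarith [hu.2], by linarith [hu.1]⟩
  · intro a b ha hab hb
    have h1 := h.bound (Real.pi - b) (Real.pi - a) (by linarith) (by linarith) (by linarith)
    rw [abs_sub_comm]
    refine h1.trans ?_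
    have h2 := hmp.setLIntegral_comp_preimage_emb hemb D (Set.Ico (Real.pi - b) (Real.pi - a))
    have h3 : (fun u : ℝ => Real.pi - u) ⁻¹' Set.Ico (Real.pi - b) (Real.pi - a) = Set.Ioc a b := by
      ext u; simp only [Set.mem_preimage, Set.mem_Ico, Set.mem_Ioc]; constructor <;>
        rintro ⟨x, y⟩ <;> constructor <;> linarith
    rw [h3] at h2
    rw [h2, ← restrict_Ioo_eq_restrict_Ioc, ← restrict_Ioo_eq_restrict_Ico]
  · have h2 := hmp.setLIntegral_comp_preimage_emb hemb
      (fun u => ENNReal.ofReal (Real.sin u ^ (d - 1)) * D u) (Set.Ioo 0 Real.pi)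
    rw [hpre] at h2
    simp only [Real.sin_pi_sub] at h2
    rw [h2]; exact h.fin
  · have h2 := (hmp.integrableOn_comp_preimage hemb (f := fun u => P u * Real.sin u ^ (d - 1))
      (s := Set.Ioo 0 Real.pi)).2 h.integ
    rw [hpre] at h2
    simpa [Function.comp_def, Real.sin_pi_sub] using h2

lemma VV_refl (d : ℕ) (D : ℝ → ℝ≥0∞) : VV d (fun u => D (Real.pi - u)) = VV d D := by
  have hpre : (fun u : ℝ => Real.pi - u) ⁻¹' Set.Ioo 0 Real.pi = Set.Ioo 0 Real.pi := by
    ext u; simp only [Set.mem_preimage, Set.mem_Ioo]; constructor <;> rintro ⟨a, b⟩ <;>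
      constructor <;> linarith
  have h2 := (Measure.measurePreserving_sub_left volume Real.pi).setLIntegral_comp_preimage_emb
    (MeasurableEquiv.subLeft Real.pi).measurableEmbedding
      (fun u => ENNReal.ofReal (Real.sin u ^ (d - 1)) * D u) (Set.Ioo 0 Real.pi)
  rw [hpre] at h2
  simp only [Real.sin_pi_sub] at h2
  exact h2

lemma pf_refl {d : ℕ} (P : ℝ → ℝ) (p : Sph d) : pf (fun u => P (Real.pi - u)) (-p) = pf P p := by
  funext η
  unfold pf
  rw [geodist_neg]
  simp

lemma Dat.refl (h : Dat d κ β p γ P D U) : Dat d κ β (-p) (fun θ => γ (Real.pi - θ))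
    (fun u => P (Real.pi - u)) (fun u => D (Real.pi - u)) (fun θ => U (Real.pi - θ)) where
  hd := h.hd
  κ0 := h.κ0
  hK := h.hK
  β0 := h.β0
  βd := h.βd
  one := h.one.refl
  γc := h.γc.comp (by fun_prop)
  γp := fun θ hθ => by
    rw [geodist_neg, h.γp _ ⟨by linarith [hθ.2], by linarith [hθ.1]⟩]; ring
  γd := fun s hs t ht => by
    rw [h.γd _ ⟨by linarith [hs.2], by linarith [hs.1]⟩ _ ⟨by linarith [ht.2], by linarith [ht.1]⟩,
      abs_sub_comm]
    congr 1; ring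
  ub := fun θ hθ => by
    rw [pf_refl]
    exact h.ub _ ⟨by linarith [hθ.2], by linarith [hθ.1]⟩
  lub := fun θ hθ => by
    rw [pf_refl]
    exact h.lub _ ⟨by linarith [hθ.2], by linarith [hθ.1]⟩

lemma Dat.full {d : ℕ} {β q : ℝ} (hd : 1 ≤ d) (hβ : 0 < β) (hβd : β < d)
    (hq : q = d / (d - β)) : ∃ C : ℝ, 0 ≤ C ∧ ∀ (κ : ℝ) (p : Sph d) (γ : ℝ → Sph d)
    (P : ℝ → ℝ) (D : ℝ → ℝ≥0∞) (U : ℝ → ℝ), Dat d κ β p γ P D U →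
    ∫⁻ θ in Set.Ioo 0 Real.pi, ENNReal.ofReal (|deriv U θ| ^ q * Real.sin θ ^ (d - 1)) ≤
      ENNReal.ofReal (C * (VV d D).toReal ^ q) := by
  obtain ⟨C, hC, H⟩ := Dat.half hd hβ hβd hq
  refine ⟨C + C, by positivity, fun κ p γ P D U h => ?_⟩
  have h1 := H κ p γ P D U h
  have h2 := H _ _ _ _ _ _ h.refl
  rw [VV_refl] at h2
  have hpi := Real.pi_pos
  have h3 : ∫⁻ θ in Set.Ioo 0 (Real.pi / 2), ENNReal.ofReal
      (|deriv (fun θ => U (Real.pi - θ)) θ| ^ q * Real.sin θ ^ (d - 1)) =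
      ∫⁻ θ in Set.Ioo (Real.pi / 2) Real.pi, ENNReal.ofReal
        (|deriv U θ| ^ q * Real.sin θ ^ (d - 1)) := by
    have e := (Measure.measurePreserving_sub_left volume Real.pi).setLIntegral_comp_preimage_emb
      (MeasurableEquiv.subLeft Real.pi).measurableEmbedding
      (fun θ => ENNReal.ofReal (|deriv U θ| ^ q * Real.sin θ ^ (d - 1)))
        (Set.Ioo (Real.pi / 2) Real.pi)
    have hpre : (fun u : ℝ => Real.pi - u) ⁻¹' Set.Ioo (Real.pi / 2) Real.pi =
        Set.Ioo 0 (Real.pi / 2) := by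
      ext u; simp only [Set.mem_preimage, Set.mem_Ioo]; constructor <;> rintro ⟨a, b⟩ <;>
        constructor <;> linarith
    rw [hpre] at e
    rw [← e]
    simp only [Real.sin_pi_sub]
    congr 1
    funext θ
    rw [deriv_comp_const_sub, abs_neg]
  rw [h3] at h2
  have hV0 : 0 ≤ (VV d D).toReal := ENNReal.toReal_nonneg
  rw [add_mul, ENNReal.ofReal_add (by positivity) (by positivity)]
  have hU : Set.Ioo 0 Real.pi ⊆ Set.Ioo 0 (Real.pi / 2) ∪ Set.Ico (Real.pi / 2) Real.pi := by
    intro u hu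
    rcases lt_or_ge u (Real.pi / 2) with h | h
    · exact Or.inl ⟨hu.1, h⟩
    · exact Or.inr ⟨h, hu.2⟩
  refine (lintegral_mono_set hU).trans ((lintegral_union_le _ _ _).trans (add_le_add h1 ?_))
  rw [← restrict_Ioo_eq_restrict_Ico]
  exact h2

end

/-! ### Construction of the data from the maximal function -/

lemma exists_meridian {d : ℕ} (hd : 1 ≤ d) : ∃ γ : ℝ → Sph d, Continuous γ ∧
    (∀ θ ∈ Set.Icc 0 Real.pi, geodist (npole d) (γ θ) = θ) ∧
    (∀ s ∈ Set.Icc 0 Real.pi, ∀ t ∈ Set.Icc 0 Real.pi, geodist (γ s) (γ t) = |s - t|) := by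
  obtain ⟨m, rfl⟩ : ∃ m, d = m + 1 := ⟨d - 1, by omega⟩
  let e : Euc (m + 1 + 1) := EuclideanSpace.single 0 1
  let w : Euc (m + 1 + 1) := EuclideanSpace.single 1 1
  have hee : ⟪e, e⟫ = 1 := by simp [e, EuclideanSpace.inner_single_left]
  have hww : ⟪w, w⟫ = 1 := by simp [w, EuclideanSpace.inner_single_left]
  have hew : ⟪e, w⟫ = 0 := by simp [e, w, EuclideanSpace.inner_single_left]
  have hwe : ⟪w, e⟫ = 0 := by rw [real_inner_comm]; exact hew
  have hin : ∀ s t : ℝ, ⟪Real.cos s • e + Real.sin s • w, Real.cos t • e + Real.sin t • w⟫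
      = Real.cos (s - t) := by
    intro s t
    simp only [inner_add_left, inner_add_right, inner_smul_left, inner_smul_right, hee, hww, hew,
      hwe, Real.cos_sub]
    simp
    try ring
  have hn : ∀ s : ℝ, Real.cos s • e + Real.sin s • w ∈ Metric.sphere (0 : Euc (m + 1 + 1)) 1 := by
    intro s
    rw [mem_sphere_zero_iff_norm]
    have h1 := hin s s
    rw [sub_self, Real.cos_zero, real_inner_self_eq_norm_sq] at h1
    exact (pow_eq_one_iff_of_nonneg (norm_nonneg _) (by norm_num)).1 h1
  have hd' : ∀ s ∈ Set.Icc 0 Real.pi, ∀ t ∈ Set.Icc 0 Real.pi,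
      Real.arccos (Real.cos (s - t)) = |s - t| := by
    intro s hs t ht
    rw [← Real.cos_abs, Real.arccos_cos (abs_nonneg _)]
    rw [abs_le]
    exact ⟨by linarith [hs.1, ht.2], by linarith [hs.2, ht.1]⟩
  refine ⟨fun θ => ⟨Real.cos θ • e + Real.sin θ • w, hn θ⟩, ?_, ?_, ?_⟩
  · refine Continuous.subtype_mk ?_ _
    fun_prop
  · intro θ hθ
    have h0 : (npole (m + 1) : Euc (m + 1 + 1)) = Real.cos 0 • e + Real.sin 0 • w := by
      simp [npole, e]
    unfold geodist
    rw [h0, hin, hd' 0 ⟨le_rfl, Real.pi_pos.le⟩ θ hθ, zero_sub, abs_neg, abs_of_nonneg hθ.1]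
  · intro s hs t ht
    unfold geodist
    rw [hin, hd' s hs t ht]

lemma av_iso {d : ℕ} {κ : ℝ} (hκ : 0 < κ) (hK : IsKappa d κ) (P : ℝ → ℝ) (p : Sph d)
    (T : Euc (d + 1) ≃ₗᵢ[ℝ] Euc (d + 1)) (hT : sphIso T p = p) (ζ : Sph d) {r : ℝ}
    (h0 : 0 ≤ r) (hr : r ≤ Real.pi) : av (pf P p) (sphIso T ζ) r = av (pf P p) ζ r := by
  rw [av_eq hκ hK _ _ h0 hr, av_eq hκ hK _ _ h0 hr]
  congr 1
  rw [← (measurePreserving_sphIso T).setIntegral_preimage_emb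
    (sphIso T).toHomeomorph.measurableEmbedding]
  have h1 : (sphIso T) ⁻¹' (gball (sphIso T ζ) r) = gball ζ r := by
    ext η
    change geodist (sphIso T ζ) (sphIso T η) < r ↔ geodist ζ η < r
    rw [geodist_sphIso]
  have h2 : ∀ η, pf P p (sphIso T η) = pf P p η := by
    intro η
    unfold pf
    conv_lhs => rw [← hT]
    rw [geodist_sphIso]
  rw [h1]
  simp only [h2]

lemma dat_exists {d : ℕ} (hd : 1 ≤ d) {κ β : ℝ} (hκ : 0 < κ) (hK : IsKappa d κ) (hβ : 0 < β)
    (hβd : β < d) {P : ℝ → ℝ} {D : ℝ → ℝ≥0∞} (h : OneDim d P D) {f : Sph d → ℝ}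
    (hf : ∀ᵐ η ∂(sphMeasure d), |f η| = P (geodist (npole d) η)) :
    ∃ γ U, Dat d κ β (npole d) γ P D U ∧ ∀ ξ, geodist (npole d) ξ ∈ Set.Ioo 0 Real.pi →
      sphMax β f ξ = U (geodist (npole d) ξ) := by
  obtain ⟨γ, hγc, hγp, hγd⟩ := exists_meridian hd
  have hav : ∀ ζ r, ⨍ η in gball ζ r, |f η| ∂(sphMeasure d) = av (pf P (npole d)) ζ r :=
    fun ζ r => average_congr (ae_restrict_of_ae hf)
  have hM : ∀ ξ, sphMax β f ξ = sSup {a | ∃ ζ : Sph d, ∃ r : ℝ, 0 < r ∧ r ≤ Real.pi ∧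
      geodist ζ ξ ≤ r ∧ a = r ^ β * av (pf P (npole d)) ζ r} := by
    intro ξ
    unfold sphMax
    simp only [hav]
  have hne : ∀ ξ : Sph d, {a | ∃ ζ : Sph d, ∃ r : ℝ, 0 < r ∧ r ≤ Real.pi ∧
      geodist ζ ξ ≤ r ∧ a = r ^ β * av (pf P (npole d)) ζ r}.Nonempty := fun ξ =>
    ⟨_, ξ, Real.pi, Real.pi_pos, le_rfl, geodist_le_pi _ _, rfl⟩
  have hbd : ∀ ξ, geodist (npole d) ξ ∈ Set.Ioo 0 Real.pi →
      BddAbove {a | ∃ ζ : Sph d, ∃ r : ℝ, 0 < r ∧ r ≤ Real.pi ∧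
      geodist ζ ξ ≤ r ∧ a = r ^ β * av (pf P (npole d)) ζ r} := by
    intro ξ hξ
    obtain ⟨M, -, hM⟩ := val_bdd hd hκ hK hβ h (npole d)
      (δ := min (geodist (npole d) ξ) (Real.pi - geodist (npole d) ξ))
      (lt_min hξ.1 (by linarith [hξ.2]))
    refine ⟨M, ?_⟩
    rintro a ⟨ζ, r, h1, h2, h3, rfl⟩
    refine hM ξ ⟨min_le_left _ _, ?_⟩ ζ r h1 h2 h3
    linarith [min_le_right (geodist (npole d) ξ) (Real.pi - geodist (npole d) ξ)]
  have hIcc : ∀ {θ : ℝ}, θ ∈ Set.Ioo 0 Real.pi → geodist (npole d) (γ θ) = θ :=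
    fun hθ => hγp _ ⟨hθ.1.le, hθ.2.le⟩
  refine ⟨γ, fun θ => sphMax β f (γ θ), ⟨hd, hκ, hK, hβ, hβd, h, hγc, hγp, hγd, ?_, ?_⟩, ?_⟩
  · intro θ hθ ζ r h1 h2 h3
    rw [hM]
    exact le_csSup (hbd _ (by rw [hIcc hθ]; exact hθ)) ⟨ζ, r, h1, h2, h3, rfl⟩
  · intro θ hθ a ha
    rw [hM] at ha
    obtain ⟨b, ⟨ζ, r, h1, h2, h3, rfl⟩, hb⟩ := exists_lt_of_lt_csSup (hne _) ha
    exact ⟨ζ, r, h1, h2, h3, hb⟩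
  · intro ξ hξ
    have key : ∀ ξ ξ' : Sph d, geodist (npole d) ξ = geodist (npole d) ξ' →
        {a | ∃ ζ : Sph d, ∃ r : ℝ, 0 < r ∧ r ≤ Real.pi ∧
          geodist ζ ξ ≤ r ∧ a = r ^ β * av (pf P (npole d)) ζ r} ⊆
        {a | ∃ ζ : Sph d, ∃ r : ℝ, 0 < r ∧ r ≤ Real.pi ∧
          geodist ζ ξ' ≤ r ∧ a = r ^ β * av (pf P (npole d)) ζ r} := by
      intro ξ ξ' hg
      rintro a ⟨ζ, r, h1, h2, h3, rfl⟩
      obtain ⟨T, hT1, hT2⟩ := exists_iso_swap ξ ξ'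
      refine ⟨sphIso T ζ, r, h1, h2, ?_, ?_⟩
      · rw [← hT1, geodist_sphIso]; exact h3
      · rw [av_iso hκ hK P _ T (hT2 _ hg) ζ h1.le h2]
    have e : geodist (npole d) ξ = geodist (npole d) (γ (geodist (npole d) ξ)) := (hIcc hξ).symm
    change sphMax β f ξ = sphMax β f (γ (geodist (npole d) ξ))
    rw [hM, hM]
    exact congrArg sSup (Set.Subset.antisymm (key _ _ e) (key _ _ e.symm))

/-! ### The weak gradient of a polar function -/

lemma ae_of_Ioo {d : ℕ} {κ : ℝ} (hK : IsKappa d κ) (q : Sph d) {p : ℝ → Prop}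
    (h : ∀ᵐ θ ∂(volume.restrict (Set.Ioo 0 Real.pi)), p θ) :
    ∀ᵐ η ∂(sphMeasure d), p (geodist q η) := by
  have h1 : ∀ᵐ θ ∂(Measure.map (geodist q) (sphMeasure d)), p θ := by
    rw [hK q]
    have h2 : ENNReal.ofReal κ • sinMeas d ≪ volume.restrict (Set.Ioo 0 Real.pi) :=
      Measure.AbsolutelyContinuous.smul_left (withDensity_absolutelyContinuous _ _) _
    exact h2.ae_le h
  exact ae_of_ae_map (continuous_geodist_right q).measurable.aemeasurable h1

lemma ae_diff_of_lip {U : ℝ → ℝ}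
    (hlip : ∀ δ > 0, ∃ K, LipschitzOnWith K U (Set.Icc δ (Real.pi - δ))) :
    ∀ᵐ θ ∂(volume.restrict (Set.Ioo 0 Real.pi)), DifferentiableAt ℝ U θ := by
  rw [ae_restrict_iff' measurableSet_Ioo]
  have h1 : ∀ n : ℕ, ∀ᵐ θ : ℝ, θ ∈ Set.Icc (1 / ((n : ℝ) + 1)) (Real.pi - 1 / ((n : ℝ) + 1)) →
      DifferentiableWithinAt ℝ U (Set.Icc (1 / ((n : ℝ) + 1)) (Real.pi - 1 / ((n : ℝ) + 1))) θ := by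
    intro n
    obtain ⟨K, hK⟩ := hlip (1 / ((n : ℝ) + 1)) (by positivity)
    exact hK.ae_differentiableWithinAt_of_mem_real
  filter_upwards [ae_all_iff.2 h1] with θ hθ hm
  obtain ⟨n, hn⟩ := exists_nat_one_div_lt (lt_min hm.1 (sub_pos.2 hm.2))
  have a1 := lt_min_iff.1 hn
  have hm2 : θ ∈ Set.Ioo (1 / ((n : ℝ) + 1)) (Real.pi - 1 / ((n : ℝ) + 1)) :=
    ⟨a1.1, by linarith [a1.2]⟩
  exact (hθ n ⟨hm2.1.le, hm2.2.le⟩).differentiableAt (Icc_mem_nhds hm2.1 hm2.2)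

lemma sin_between {θ u : ℝ} (hθ : θ ∈ Set.Ioo 0 Real.pi) (hu : u ∈ Set.uIoc (Real.pi / 2) θ) :
    0 < Real.sin θ ∧ Real.sin θ ≤ Real.sin u := by
  have hp := Real.pi_pos
  refine ⟨Real.sin_pos_of_pos_of_lt_pi hθ.1 hθ.2, ?_⟩
  rcases Set.mem_uIoc.1 hu with h | h
  · rw [← Real.sin_pi_sub θ, ← Real.sin_pi_sub u]
    exact Real.sin_le_sin_of_le_of_le_pi_div_two (by linarith [hθ.2]) (by linarith [h.1])
      (by linarith [h.2])
  · exact Real.sin_le_sin_of_le_of_le_pi_div_two (by linarith [hθ.1]) (by linarith [h.2])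
      (by linarith [h.1])

lemma U_bound (d : ℕ) {U : ℝ → ℝ}
    (hlip : ∀ δ > 0, ∃ K, LipschitzOnWith K U (Set.Icc δ (Real.pi - δ)))
    (hIntU : IntegrableOn (fun θ => |deriv U θ| * Real.sin θ ^ (d - 1)) (Set.Ioo 0 Real.pi))
    {θ : ℝ} (hθ : θ ∈ Set.Ioo 0 Real.pi) :
    |U θ| ≤ |U (Real.pi / 2)| +
      (∫ u in Set.Ioo 0 Real.pi, |deriv U u| * Real.sin u ^ (d - 1)) / Real.sin θ ^ (d - 1) := by
  have hp := Real.pi_pos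
  set I := ∫ u in Set.Ioo 0 Real.pi, |deriv U u| * Real.sin u ^ (d - 1) with hI
  have hs : 0 < Real.sin θ := Real.sin_pos_of_pos_of_lt_pi hθ.1 hθ.2
  obtain ⟨K, hK⟩ := hlip (min θ (Real.pi - θ)) (lt_min hθ.1 (sub_pos.2 hθ.2))
  have hm1 : min θ (Real.pi - θ) ≤ θ := min_le_left _ _
  have hm2 : min θ (Real.pi - θ) ≤ Real.pi - θ := min_le_right _ _
  have hsub : Set.uIcc (Real.pi / 2) θ ⊆ Set.Icc (min θ (Real.pi - θ))
      (Real.pi - min θ (Real.pi - θ)) := by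
    apply Set.uIcc_subset_Icc
    · constructor <;> linarith
    · constructor <;> linarith
  have hAC := (hK.mono hsub).absolutelyContinuousOnInterval
  have hi := hAC.intervalIntegrable_deriv
  have e1 := hAC.integral_deriv_eq_sub
  have hsubI : Set.uIoc (Real.pi / 2) θ ⊆ Set.Ioo 0 Real.pi := by
    intro u hu
    rcases Set.mem_uIoc.1 hu with h | h
    · exact ⟨by linarith [h.1], by linarith [h.2, hθ.2]⟩
    · exact ⟨by linarith [h.1, hθ.1], by linarith [h.2]⟩
  have e2 : |U θ - U (Real.pi / 2)| ≤ ∫ u in Set.uIoc (Real.pi / 2) θ, |deriv U u| := by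
    rw [← e1]
    exact intervalIntegral.norm_integral_le_integral_norm_uIoc (f := deriv U) (μ := volume)
  have e3 : (∫ u in Set.uIoc (Real.pi / 2) θ, |deriv U u|) * Real.sin θ ^ (d - 1) ≤ I := by
    rw [← integral_mul_const]
    calc _ ≤ ∫ u in Set.uIoc (Real.pi / 2) θ, |deriv U u| * Real.sin u ^ (d - 1) := by
          refine setIntegral_mono_on ?_ (hIntU.mono_set hsubI) measurableSet_uIoc ?_
          · exact (intervalIntegrable_iff.1 hi).abs.mul_const _
          · intro u hu
            have := sin_between hθ hu
            exact mul_le_mul_of_nonneg_left (pow_le_pow_left₀ this.1.le this.2 _) (abs_nonneg _)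
      _ ≤ I := by
          refine setIntegral_mono_set hIntU ?_ (LE.le.eventuallyLE hsubI)
          rw [EventuallyLE, ae_restrict_iff' measurableSet_Ioo]
          refine Eventually.of_forall fun u hu => ?_
          have := Real.sin_pos_of_pos_of_lt_pi hu.1 hu.2
          simp only [Pi.zero_apply]
          positivity
  have e4 : |U θ| ≤ |U (Real.pi / 2)| + |U θ - U (Real.pi / 2)| := by
    have := abs_add_le (U (Real.pi / 2)) (U θ - U (Real.pi / 2))
    simpa using this
  refine e4.trans (add_le_add le_rfl (e2.trans ?_))
  rw [le_div_iff₀ (by positivity)]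
  exact e3

/-- truncation of the profile, in the variable `t = cos θ` -/
def psi (U : ℝ → ℝ) (c : ℝ) : ℝ → ℝ := fun t => U (Real.arccos (max (-c) (min t c)))

/-- its derivative -/
def psid (U : ℝ → ℝ) (c : ℝ) : ℝ → ℝ := fun t =>
  (Set.Ioo (-c) c).indicator (fun t => -(deriv U (Real.arccos t) / Real.sqrt (1 - t ^ 2))) t

lemma clamp_mem {c t : ℝ} (hc : 0 < c) : max (-c) (min t c) ∈ Set.Icc (-c) c :=
  ⟨le_max_left _ _, max_le (by linarith) (min_le_right _ _)⟩

lemma clamp_abs {c t : ℝ} (hc : 0 < c) : |max (-c) (min t c)| ≤ |t| := by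
  rcases le_total t 0 with h | h
  · rw [min_eq_left (by linarith), abs_of_nonpos h, abs_of_nonpos (max_le (by linarith) h)]
    linarith [le_max_right (-c) t]
  · have : 0 ≤ min t c := le_min h hc.le
    rw [max_eq_right (by linarith), abs_of_nonneg h, abs_of_nonneg this]
    exact min_le_left _ _

lemma clamp_eq {c t : ℝ} (h : t ∈ Set.Ioo (-c) c) : max (-c) (min t c) = t := by
  rw [min_eq_left h.2.le, max_eq_right h.1.le]

lemma psi_lip {U : ℝ → ℝ}
    (hlip : ∀ δ > 0, ∃ K, LipschitzOnWith K U (Set.Icc δ (Real.pi - δ)))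
    {c : ℝ} (hc : 0 < c) (hc1 : c < 1) : ∃ K, LipschitzWith K (psi U c) := by
  obtain ⟨K, hK⟩ := hlip (Real.arccos c) (Real.arccos_pos.2 hc1)
  have hcd : ContDiffOn ℝ 1 Real.arccos (Set.Icc (-c) c) := fun x hx =>
    (Real.contDiffAt_arccos (by intro h; linarith [hx.1])
      (by intro h; linarith [hx.2])).contDiffWithinAt
  obtain ⟨L, hL⟩ := hcd.exists_lipschitzOnWith (by simp) (convex_Icc _ _) isCompact_Icc
  have hcl : LipschitzWith 1 (fun t : ℝ => max (-c) (min t c)) :=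
    (LipschitzWith.id.min_const c).const_max (-c)
  have hL2 : LipschitzWith (L * 1) (fun t : ℝ => Real.arccos (max (-c) (min t c))) := by
    have := hL.comp (hcl.lipschitzOnWith (s := Set.univ)) (fun t _ => clamp_mem hc)
    rwa [lipschitzOnWith_univ] at this
  refine ⟨K * (L * 1), ?_⟩
  have := hK.comp (hL2.lipschitzOnWith (s := Set.univ)) (fun t _ => by
    have hm := clamp_mem (t := t) hc
    refine ⟨Real.arccos_le_arccos hm.2, ?_⟩
    rw [← Real.arccos_neg]
    exact Real.arccos_le_arccos hm.1)
  rwa [lipschitzOnWith_univ] at this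

lemma psi_deriv {U : ℝ → ℝ} {c : ℝ} (hc : 0 < c) (hc1 : c < 1) {t : ℝ} (ht1 : t ≠ c)
    (ht2 : t ≠ -c) (hU : t ∈ Set.Ioo (-1 : ℝ) 1 → DifferentiableAt ℝ U (Real.arccos t)) :
    HasDerivAt (psi U c) (psid U c t) t := by
  by_cases h : t ∈ Set.Ioo (-c) c
  · have ht : t ∈ Set.Ioo (-1 : ℝ) 1 := ⟨by linarith [h.1], by linarith [h.2]⟩
    have h1 := (hU ht).hasDerivAt.comp t (Real.hasDerivAt_arccos ht.1.ne' ht.2.ne)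
    unfold psid
    rw [Set.indicator_of_mem h]
    have h2 : deriv U (Real.arccos t) * -(1 / Real.sqrt (1 - t ^ 2)) =
        -(deriv U (Real.arccos t) / Real.sqrt (1 - t ^ 2)) := by ring
    rw [← h2]
    refine h1.congr_of_eventuallyEq ?_
    filter_upwards [isOpen_Ioo.mem_nhds h] with s hs
    simp only [psi, clamp_eq hs, Function.comp]
  · unfold psid
    rw [Set.indicator_of_notMem h]
    rcases lt_or_gt_of_ne ht1 with h1 | h1
    · have h2 : t < -c := by
        rcases lt_or_gt_of_ne ht2 with h3 | h3
        · exact h3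
        · exact absurd ⟨h3, h1⟩ h
      refine (hasDerivAt_const t (U (Real.arccos (-c)))).congr_of_eventuallyEq ?_
      filter_upwards [isOpen_Iio.mem_nhds h2] with s hs
      have hs' : s < -c := hs
      simp only [psi]
      rw [min_eq_left (by linarith), max_eq_left hs'.le]
    · refine (hasDerivAt_const t (U (Real.arccos c))).congr_of_eventuallyEq ?_
      filter_upwards [isOpen_Ioi.mem_nhds h1] with s hs
      have hs' : c < s := hs
      simp only [psi]
      rw [min_eq_right hs'.le, max_eq_right (by linarith)]

lemma tangProj_add {d : ℕ} (η : Sph d) (v w : Euc (d + 1)) :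
    tangProj η (v + w) = tangProj η v + tangProj η w := by
  unfold tangProj
  rw [inner_add_left, add_smul]
  abel

lemma tangProj_smul {d : ℕ} (η : Sph d) (a : ℝ) (v : Euc (d + 1)) :
    tangProj η (a • v) = a • tangProj η v := by
  unfold tangProj
  rw [real_inner_smul_left, mul_smul, smul_sub]

lemma tangProj_perp {d : ℕ} (η : Sph d) (v : Euc (d + 1)) :
    ⟪tangProj η v, (η : Euc (d + 1))⟫ = 0 := by
  unfold tangProj
  rw [inner_sub_left, real_inner_smul_left, real_inner_self_eq_norm_sq, norm_sph]
  ring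

lemma norm_tangProj_e {d : ℕ} (η : Sph d) :
    ‖tangProj η (EuclideanSpace.single 0 (1 : ℝ))‖ = Real.sin (geodist (npole d) η) := by
  have h0 : 0 ≤ Real.sin (geodist (npole d) η) :=
    Real.sin_nonneg_of_nonneg_of_le_pi (geodist_nonneg _ _) (geodist_le_pi _ _)
  have h1 : ⟪(EuclideanSpace.single 0 (1 : ℝ) : Euc (d + 1)), (η : Euc (d + 1))⟫
      = (η : Euc (d + 1)) 0 := by
    simp [EuclideanSpace.inner_single_left]
  have h2 : ⟪(EuclideanSpace.single 0 (1 : ℝ) : Euc (d + 1)),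
      (EuclideanSpace.single 0 (1 : ℝ) : Euc (d + 1))⟫ = 1 := by
    simp
  have h3 : ⟪(η : Euc (d + 1)), (EuclideanSpace.single 0 (1 : ℝ) : Euc (d + 1))⟫
      = (η : Euc (d + 1)) 0 := by
    rw [real_inner_comm]; exact h1
  have h4 : ‖tangProj η (EuclideanSpace.single 0 (1 : ℝ))‖ ^ 2
      = Real.sin (geodist (npole d) η) ^ 2 := by
    rw [← real_inner_self_eq_norm_sq]
    unfold tangProj
    rw [inner_sub_left, inner_sub_right, inner_sub_right, real_inner_smul_left,
      real_inner_smul_right, real_inner_smul_left, real_inner_smul_right, h1, h2, h3,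
      real_inner_self_eq_norm_sq, norm_sph, Real.sin_sq, cos_npole]
    ring
  exact (pow_left_inj₀ (norm_nonneg _) h0 (by norm_num)).1 h4

lemma continuous_tangProj {d : ℕ} {k : Sph d → Euc (d + 1)} (hk : Continuous k) :
    Continuous (fun η : Sph d => tangProj η (k η)) := by
  have hin : Continuous (fun η : Sph d => ⟪k η, (η : Euc (d + 1))⟫) :=
    hk.inner continuous_subtype_val
  have hsm : Continuous (fun η : Sph d => ⟪k η, (η : Euc (d + 1))⟫ • (η : Euc (d + 1))) := by
    fun_prop
  exact hk.sub hsm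

lemma sph_bdd {d : ℕ} {E : Type} [NormedAddCommGroup E] {k : Sph d → E} (hk : Continuous k) :
    ∃ C, ∀ η, ‖k η‖ ≤ C := by
  obtain ⟨C, hC⟩ := isCompact_univ.exists_bound_of_continuousOn (f := k) hk.continuousOn
  exact ⟨C, fun η => hC η trivial⟩

lemma psid_measurable (U : ℝ → ℝ) (c : ℝ) : Measurable (psid U c) := by
  unfold psid
  refine Measurable.indicator ?_ measurableSet_Ioo
  have h1 : Measurable fun t => deriv U (Real.arccos t) :=
    (measurable_deriv U).comp Real.continuous_arccos.measurable
  have h2 : Measurable fun t : ℝ => Real.sqrt (1 - t ^ 2) := by fun_prop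
  exact (h1.div h2).neg

lemma trunc_identity {d : ℕ} {κ : ℝ} (hK : IsKappa d κ) {U : ℝ → ℝ}
    (hlip : ∀ δ > 0, ∃ K, LipschitzOnWith K U (Set.Icc δ (Real.pi - δ)))
    {φ : Euc (d + 1) → ℝ} (hφ : ContDiff ℝ (⊤ : ℕ∞) φ) {c : ℝ} (hc : 0 < c) (hc1 : c < 1)
    (j : Fin (d + 1)) :
    ∫ η : Sph d, (φ η * psid U c ((η : Euc (d + 1)) 0)) *
        (tangProj η (EuclideanSpace.single 0 (1 : ℝ))) j ∂(sphMeasure d) =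
      - ∫ η : Sph d, psi U c ((η : Euc (d + 1)) 0) * (tangProj η (gradient φ η)) j ∂(sphMeasure d)
      + d * ∫ η : Sph d, (psi U c ((η : Euc (d + 1)) 0) * φ η) * (η : Euc (d + 1)) j
        ∂(sphMeasure d) := by
  obtain ⟨K, hKl⟩ := psi_lip hlip hc hc1
  have hφc : Continuous (fun η : Sph d => φ η) := hφ.continuous.comp continuous_subtype_val
  have hgc : Continuous (fun η : Sph d => gradient φ η) :=
    (continuous_gradient hφ).comp continuous_subtype_val
  have h0c : Continuous (fun η : Sph d => (η : Euc (d + 1)) 0) := by fun_prop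
  have hψc : Continuous (fun η : Sph d => psi U c ((η : Euc (d + 1)) 0)) :=
    hKl.continuous.comp h0c
  have hψd : Measurable (fun η : Sph d => psid U c ((η : Euc (d + 1)) 0)) :=
    (psid_measurable U c).comp h0c.measurable
  have hcoord : LipschitzOnWith 1 (fun x : Euc (d + 1) => x 0) (Metric.sphere 0 1) := by
    refine LipschitzOnWith.of_dist_le_mul ?_
    intro x _ y _
    rw [dist_eq_norm, dist_eq_norm]
    have := PiLp.norm_apply_le (x - y) 0
    simpa using this
  have hmain := sph_div (fun x : Euc (d + 1) => psi U c (x 0) * φ x)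
    (fun η => (φ η * psid U c ((η : Euc (d + 1)) 0)) • EuclideanSpace.single 0 (1 : ℝ) +
      psi U c ((η : Euc (d + 1)) 0) • gradient φ η)
    (lipOn_mul (isCompact_sphere 0 1)
      ⟨K * 1, (hKl.lipschitzOnWith (s := Set.univ)).comp hcoord (fun _ _ => trivial)⟩
      (lip_sphere_of_contDiff hφ))
    (((hφc.measurable.mul hψd).aestronglyMeasurable.smul_const _).add
      (hψc.smul hgc).aestronglyMeasurable) ?_ j
  · obtain ⟨hi, he⟩ := hmain
    have hsplit : ∀ η : Sph d, (tangProj η ((φ η * psid U c ((η : Euc (d + 1)) 0)) •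
        EuclideanSpace.single 0 (1 : ℝ) + psi U c ((η : Euc (d + 1)) 0) • gradient φ η)) j =
        (φ η * psid U c ((η : Euc (d + 1)) 0)) *
          (tangProj η (EuclideanSpace.single 0 (1 : ℝ))) j +
        psi U c ((η : Euc (d + 1)) 0) * (tangProj η (gradient φ η)) j := by
      intro η
      rw [tangProj_add, tangProj_smul, tangProj_smul]
      simp
    simp only [hsplit] at hi he
    have hcj : Continuous (fun η : Sph d =>
        psi U c ((η : Euc (d + 1)) 0) * (tangProj η (gradient φ η)) j) := by
      have := continuous_tangProj hgc
      exact hψc.mul (by fun_prop)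
    have hi2 : Integrable (fun η : Sph d =>
        psi U c ((η : Euc (d + 1)) 0) * (tangProj η (gradient φ η)) j) (sphMeasure d) := by
      obtain ⟨C, hC⟩ := sph_bdd hcj
      exact Integrable.of_bound hcj.aestronglyMeasurable C (Eventually.of_forall hC)
    have hi1 : Integrable (fun η : Sph d => (φ η * psid U c ((η : Euc (d + 1)) 0)) *
          (tangProj η (EuclideanSpace.single 0 (1 : ℝ))) j) (sphMeasure d) := by
      have := hi.sub hi2
      refine this.congr (Eventually.of_forall fun η => ?_)
      simp
    rw [integral_add hi1 hi2] at he
    linarith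
  · have hbad : ∀ᵐ θ ∂(volume.restrict (Set.Ioo 0 Real.pi)),
        DifferentiableAt ℝ U θ ∧ θ ≠ Real.arccos c ∧ θ ≠ Real.arccos (-c) := by
      have h1 : ∀ a : ℝ, ∀ᵐ θ ∂(volume.restrict (Set.Ioo 0 Real.pi)), θ ≠ a := fun a =>
        ae_restrict_of_ae (by simp [ae_iff])
      filter_upwards [ae_diff_of_lip hlip, h1 (Real.arccos c), h1 (Real.arccos (-c))] with θ a b c
      exact ⟨a, b, c⟩
    filter_upwards [ae_of_Ioo hK (npole d) hbad] with η hη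
    rw [geodist_npole] at hη
    have hd1 := psi_deriv (U := U) hc hc1 (t := (η : Euc (d + 1)) 0)
      (fun h => hη.2.1 (by rw [h])) (fun h => hη.2.2 (by rw [h])) (fun _ => hη.1)
    have hg1 := hasGradientAt_comp0 (psi U c) _ (η : Euc (d + 1)) hd1
    have hg2 : HasGradientAt φ (gradient φ η) (η : Euc (d + 1)) :=
      ((hφ.differentiable (by simp)).differentiableAt).hasGradientAt
    rw [hasGradientAt_iff_hasFDerivAt] at hg1 hg2 ⊢
    have := hg1.mul hg2
    refine this.congr_fderiv ?_
    ext v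
    simp [inner_add_left, inner_smul_left]
    ring

/-- gradient field of the polar function with profile `U` -/
def Grad {d : ℕ} (U : ℝ → ℝ) (ξ : Sph d) : Euc (d + 1) :=
  (-(deriv U (geodist (npole d) ξ) / Real.sin (geodist (npole d) ξ))) •
    tangProj ξ (EuclideanSpace.single 0 (1 : ℝ))

lemma Grad_norm {d : ℕ} (hd : 1 ≤ d) (U : ℝ → ℝ) : ∀ᵐ ξ ∂(sphMeasure d),
    ‖Grad U ξ‖ = |deriv U (geodist (npole d) ξ)| := by
  filter_upwards [ae_Ioo hd (npole d)] with ξ hξ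
  have hs := Real.sin_pos_of_pos_of_lt_pi hξ.1 hξ.2
  unfold Grad
  rw [norm_smul, norm_tangProj_e, norm_neg, norm_div, Real.norm_eq_abs, Real.norm_eq_abs,
    abs_of_pos hs, div_mul_cancel₀ _ hs.ne']

lemma Grad_meas {d : ℕ} (U : ℝ → ℝ) : AEStronglyMeasurable (Grad (d := d) U) (sphMeasure d) := by
  have hθ : Measurable (geodist (npole d)) := (continuous_geodist_right _).measurable
  have h1 : Measurable fun ξ : Sph d => deriv U (geodist (npole d) ξ) :=
    (measurable_deriv U).comp hθ
  have h2 : Measurable fun ξ : Sph d => Real.sin (geodist (npole d) ξ) :=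
    Real.measurable_sin.comp hθ
  exact (h1.div h2).neg.aestronglyMeasurable.smul
    (continuous_tangProj continuous_const).aestronglyMeasurable

lemma recon {d : ℕ} (hd : 1 ≤ d) {κ : ℝ} (hκ : 0 < κ) (hK : IsKappa d κ) {U : ℝ → ℝ}
    (hlip : ∀ δ > 0, ∃ K, LipschitzOnWith K U (Set.Icc δ (Real.pi - δ)))
    (hIntU : IntegrableOn (fun θ => |deriv U θ| * Real.sin θ ^ (d - 1)) (Set.Ioo 0 Real.pi))
    {N : Sph d → ℝ} (hN : ∀ᵐ η ∂(sphMeasure d), N η = U (geodist (npole d) η)) :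
    HasWeakGrad N (Grad U) := by
  refine ⟨Eventually.of_forall fun η => ?_, fun φ hφ => ?_⟩
  · unfold Grad
    rw [real_inner_smul_left, tangProj_perp, mul_zero]
  set θ : Sph d → ℝ := geodist (npole d) with hθ
  have hφc : Continuous (fun η : Sph d => φ η) := hφ.continuous.comp continuous_subtype_val
  have hgc : Continuous (fun η : Sph d => gradient φ η) :=
    (continuous_gradient hφ).comp continuous_subtype_val
  have htc := continuous_tangProj hgc
  have h0c : Continuous (fun η : Sph d => (η : Euc (d + 1)) 0) := by fun_prop
  have hvc : Continuous (fun η : Sph d => φ η • (η : Euc (d + 1))) :=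
    hφc.smul continuous_subtype_val
  -- truncation parameters
  let c : ℕ → ℝ := fun n => 1 - 1 / ((n : ℝ) + 2)
  have hc0 : ∀ n, 0 < c n := by
    intro n
    have : 1 / ((n : ℝ) + 2) < 1 := by
      rw [div_lt_one (by positivity)]
      have : (0 : ℝ) ≤ n := Nat.cast_nonneg n
      linarith
    simp only [c]; linarith
  have hc1 : ∀ n, c n < 1 := by
    intro n
    have : 0 < 1 / ((n : ℝ) + 2) := by positivity
    simp only [c]; linarith
  have hclim : Tendsto c atTop (𝓝 1) := by
    have h1 : Tendsto (fun n : ℕ => 1 / (((n + 1 : ℕ) : ℝ) + 1)) atTop (𝓝 0) :=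
      (tendsto_one_div_add_atTop_nhds_zero_nat (𝕜 := ℝ)).comp (tendsto_add_atTop_nat 1)
    have h2 : Tendsto (fun n : ℕ => 1 - 1 / (((n + 1 : ℕ) : ℝ) + 1)) atTop (𝓝 (1 - 0)) :=
      tendsto_const_nhds.sub h1
    rw [sub_zero] at h2
    refine h2.congr fun n => ?_
    simp only [c]
    push_cast
    ring
  -- good points
  have hgood : ∀ᵐ η ∂(sphMeasure d), N η = U (θ η) ∧ θ η ∈ Set.Ioo 0 Real.pi := by
    filter_upwards [hN, ae_Ioo hd (npole d)] with η h1 h2 using ⟨h1, h2⟩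
  have hev : ∀ η : Sph d, θ η ∈ Set.Ioo 0 Real.pi → ∀ᶠ n in atTop,
      (η : Euc (d + 1)) 0 ∈ Set.Ioo (-(c n)) (c n) := by
    intro η hη
    have hs := Real.sin_pos_of_pos_of_lt_pi hη.1 hη.2
    have h1 : |(η : Euc (d + 1)) 0| < 1 := by
      rw [← cos_npole, ← sq_lt_one_iff_abs_lt_one]
      have := Real.sin_sq_add_cos_sq (geodist (npole d) η)
      have : 0 < Real.sin (geodist (npole d) η) ^ 2 := by positivity
      linarith
    filter_upwards [hclim.eventually (lt_mem_nhds h1)] with n hn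
    exact abs_lt.1 hn
  have hpsi : ∀ η : Sph d, θ η ∈ Set.Ioo 0 Real.pi → ∀ᶠ n in atTop,
      psi U (c n) ((η : Euc (d + 1)) 0) = U (θ η) := by
    intro η hη
    filter_upwards [hev η hη] with n hn
    unfold psi
    rw [clamp_eq hn, ← geodist_npole]
  have hpsid : ∀ η : Sph d, θ η ∈ Set.Ioo 0 Real.pi → ∀ᶠ n in atTop,
      psid U (c n) ((η : Euc (d + 1)) 0) = -(deriv U (θ η) / Real.sin (θ η)) := by
    intro η hη
    filter_upwards [hev η hη] with n hn
    unfold psid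
    rw [Set.indicator_of_mem hn, ← Real.sin_arccos, ← geodist_npole]
  -- dominating functions
  set I := ∫ u in Set.Ioo 0 Real.pi, |deriv U u| * Real.sin u ^ (d - 1) with hI
  have hI0 : 0 ≤ I := setIntegral_nonneg measurableSet_Ioo fun u hu => by
    have := Real.sin_pos_of_pos_of_lt_pi hu.1 hu.2
    positivity
  set B : ℝ → ℝ := fun u => |U (Real.pi / 2)| + I / Real.sin u ^ (d - 1) with hB
  have hBm : Measurable B := by fun_prop
  have hBi : Integrable (fun η => B (θ η)) (sphMeasure d) := by
    rw [hθ, hK.integrable hκ (npole d) hBm]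
    have h1 : IntegrableOn (fun u => |U (Real.pi / 2)| * Real.sin u ^ (d - 1) + I)
        (Set.Ioo 0 Real.pi) := by
      refine (Continuous.integrableOn_Icc (by fun_prop)).mono_set Set.Ioo_subset_Icc_self
    refine h1.congr_fun (fun u hu => ?_) measurableSet_Ioo
    have := Real.sin_pos_of_pos_of_lt_pi hu.1 hu.2
    simp only [hB]
    field_simp
  have hUd : Integrable (fun η => |deriv U (θ η)|) (sphMeasure d) := by
    rw [hθ, hK.integrable hκ (npole d) (k := fun u => |deriv U u|)
      (measurable_norm.comp (measurable_deriv U))]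
    exact hIntU
  have hpb : ∀ n, ∀ η : Sph d, θ η ∈ Set.Ioo 0 Real.pi →
      |psi U (c n) ((η : Euc (d + 1)) 0)| ≤ B (θ η) := by
    intro n η hη
    have hs := Real.sin_pos_of_pos_of_lt_pi hη.1 hη.2
    have hm := clamp_mem (t := (η : Euc (d + 1)) 0) (hc0 n)
    have hab := clamp_abs (t := (η : Euc (d + 1)) 0) (hc0 n)
    set s := max (-(c n)) (min ((η : Euc (d + 1)) 0) (c n)) with hsdef
    have hmem : Real.arccos s ∈ Set.Ioo 0 Real.pi := by
      refine ⟨Real.arccos_pos.2 (hm.2.trans_lt (hc1 n)), ?_⟩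
      have h1 : 0 < Real.arccos (-s) := Real.arccos_pos.2 (by linarith [hm.1, hc1 n])
      rw [Real.arccos_neg] at h1
      linarith
    have h1 := U_bound d hlip hIntU hmem
    refine h1.trans (add_le_add le_rfl ?_)
    refine div_le_div_of_nonneg_left hI0 (by positivity) (pow_le_pow_left₀ hs.le ?_ _)
    rw [hθ, geodist_npole, Real.sin_arccos, Real.sin_arccos]
    refine Real.sqrt_le_sqrt ?_
    have := sq_le_sq.2 hab
    linarith
  have hpdb : ∀ n, ∀ η : Sph d, θ η ∈ Set.Ioo 0 Real.pi →
      |psid U (c n) ((η : Euc (d + 1)) 0)| ≤ |deriv U (θ η)| / Real.sin (θ η) := by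
    intro n η hη
    have hs := Real.sin_pos_of_pos_of_lt_pi hη.1 hη.2
    by_cases h : (η : Euc (d + 1)) 0 ∈ Set.Ioo (-(c n)) (c n)
    · unfold psid
      rw [Set.indicator_of_mem h, ← Real.sin_arccos, ← geodist_npole, abs_neg, abs_div,
        abs_of_pos hs]
    · unfold psid
      rw [Set.indicator_of_notMem h, abs_zero]
      positivity
  have hψc : ∀ n, Continuous (fun η : Sph d => psi U (c n) ((η : Euc (d + 1)) 0)) := by
    intro n
    obtain ⟨K, hKl⟩ := psi_lip hlip (hc0 n) (hc1 n)
    exact hKl.continuous.comp h0c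
  have hψd : ∀ n, Measurable (fun η : Sph d => psid U (c n) ((η : Euc (d + 1)) 0)) := fun n =>
    (psid_measurable U (c n)).comp h0c.measurable
  -- integrability of the limits
  have hNm : AEStronglyMeasurable N (sphMeasure d) := by
    refine aestronglyMeasurable_of_tendsto_ae atTop
      (f := fun n (η : Sph d) => psi U (c n) ((η : Euc (d + 1)) 0))
      (fun n => (hψc n).aestronglyMeasurable) ?_
    filter_upwards [hgood] with η hη
    rw [hη.1]
    exact tendsto_const_nhds.congr' ((hpsi η hη.2).mono fun n h => h.symm)
  have hNi : Integrable N (sphMeasure d) := by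
    refine hBi.mono' hNm ?_
    filter_upwards [hgood] with η hη
    rw [hη.1]
    exact U_bound d hlip hIntU hη.2
  have hGi : Integrable (Grad (d := d) U) (sphMeasure d) := by
    refine hUd.mono' (Grad_meas U) ?_
    filter_upwards [Grad_norm hd U] with η hη using hη.le
  have i1 : Integrable (fun η : Sph d => φ η • Grad U η) (sphMeasure d) := by
    obtain ⟨C, hC⟩ := sph_bdd hφc
    exact hGi.bdd_smul C (hφc.aestronglyMeasurable) (Eventually.of_forall hC)
  have i2 : Integrable (fun η : Sph d => N η • tangProj η (gradient φ (η : Euc (d + 1))))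
      (sphMeasure d) := by
    obtain ⟨C, hC⟩ := sph_bdd htc
    exact hNi.smul_bdd C (htc.aestronglyMeasurable) (Eventually.of_forall hC)
  have i3 : Integrable (fun η : Sph d => (N η * φ η) • (η : Euc (d + 1))) (sphMeasure d) := by
    obtain ⟨C, hC⟩ := sph_bdd hvc
    simp_rw [mul_smul]
    exact hNi.smul_bdd C (hvc.aestronglyMeasurable) (Eventually.of_forall hC)
  ext j
  let L : Euc (d + 1) →L[ℝ] ℝ := PiLp.proj (𝕜 := ℝ) 2 (fun _ : Fin (d + 1) => ℝ) j
  change L (∫ η : Sph d, φ η • Grad U η ∂(sphMeasure d)) =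
    L (-∫ η : Sph d, N η • tangProj η (gradient φ (η : Euc (d + 1))) ∂(sphMeasure d) +
      (d : ℝ) • ∫ η : Sph d, (N η * φ η) • (η : Euc (d + 1)) ∂(sphMeasure d))
  rw [← L.integral_comp_comm i1, map_add, map_neg, map_smul, ← L.integral_comp_comm i2,
    ← L.integral_comp_comm i3]
  change ∫ η : Sph d, φ η * (Grad U η) j ∂(sphMeasure d) =
    - ∫ η : Sph d, N η * (tangProj η (gradient φ η)) j ∂(sphMeasure d) +
      d * ∫ η : Sph d, (N η * φ η) * (η : Euc (d + 1)) j ∂(sphMeasure d)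
  have hcj : ∀ {k : Sph d → Euc (d + 1)}, Continuous k → Continuous fun η => k η j := by
    intro k hk
    fun_prop
  have t1 : Tendsto (fun n => ∫ η : Sph d, (φ η * psid U (c n) ((η : Euc (d + 1)) 0)) *
        (tangProj η (EuclideanSpace.single 0 (1 : ℝ))) j ∂(sphMeasure d)) atTop
      (𝓝 (∫ η : Sph d, φ η * (Grad U η) j ∂(sphMeasure d))) := by
    obtain ⟨C, hC⟩ := sph_bdd hφc
    refine tendsto_integral_of_dominated_convergence (fun η => C * |deriv U (θ η)|)
      (fun n => ((hφc.measurable.mul (hψd n)).mul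
        (hcj (continuous_tangProj continuous_const)).measurable).aestronglyMeasurable)
      (hUd.const_mul C) (fun n => ?_) ?_
    · filter_upwards [hgood] with η hη
      have hs := Real.sin_pos_of_pos_of_lt_pi hη.2.1 hη.2.2
      rw [norm_mul, norm_mul, mul_assoc]
      have b1 := hpdb n η hη.2
      have b2 : ‖(tangProj η (EuclideanSpace.single 0 (1 : ℝ))) j‖ ≤ Real.sin (θ η) := by
        rw [hθ, ← norm_tangProj_e]
        exact PiLp.norm_apply_le _ j
      have b3 : ‖psid U (c n) ((η : Euc (d + 1)) 0)‖ *
          ‖(tangProj η (EuclideanSpace.single 0 (1 : ℝ))) j‖ ≤ |deriv U (θ η)| := by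
        calc _ ≤ |deriv U (θ η)| / Real.sin (θ η) * Real.sin (θ η) :=
              mul_le_mul b1 b2 (norm_nonneg _) (by positivity)
          _ = _ := div_mul_cancel₀ _ hs.ne'
      exact mul_le_mul (hC η) b3 (by positivity) ((norm_nonneg _).trans (hC η))
    · filter_upwards [hgood] with η hη
      refine tendsto_const_nhds.congr' ((hpsid η hη.2).mono fun n h => ?_)
      beta_reduce
      rw [h]
      simp only [Grad, PiLp.smul_apply, smul_eq_mul, hθ]
      ring
  have t23 : ∀ {k : Sph d → ℝ}, Continuous k →
      Tendsto (fun n => ∫ η : Sph d, psi U (c n) ((η : Euc (d + 1)) 0) * k η ∂(sphMeasure d)) atTop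
      (𝓝 (∫ η : Sph d, N η * k η ∂(sphMeasure d))) := by
    intro k hk
    obtain ⟨C, hC⟩ := sph_bdd hk
    refine tendsto_integral_of_dominated_convergence (fun η => B (θ η) * C)
      (fun n => ((hψc n).mul hk).aestronglyMeasurable)
      (hBi.mul_const C) (fun n => ?_) ?_
    · filter_upwards [hgood] with η hη
      rw [norm_mul]
      have := hpb n η hη.2
      exact mul_le_mul this (hC η) (norm_nonneg _) ((abs_nonneg _).trans this)
    · filter_upwards [hgood] with η hη
      refine tendsto_const_nhds.congr' ((hpsi η hη.2).mono fun n h => ?_)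
      beta_reduce
      rw [h, hη.1]
  have t2 := t23 (hcj htc)
  have t3 := t23 (hφc.mul (hcj (continuous_subtype_val : Continuous fun η : Sph d => (η : Euc (d + 1)))))
  simp only [Pi.mul_apply, ← mul_assoc] at t3
  refine tendsto_nhds_unique t1 ?_
  refine (t2.neg.add (t3.const_mul (d : ℝ))).congr fun n => ?_
  exact (trunc_identity hK hlip hφ (hc0 n) (hc1 n) j).symm

lemma integrable_of_q (d : ℕ) {q : ℝ} (hq : 1 ≤ q) {U : ℝ → ℝ}
    (h : ∫⁻ θ in Set.Ioo 0 Real.pi, ENNReal.ofReal (|deriv U θ| ^ q * Real.sin θ ^ (d - 1)) ≠ ⊤) :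
    IntegrableOn (fun θ => |deriv U θ| * Real.sin θ ^ (d - 1)) (Set.Ioo 0 Real.pi) := by
  have hm : Measurable fun θ => |deriv U θ| := measurable_norm.comp (measurable_deriv U)
  have hsin : ∀ θ ∈ Set.Ioo 0 Real.pi, 0 ≤ Real.sin θ ^ (d - 1) := fun θ hθ =>
    pow_nonneg (Real.sin_pos_of_pos_of_lt_pi hθ.1 hθ.2).le _
  have h1 : IntegrableOn (fun θ => |deriv U θ| ^ q * Real.sin θ ^ (d - 1)) (Set.Ioo 0 Real.pi) := by
    refine (lintegral_ofReal_ne_top_iff_integrable (by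
      exact ((hm.pow_const q).mul (by fun_prop)).aestronglyMeasurable) ?_).1 h
    rw [EventuallyLE, ae_restrict_iff' measurableSet_Ioo]
    refine Eventually.of_forall fun θ hθ => ?_
    have := hsin θ hθ
    simp only [Pi.zero_apply]
    positivity
  have h2 : IntegrableOn (fun θ => Real.sin θ ^ (d - 1)) (Set.Ioo 0 Real.pi) :=
    (Continuous.integrableOn_Icc (by fun_prop)).mono_set Set.Ioo_subset_Icc_self
  refine (h2.add h1).mono' (hm.mul (by fun_prop)).aestronglyMeasurable ?_
  rw [ae_restrict_iff' measurableSet_Ioo]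
  refine Eventually.of_forall fun θ hθ => ?_
  have h3 := hsin θ hθ
  rw [norm_mul, Real.norm_eq_abs, Real.norm_eq_abs, abs_abs, abs_of_nonneg h3]
  have h4 : |deriv U θ| ≤ 1 + |deriv U θ| ^ q := by
    rcases le_total |deriv U θ| 1 with h5 | h5
    · have : 0 ≤ |deriv U θ| ^ q := by positivity
      linarith
    · have := Real.rpow_le_rpow_of_exponent_le h5 hq
      rw [Real.rpow_one] at this
      linarith
  have := mul_le_mul_of_nonneg_right h4 h3
  simp only [Pi.add_apply]
  linarith

lemma grad_norm_bound {d : ℕ} (hd : 1 ≤ d) {κ q C V : ℝ} (hκ : 0 < κ) (hK : IsKappa d κ)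
    (hq : 1 ≤ q) (hC : 0 ≤ C) (hV : 0 ≤ V) {U : ℝ → ℝ}
    (h : ∫⁻ θ in Set.Ioo 0 Real.pi, ENNReal.ofReal (|deriv U θ| ^ q * Real.sin θ ^ (d - 1)) ≤
      ENNReal.ofReal (C * V ^ q)) :
    eLpNorm (Grad (d := d) U) (ENNReal.ofReal q) (sphMeasure d) ≤
      ENNReal.ofReal ((κ * C) ^ (1 / q) * V) := by
  have hq0 : 0 < q := by linarith
  have hm : Measurable fun θ => |deriv U θ| := measurable_norm.comp (measurable_deriv U)
  rw [eLpNorm_eq_lintegral_rpow_enorm_toReal (by simpa using hq0) (by simp),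
    ENNReal.toReal_ofReal hq0.le]
  have e1 : ∫⁻ ξ, ‖Grad (d := d) U ξ‖ₑ ^ q ∂(sphMeasure d) =
      ∫⁻ ξ, ENNReal.ofReal (|deriv U (geodist (npole d) ξ)| ^ q) ∂(sphMeasure d) := by
    refine lintegral_congr_ae ?_
    filter_upwards [Grad_norm hd U] with ξ hξ
    rw [← ofReal_norm, hξ, ENNReal.ofReal_rpow_of_nonneg (abs_nonneg _) hq0.le]
  rw [e1, hK.lintegral (npole d) (k := fun u => ENNReal.ofReal (|deriv U u| ^ q))
    (hm.pow_const q).ennreal_ofReal]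
  have e2 : ∫⁻ u in Set.Ioo 0 Real.pi, ENNReal.ofReal (Real.sin u ^ (d - 1)) *
      ENNReal.ofReal (|deriv U u| ^ q) ≤ ENNReal.ofReal (C * V ^ q) := by
    refine le_trans (le_of_eq ?_) h
    refine setLIntegral_congr_fun measurableSet_Ioo fun u hu => ?_
    have := Real.sin_pos_of_pos_of_lt_pi hu.1 hu.2
    rw [mul_comm (|deriv U u| ^ q), ENNReal.ofReal_mul (by positivity)]
  have e3 := mul_le_mul_right e2 (ENNReal.ofReal κ)
  rw [← ENNReal.ofReal_mul hκ.le] at e3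
  refine (ENNReal.rpow_le_rpow e3 (by positivity)).trans (le_of_eq ?_)
  rw [ENNReal.ofReal_rpow_of_nonneg (by positivity) (by positivity), ← mul_assoc,
    Real.mul_rpow (by positivity) (by positivity), ← Real.rpow_mul hV, mul_one_div_cancel hq0.ne',
    Real.rpow_one]

/-- **Boundedness.** Let `0 < β < d` and `q = d/(d-β)`. Then for every polar
`f ∈ W^{1,1}(𝕊^d)`, the maximal function `𝓜̃_β f` is weakly differentiable and
`‖∇𝓜̃_β f‖_q ≤ C(d,β) ‖∇f‖_1`. -/
theorem boundedness_sphere_polar (d : ℕ) (hd : 1 ≤ d) (β q : ℝ) (hβ0 : 0 < β)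
    (hβd : β < d) (hq : q = d / (d - β)) :
    ∃ C : ℝ, 0 < C ∧ ∀ (f : Sph d → ℝ) (g : Sph d → Euc (d + 1)),
      MemW11 f g → IsPolar f →
      ∃ G : Sph d → Euc (d + 1), HasWeakGrad (sphMax β f) G ∧
        eLpNorm G (ENNReal.ofReal q) (sphMeasure d) ≤
          ENNReal.ofReal (C * ∫ ξ, ‖g ξ‖ ∂(sphMeasure d)) := by
  obtain ⟨κ, hκ0, hK⟩ := polar_map hd
  rcases hκ0.eq_or_lt with hκ | hκ
  · have hz : sphMeasure d = 0 := by
      rw [← Measure.measure_univ_eq_zero, IsKappa.univ hd (κ := κ) hK, ← hκ]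
      simp
    refine ⟨1, one_pos, fun f g _ _ => ⟨0, ⟨by simp [hz], fun φ _ => by simp [hz]⟩, ?_⟩⟩
    simp
  have hK' : IsKappa d κ := hK
  have hdβ : (0 : ℝ) < d - β := by linarith
  have hq1 : 1 ≤ q := by
    rw [hq, le_div_iff₀ hdβ]
    linarith
  obtain ⟨C, hC0, hC⟩ := Dat.full hd hβ0 hβd hq
  refine ⟨(κ * C) ^ (1 / q) / κ + 1, by positivity, fun f g hfg hpol => ?_⟩
  obtain ⟨P, D, hone, hf, hV⟩ := extract hd hκ hK' hfg hpol
  obtain ⟨γ, U, hdat, hU⟩ := dat_exists hd hκ hK' hβ0 hβd hone hf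
  have hfull := hC κ _ γ P D U hdat
  have hN : ∀ᵐ η ∂(sphMeasure d), sphMax β f η = U (geodist (npole d) η) := by
    filter_upwards [ae_Ioo hd (npole d)] with η hη using hU η hη
  have hIntU := integrable_of_q d hq1 (ne_top_of_le_ne_top ENNReal.ofReal_ne_top hfull)
  refine ⟨Grad U, recon hd hκ hK' (fun δ hδ => hdat.lip hδ) hIntU hN, ?_⟩
  refine (grad_norm_bound hd hκ hK' hq1 hC0 ENNReal.toReal_nonneg hfull).trans ?_
  refine ENNReal.ofReal_le_ofReal ?_
  have hg0 : 0 ≤ ∫ ξ, ‖g ξ‖ ∂(sphMeasure d) := integral_nonneg fun _ => norm_nonneg _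
  have hV2 : κ * (VV d D).toReal ≤ ∫ ξ, ‖g ξ‖ ∂(sphMeasure d) := by
    have h1 := ENNReal.toReal_mono ENNReal.ofReal_ne_top hV
    rw [ENNReal.toReal_mul, ENNReal.toReal_ofReal hκ.le, ENNReal.toReal_ofReal hg0] at h1
    exact h1
  have hA : 0 ≤ (κ * C) ^ (1 / q) / κ := by positivity
  calc (κ * C) ^ (1 / q) * (VV d D).toReal
      = (κ * C) ^ (1 / q) / κ * (κ * (VV d D).toReal) := by field_simp
    _ ≤ (κ * C) ^ (1 / q) / κ * ∫ ξ, ‖g ξ‖ ∂(sphMeasure d) := mul_le_mul_of_nonneg_left hV2 hA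
    _ ≤ _ := by nlinarith

end
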